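/- Assume either (a) d ≠ 0 and (s,ε) ∈ S[d], or (b) d = 0 and (s,ε) ∈ S (in case (b) read Y(s,ε) and Y_<(s,ε) for Y(s,ε)[d] and Y_<(s,ε)[d]). Then Y(s,ε)[d] and Y_<(s,ε)[d] are kSp(V)-submodules of k[V], Y_<(s,ε)[d] is properly contained in Y(s,ε)[d], and every kSp(V)-submodule of k[V] that is properly contained in Y(s,ε)[d] is contained in Y_<(s,ε)[d]; that is, Y_<(s,ε)[d] is the unique maximal kSp(V)-submodule of Y(s,ε)[d]. -/

import Mathlib

open scoped Classical

noncomputable section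

/-- The `2m`-dimensional standard symplectic space over `k = F_q = GaloisField p t`:
pairs `(x,y)` of `m`-tuples; the coordinates are `x_i(v) = v.1 i`, `y_i(v) = v.2 i`. -/
abbrev SympV (p t m : ℕ) [Fact p.Prime] : Type :=
  (Fin m → GaloisField p t) × (Fin m → GaloisField p t)

/-- The nonsingular alternating bilinear form
`⟨(x,y),(x',y')⟩ = Σ_i (x_i y'_i − y_i x'_i)`. -/
def sform {p t m : ℕ} [Fact p.Prime] (v w : SympV p t m) : GaloisField p t :=
  ∑ i, (v.1 i * w.2 i - v.2 i * w.1 i)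

/-- Membership in the symplectic group `Sp(V)`: a linear automorphism of `V`
preserving the form. -/
def IsSymp {p t m : ℕ} [Fact p.Prime]
    (g : SympV p t m ≃ₗ[GaloisField p t] SympV p t m) : Prop :=
  ∀ v w, sform (g v) (g w) = sform v w

/-- A `k`-subspace `M` of `k[V]` is `Sp(V)`-stable (a `kSp(V)`-submodule) if it is
closed under the action `(g·f)(v) = f(g⁻¹v)`. -/
def SpStable {p t m : ℕ} [Fact p.Prime]
    (M : Submodule (GaloisField p t) (SympV p t m → GaloisField p t)) : Prop :=
  ∀ g : SympV p t m ≃ₗ[GaloisField p t] SympV p t m, IsSymp g →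
    ∀ h ∈ M, (fun v => h (g.symm v)) ∈ M

/-- The monomial `x^α y^β = ∏_i x_i^{α_i} y_i^{β_i}` as a function `V → k`. -/
def mono {p t m : ℕ} [Fact p.Prime] (α β : Fin m → ℕ) :
    SympV p t m → GaloisField p t :=
  fun v => ∏ i, (v.1 i ^ α i * v.2 i ^ β i)

/-- The complementary multi-index `ᾱ = (p−1−α₁,…,p−1−α_m)`. -/
def abar (p : ℕ) {m : ℕ} (α : Fin m → ℕ) : Fin m → ℕ := fun i => p - 1 - α i

/-- `α! = ∏_i α_i!`, computed in the prime field `F_p ⊆ k`. -/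
def factk (p t : ℕ) [Fact p.Prime] {m : ℕ} (α : Fin m → ℕ) : GaloisField p t :=
  ∏ i, ((α i).factorial : GaloisField p t)

/-- Allowable `j`-th digit of a symplectic basis function, of degree `lam`;
`pl` records whether this digit counts towards the signature (a monomial
`x^α y^{ᾱ}` or a '+' binomial when `lam = m(p−1)`). -/
def IsDigit (p t m lam : ℕ) [Fact p.Prime] (pl : Prop)
    (g : SympV p t m → GaloisField p t) : Prop :=
  (lam ≠ m * (p - 1) ∧ ¬pl ∧
    ∃ α β : Fin m → ℕ, (∀ i, α i ≤ p - 1) ∧ (∀ i, β i ≤ p - 1) ∧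
      (∑ i, α i) + (∑ i, β i) = lam ∧ g = mono α β) ∨
  (lam = m * (p - 1) ∧ pl ∧
    ∃ α : Fin m → ℕ, (∀ i, α i ≤ p - 1) ∧ g = mono α (abar p α)) ∨
  (lam = m * (p - 1) ∧
    ∃ α β : Fin m → ℕ, (∀ i, α i ≤ p - 1) ∧ (∀ i, β i ≤ p - 1) ∧
      (∑ i, α i) + (∑ i, β i) = m * (p - 1) ∧ β ≠ abar p α ∧
      g = mono α β +
        ((if pl then (1 : GaloisField p t) else -1) *
          ((-1) ^ ((∑ i, β i) + m) * factk p t α * factk p t β)) •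
            mono (abar p β) (abar p α))

/-- `f` is a symplectic basis function of type `λ` with signature `ε`:
`f = f₀·f₁^p⋯f_{t−1}^{p^{t−1}}` with every digit `f_j` allowable of degree `λ_j`,
and `ε` is the set of digits of '+' kind. -/
def IsSBF (p t m : ℕ) [Fact p.Prime] (lam : Fin t → ℕ) (eps : Finset (Fin t))
    (f : SympV p t m → GaloisField p t) : Prop :=
  ∃ g : Fin t → (SympV p t m → GaloisField p t),
    (∀ j, IsDigit p t m (lam j) (j ∈ eps) (g j)) ∧
    f = fun v => ∏ j, (g j v) ^ (p ^ (j : ℕ))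

/-- The `j`-th `p`-adic digit of `d`. -/
def digitp (p d j : ℕ) : ℕ := d / p ^ j % p

/-- The type `λ` attached to a tuple `s` (for `d`): `λ_j = p·s_{j+1} − s_j + d_j`,
indices mod `t`. -/
def lamOf (p t d : ℕ) [NeZero t] (s : Fin t → ℤ) (j : Fin t) : ℤ :=
  (p : ℤ) * s (j + 1) - s j + digitp p d (j : ℕ)

/-- The type of `s` as a tuple of naturals. -/
def lamOfN (p t d : ℕ) [NeZero t] (s : Fin t → ℤ) (j : Fin t) : ℕ :=
  (lamOf p t d s j).toNat

/-- Membership in `H[d]`: `0 ≤ s_j ≤ 2m−1` and `0 ≤ λ_j ≤ 2m(p−1)` for all `j`. -/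
def memHd (p t m d : ℕ) [NeZero t] (s : Fin t → ℤ) : Prop :=
  (∀ j, 0 ≤ s j ∧ s j ≤ 2 * m - 1) ∧
  (∀ j, 0 ≤ lamOf p t d s j ∧ lamOf p t d s j ≤ 2 * m * ((p : ℤ) - 1))

/-- Membership in `H`: `1 ≤ s_j ≤ 2m−1` and `0 ≤ p·s_{j+1} − s_j ≤ 2m(p−1)`. -/
def memH (p t m : ℕ) [NeZero t] (s : Fin t → ℤ) : Prop :=
  (∀ j, 1 ≤ s j ∧ s j ≤ 2 * m - 1) ∧
  (∀ j, 0 ≤ lamOf p t 0 s j ∧ lamOf p t 0 s j ≤ 2 * m * ((p : ℤ) - 1))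

/-- `J(s) = {j : λ_j = m(p−1)}`. -/
def Jset (p t m d : ℕ) [NeZero t] (s : Fin t → ℤ) : Finset (Fin t) :=
  Finset.univ.filter (fun j => lamOf p t d s j = m * ((p : ℤ) - 1))

/-- Membership in `S[d]`: `s ∈ H[d]` and `ε ⊆ J(s)`. -/
def memSd (p t m d : ℕ) [NeZero t] (s : Fin t → ℤ) (eps : Finset (Fin t)) : Prop :=
  memHd p t m d s ∧ eps ⊆ Jset p t m d s

/-- Membership in `S`: `s ∈ H` and `ε ⊆ J(s)` (with `d = 0`). -/
def memS (p t m : ℕ) [NeZero t] (s : Fin t → ℤ) (eps : Finset (Fin t)) : Prop :=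
  memH p t m s ∧ eps ⊆ Jset p t m 0 s

/-- Case distinction: for `d ≠ 0` the relevant poset is `S[d]`, for `d = 0` it is `S`. -/
def memCase (p t m d : ℕ) [NeZero t] (s : Fin t → ℤ) (eps : Finset (Fin t)) : Prop :=
  if d = 0 then memS p t m s eps else memSd p t m d s eps

/-- `Z(s',s) = {j : s'_j = s_j, s'_{j+1} = s_{j+1}, λ'_j = m(p−1)}`. -/
def Zset (p t m d : ℕ) [NeZero t] (s' s : Fin t → ℤ) : Finset (Fin t) :=
  Finset.univ.filter (fun j =>
    s' j = s j ∧ s' (j + 1) = s (j + 1) ∧ lamOf p t d s' j = m * ((p : ℤ) - 1))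

/-- The order on `S[d]` (and on `S`): `(s',ε') ≤ (s,ε)` iff `s' ≤ s` pointwise and
`ε ∩ Z(s',s) = ε' ∩ Z(s',s)`. -/
def leSd (p t m d : ℕ) [NeZero t] (s' : Fin t → ℤ) (eps' : Finset (Fin t))
    (s : Fin t → ℤ) (eps : Finset (Fin t)) : Prop :=
  (∀ j, s' j ≤ s j) ∧ eps ∩ Zset p t m d s' s = eps' ∩ Zset p t m d s' s

/-- `Y(s,ε)[d]` (for `d ≠ 0`), resp. `Y(s,ε)` (for `d = 0`): the span in `k[V]` of all
symplectic basis functions with signed `H`-type `(s',ε') ≤ (s,ε)` in `S[d]`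
(resp. in `S`). -/
def Ymod (p t m d : ℕ) [Fact p.Prime] [NeZero t] (s : Fin t → ℤ)
    (eps : Finset (Fin t)) :
    Submodule (GaloisField p t) (SympV p t m → GaloisField p t) :=
  Submodule.span (GaloisField p t)
    {f | ∃ s' eps', memCase p t m d s' eps' ∧ leSd p t m d s' eps' s eps ∧
      IsSBF p t m (lamOfN p t d s') eps' f}

/-- `Y_<(s,ε)[d]`: the span of the symplectic basis functions with signed `H`-type
strictly below `(s,ε)`. -/
def Yltmod (p t m d : ℕ) [Fact p.Prime] [NeZero t] (s : Fin t → ℤ)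
    (eps : Finset (Fin t)) :
    Submodule (GaloisField p t) (SympV p t m → GaloisField p t) :=
  Submodule.span (GaloisField p t)
    {f | ∃ s' eps', memCase p t m d s' eps' ∧ leSd p t m d s' eps' s eps ∧
      ¬(s' = s ∧ eps' = eps) ∧ IsSBF p t m (lamOfN p t d s') eps' f}

set_option linter.all false

section PartA
open MvPolynomial

/-- index set of the `2m` variables -/
abbrev Ix (m : ℕ) := Fin m ⊕ Fin m
/-- exponents -/
abbrev Ex (m : ℕ) := Ix m →₀ ℕ

def mkE {m : ℕ} (f : Ix m → ℕ) : Ex m := Finsupp.equivFunOnFinite.symm f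
@[simp] theorem mkE_apply {m : ℕ} (f : Ix m → ℕ) (a : Ix m) : mkE f a = f a := rfl

def topE (p m : ℕ) : Ex m := mkE fun _ => p - 1
def swE {m : ℕ} (g : Ex m) : Ex m := mkE fun a => g a.swap
def twE (p : ℕ) {m : ℕ} (g : Ex m) : Ex m := mkE fun a => p - 1 - g a.swap

@[simp] theorem topE_apply {p m : ℕ} (a : Ix m) : topE p m a = p - 1 := rfl
@[simp] theorem swE_apply {m : ℕ} (g : Ex m) (a : Ix m) : swE g a = g a.swap := rfl
@[simp] theorem twE_apply {p m : ℕ} (g : Ex m) (a : Ix m) : twE p g a = p - 1 - g a.swap := rfl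

theorem le_topE {p m : ℕ} (g : Ex m) : g ≤ topE p m ↔ ∀ a, g a ≤ p - 1 := Iff.rfl

theorem deg_eq {m : ℕ} (g : Ex m) : g.degree = ∑ a, g a := by
  rw [Finsupp.degree_eq_sum]

theorem deg_eq' {m : ℕ} (g : Ex m) : g.degree = (∑ i, g (.inl i)) + ∑ i, g (.inr i) := by
  rw [deg_eq, Fintype.sum_sum_type]

theorem swE_swE {m : ℕ} (g : Ex m) : swE (swE g) = g := by ext a; simp

theorem twE_le {p m : ℕ} (g : Ex m) : twE p g ≤ topE p m := by intro a; simp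

theorem twE_twE {p m : ℕ} {g : Ex m} (h : g ≤ topE p m) : twE p (twE p g) = g := by
  ext a; have := h a; simp at this ⊢; omega

theorem deg_sw {m : ℕ} (g : Ex m) : (swE g).degree = g.degree := by
  simp [deg_eq', add_comm]

theorem deg_top {p m : ℕ} : (topE p m).degree = 2 * (m * (p - 1)) := by
  simp [deg_eq']; ring

theorem deg_tw {p m : ℕ} {g : Ex m} (h : g ≤ topE p m) :
    (twE p g).degree + g.degree = 2 * (m * (p - 1)) := by
  rw [← deg_sw g, ← deg_top, ← map_add]
  congr 1; ext a; have := h a.swap; simp at this ⊢; omega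

variable {K : Type} [Field K] {p : ℕ} [Fact p.Prime] [CharP K p] {m : ℕ}

def fct (K : Type) [Field K] {m : ℕ} (g : Ex m) : K := ∏ a, ((g a).factorial : K)
def wE (K : Type) [Field K] {m : ℕ} (g : Ex m) : K := (-1) ^ (∑ i, g (.inr i)) * fct K g
def sgE (K : Type) [Field K] {m : ℕ} (g : Ex m) : K := (-1) ^ ((∑ i, g (.inr i)) + m) * fct K g
def pm (K : Type) [Field K] (pl : Prop) : K := if pl then 1 else -1

theorem pm_sq (pl : Prop) : pm K pl * pm K pl = 1 := by unfold pm; split_ifs <;> simp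

theorem fact_ne {n : ℕ} (h : n ≤ p - 1) : (n.factorial : K) ≠ 0 := by
  have hp := (Fact.out : p.Prime)
  rw [Ne, CharP.cast_eq_zero_iff K p, hp.dvd_factorial]
  have := hp.pos
  omega

theorem fact_zero {n : ℕ} (h : ¬ n ≤ p - 1) : (n.factorial : K) = 0 := by
  have hp := (Fact.out : p.Prime)
  rw [CharP.cast_eq_zero_iff K p, hp.dvd_factorial]
  omega

theorem fct_ne {g : Ex m} (h : g ≤ topE p m) : fct K g ≠ 0 :=
  Finset.prod_ne_zero_iff.2 fun a _ => fact_ne (p := p) (h a)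

theorem fct_zero {g : Ex m} (h : ¬ g ≤ topE p m) : fct K g = 0 := by
  rw [le_topE] at h; push Not at h
  obtain ⟨a, ha⟩ := h
  exact Finset.prod_eq_zero (Finset.mem_univ a) (fact_zero (p := p) (by omega))

theorem wilson_gen (n : ℕ) (h : n ≤ p - 1) :
    (n.factorial : K) * ((p - 1 - n).factorial : K) = (-1) ^ (n + 1) := by
  have hp := (Fact.out : p.Prime)
  induction n with
  | zero =>
    have h1 : ((p-1).factorial : ZMod p) = -1 := ZMod.wilsons_lemma p
    have h2 := congrArg (ZMod.castHom (dvd_refl p) K) h1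
    rw [map_natCast, map_neg, map_one] at h2
    simp [h2]
  | succ n ih =>
    have h1 := ih (by omega)
    have h2 : p - 1 - n = (p - 1 - (n+1)) + 1 := by omega
    rw [h2, Nat.factorial_succ] at h1
    have h3 : ((p - 1 - (n+1) + 1 : ℕ) : K) = -((n:K)+1) := by
      have : ((p - 1 - (n+1) + 1 : ℕ) : K) + ((n + 1 : ℕ) : K) = 0 := by
        rw [← Nat.cast_add, show p - 1 - (n+1) + 1 + (n+1) = p by omega, CharP.cast_eq_zero]
      push_cast at this ⊢
      linear_combination this
    rw [Nat.factorial_succ]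
    rw [Nat.cast_mul, h3] at h1
    push_cast
    rw [pow_succ, ← h1]; ring

theorem neg_one_p (hodd : Odd p) : (-1 : K) ^ (p - 1) = 1 := by
  obtain ⟨r, rfl⟩ := hodd
  simp

theorem fct_tw {g : Ex m} (h : g ≤ topE p m) :
    fct K (twE p g) * fct K g = (-1) ^ (g.degree) := by
  have h1 : fct K (twE p g) = ∏ a, ((p - 1 - g a).factorial : K) := by
    unfold fct
    exact Fintype.prod_equiv (Equiv.sumComm _ _) _ _ (by simp)
  rw [h1, fct, ← Finset.prod_mul_distrib]
  have : ∀ a ∈ Finset.univ, ((p - 1 - g a).factorial : K) * ((g a).factorial : K) = (-1) ^ (g a + 1) := by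
    intro a _; rw [mul_comm]; exact wilson_gen _ (h a)
  rw [Finset.prod_congr rfl this, Finset.prod_pow_eq_pow_sum, Finset.sum_add_distrib, deg_eq]
  simp [pow_add, ← two_mul, pow_mul]

theorem neg_one_pow_sub (hodd : Odd p) {n : ℕ} (h : n ≤ p - 1) : (-1 : K) ^ (p - 1 - n) = (-1) ^ n := by
  have h1 := neg_one_p (K := K) hodd
  rw [show p - 1 = (p - 1 - n) + n by omega, pow_add] at h1
  have h2 : ((-1 : K) ^ n) * (-1) ^ n = 1 := by rw [← pow_add, ← two_mul, pow_mul]; simp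
  linear_combination (-1 : K) ^ n * h1 - (-1 : K) ^ (p - 1 - n) * h2

theorem sq_neg_pow (n : ℕ) : ((-1 : K) ^ n) * (-1) ^ n = 1 := by
  rw [← pow_add, ← two_mul, pow_mul]; simp

theorem sg_tw (hodd : Odd p) {g : Ex m} (h : g ≤ topE p m) : sgE K (twE p g) * sgE K g = 1 := by
  have h1 : (-1 : K) ^ (∑ i, (twE p g) (.inr i)) = (-1) ^ (∑ i, g (.inl i)) := by
    rw [← Finset.prod_pow_eq_pow_sum, ← Finset.prod_pow_eq_pow_sum]
    exact Finset.prod_congr rfl fun i _ => neg_one_pow_sub hodd (h _)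
  have h2 := fct_tw (K := K) h
  unfold sgE
  rw [pow_add, h1, pow_add]
  rw [deg_eq', pow_add] at h2
  have a1 := sq_neg_pow (K := K) m
  have a2 := sq_neg_pow (K := K) (∑ i, g (.inl i))
  have a3 := sq_neg_pow (K := K) (∑ i, g (.inr i))
  calc _ = ((-1 : K) ^ (∑ i, g (.inl i)) * (-1) ^ (∑ i, g (.inr i))) * ((-1) ^ m * (-1) ^ m) * (fct K (twE p g) * fct K g) := by ring
    _ = _ := by rw [h2, a1, mul_one]; rw [mul_mul_mul_comm, a2, a3, one_mul]

theorem fct_tw_sq (hodd : Odd p) {g : Ex m} (h : g ≤ topE p m) (hd : g.degree = m * (p - 1)) :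
    fct K (twE p g) * (sgE K g * sgE K g) = fct K g := by
  have h2 := fct_tw (K := K) h
  rw [hd, mul_comm m, pow_mul, neg_one_p hodd, one_pow] at h2
  unfold sgE
  have a3 := sq_neg_pow (K := K) (∑ i, g (.inr i) + m)
  linear_combination fct K (twE p g) * (fct K g)^2 * a3 + fct K g * h2

theorem sg_self {g : Ex m} (h : g ≤ topE p m) (ht : twE p g = g) : sgE K g = 1 := by
  unfold sgE fct
  rw [Fintype.prod_sum_type, ← Finset.prod_mul_distrib]
  have : ∀ i ∈ Finset.univ, ((g (.inl i)).factorial : K) * ((g (.inr i)).factorial : K) = (-1) ^ (g (.inr i) + 1) := by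
    intro i _
    have h1 : g (.inl i) = p - 1 - g (.inr i) := by
      conv_lhs => rw [← ht]
      simp
    rw [h1, mul_comm]; exact wilson_gen _ (h _)
  rw [Finset.prod_congr rfl this, Finset.prod_pow_eq_pow_sum, Finset.sum_add_distrib]
  simpa using sq_neg_pow (K := K) (∑ i, g (.inr i) + m)

theorem deg_of_self {g : Ex m} (h : g ≤ topE p m) (ht : twE p g = g) : g.degree = m * (p - 1) := by
  have := deg_tw h
  rw [ht] at this; omega

theorem tw_inj {g g' : Ex m} (h : g ≤ topE p m) (h' : g' ≤ topE p m) (e : twE p g = twE p g') : g = g' := by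
  rw [← twE_twE h, e, twE_twE h']

/-- sign-symmetric digit polynomials -/
def SSg (p m : ℕ) (lam : ℕ) (pl : Prop) (F : MvPolynomial (Ix m) K) : Prop :=
  F.IsHomogeneous lam ∧ (lam = m * (p - 1) → ∀ g : Ex m, g ≤ topE p m → g.degree = m * (p - 1) →
    coeff (twE p g) F = pm K pl * sgE K g * coeff g F)

def GenD (K : Type) [Field K] (p m : ℕ) (lam : ℕ) (pl : Prop) : Set (MvPolynomial (Ix m) K) :=
  {F | ∃ g : Ex m, g ≤ topE p m ∧ g.degree = lam ∧
    ((lam ≠ m * (p - 1) ∧ ¬ pl ∧ F = monomial g 1) ∨ (lam = m * (p-1) ∧ pl ∧ twE p g = g ∧ F = monomial g 1) ∨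
     (lam = m * (p-1) ∧ twE p g ≠ g ∧ F = monomial g 1 + monomial (twE p g) (pm K pl * sgE K g)))}

def NRD (K : Type) [Field K] (p m : ℕ) (lam : ℕ) : Set (MvPolynomial (Ix m) K) :=
  {F | ∃ g : Ex m, ¬ g ≤ topE p m ∧ g.degree = lam ∧ F = monomial g 1}

theorem pr_coeff (hodd : Odd p) (pl : Prop) {g : Ex m} (h : g ≤ topE p m)
    (d : Ex m) (hd : d ≤ topE p m) :
    coeff (twE p d) (monomial g 1 + monomial (twE p g) (pm K pl * sgE K g)) =
      pm K pl * sgE K d * coeff d (monomial g 1 + monomial (twE p g) (pm K pl * sgE K g)) := by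
  simp only [coeff_add, coeff_monomial]
  have hs := sg_tw (K := K) hodd h
  have hpm := pm_sq (K := K) pl
  have e1 : (g = twE p d) ↔ (twE p g = d) :=
    ⟨fun e => by rw [e, twE_twE hd], fun e => by rw [← e, twE_twE h]⟩
  have e2 : (twE p g = twE p d) ↔ (g = d) := ⟨fun e => tw_inj h hd e, fun e => by rw [e]⟩
  simp only [e1, e2]
  have h3 : twE p g = d → pm K pl * sgE K d * (pm K pl * sgE K g) = 1 := by
    rintro rfl
    linear_combination (pm K pl * pm K pl) * hs + hpm
  by_cases c1 : g = d <;> by_cases c2 : twE p g = d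
  · rw [if_pos c1, if_pos c2, if_pos c1, if_pos c2]
    have h4 := h3 c2
    rw [c1] at h4 ⊢
    linear_combination -h4
  · simp [c1, c2]
    subst c1; simp [c2]
  · simp [c1, c2, h3]
    
  · simp [c1, c2]

theorem monomial_hom {g : Ex m} {n : ℕ} (c : K) (h : g.degree = n) : (monomial g c).IsHomogeneous n :=
  isHomogeneous_monomial c h

theorem pr_hom {g : Ex m} (pl : Prop) (h : g ≤ topE p m) (hd : g.degree = m * (p-1)) :
    (monomial g 1 + monomial (twE p g) (pm K pl * sgE K g)).IsHomogeneous (m * (p - 1)) := by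
  refine (monomial_hom _ hd).add (monomial_hom _ ?_)
  have := deg_tw h; omega

theorem pr_SSg (hodd : Odd p) (pl : Prop) {g : Ex m} (h : g ≤ topE p m) (hd : g.degree = m * (p-1)) :
    SSg p m (m * (p-1)) pl (monomial g 1 + monomial (twE p g) (pm K pl * sgE K g)) :=
  ⟨pr_hom pl h hd, fun _ d hd1 _ => pr_coeff hodd pl h d hd1⟩

theorem self_SSg {pl : Prop} (hpl : pl) {g : Ex m} (h : g ≤ topE p m) (ht : twE p g = g) (n : ℕ)
    (hn : g.degree = n) :
    SSg p m n pl (monomial g (1 : K)) := by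
  refine ⟨monomial_hom _ hn, fun _ d hd _ => ?_⟩
  simp only [coeff_monomial]
  by_cases c : g = d
  · subst c; simp [ht, pm, hpl, sg_self h ht]
  · have : ¬ g = twE p d := fun e => c (by rw [← ht, e, twE_twE hd])
    simp [c, this]

theorem mono_SSg (pl : Prop) {g : Ex m} {n : ℕ} (hn : g.degree = n) (hne : n ≠ m * (p-1)) :
    SSg p m n pl (monomial g (1 : K)) := ⟨monomial_hom _ hn, fun h => absurd h hne⟩

theorem GenD_SSg (hodd : Odd p) {lam : ℕ} {pl : Prop} {F : MvPolynomial (Ix m) K}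
    (hF : F ∈ GenD K p m lam pl) : SSg p m lam pl F := by
  obtain ⟨g, h, hd, (⟨h1, h2, rfl⟩ | ⟨h1, h2, h3, rfl⟩ | ⟨h1, h2, rfl⟩)⟩ := hF
  · exact mono_SSg pl hd h1
  · exact self_SSg h2 h h3 _ hd
  · subst h1; exact pr_SSg hodd pl h hd

/-- homogeneous with no reduced terms is spanned by nonreduced monomials -/
theorem mem_span_NRD {lam : ℕ} {F : MvPolynomial (Ix m) K} (hF : F.IsHomogeneous lam)
    (h0 : ∀ g ≤ topE p m, coeff g F = 0) : F ∈ Submodule.span K (NRD K p m lam) := by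
  rw [F.as_sum]
  refine Submodule.sum_mem _ fun g hg => ?_
  rw [mem_support_iff] at hg
  have : monomial g (coeff g F) = coeff g F • (monomial g (1:K)) := by simp [smul_monomial]
  rw [this]
  refine Submodule.smul_mem _ _ (Submodule.subset_span ⟨g, fun h => hg (h0 g h), ?_, rfl⟩)
  by_contra hne
  exact hg (hF.coeff_eq_zero hne)

theorem two_ne (hodd : Odd p) : (2 : K) ≠ 0 := by
  have : p ≠ 2 := by rintro rfl; exact absurd hodd (by decide)
  exact Ring.two_ne_zero (by rwa [ringChar.eq K p])

theorem pr_mem_span {pl : Prop} {g : Ex m} (h : g ≤ topE p m) (hd : g.degree = m * (p-1)) :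
    (monomial g 1 + monomial (twE p g) (pm K pl * sgE K g)) ∈ Submodule.span K (GenD K p m (m * (p-1)) pl) := by
  by_cases ht : twE p g = g
  · rw [ht, sg_self h ht]
    by_cases hpl : pl
    · have : (monomial g (1:K)) ∈ Submodule.span K (GenD K p m (m * (p-1)) pl) :=
        Submodule.subset_span ⟨g, h, hd, Or.inr (Or.inl ⟨rfl, hpl, ht, rfl⟩)⟩
      simpa [pm, hpl] using Submodule.add_mem _ this this
    · rw [← map_add]; simp [pm, hpl]
  · exact Submodule.subset_span ⟨g, h, hd, Or.inr (Or.inr ⟨rfl, ht, rfl⟩)⟩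

theorem SSg_mem_span (hodd : Odd p) {lam : ℕ} {pl : Prop} (hpl : pl → lam = m * (p-1))
    {F : MvPolynomial (Ix m) K} (hF : SSg p m lam pl F) :
    F ∈ Submodule.span K (GenD K p m lam pl ∪ NRD K p m lam) := by
  rw [Submodule.span_union]
  obtain ⟨hh, hs⟩ := hF
  by_cases hl : lam = m * (p - 1)
  · subst hl
    let S : Finset (Ex m) := (Finset.Iic (topE p m)).filter fun g => g.degree = m * (p - 1)
    let R := ∑ g ∈ S, coeff g F • (monomial g 1 + monomial (twE p g) (pm K pl * sgE K g))
    have hS : ∀ g ∈ S, g ≤ topE p m ∧ g.degree = m * (p-1) := by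
      intro g hg; simpa [S] using hg
    have hR : R ∈ Submodule.span K (GenD K p m (m * (p-1)) pl) :=
      Submodule.sum_mem _ fun g hg => Submodule.smul_mem _ _ (pr_mem_span (hS g hg).1 (hS g hg).2)
    have hRh : R.IsHomogeneous (m * (p-1)) := by
      refine IsHomogeneous.sum _ _ _ fun g hg => ?_
      rw [smul_eq_C_mul]; exact (pr_hom pl (hS g hg).1 (hS g hg).2).C_mul _
    have hN : (2 : K) • F - R ∈ Submodule.span K (NRD K p m (m * (p-1))) := by
      refine mem_span_NRD ?_ ?_
      · rw [smul_eq_C_mul]; exact (hh.C_mul _).sub hRh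
      intro d hd
      by_cases hdd : d.degree = m * (p-1)
      · have ht := deg_tw hd
        have hdS : d ∈ S := by simp [S, hd, hdd]
        have htS : twE p d ∈ S := by simp [S, twE_le]; omega
        have hc : coeff d R = 2 * coeff d F := by
          simp only [R, coeff_sum, coeff_smul, coeff_add, coeff_monomial, smul_eq_mul, mul_add, Finset.sum_add_distrib]
          have e1 : ∑ g ∈ S, coeff g F * (if g = d then 1 else 0) = coeff d F := by
            simp [hdS]
          have e2 : ∑ g ∈ S, coeff g F * (if twE p g = d then pm K pl * sgE K g else 0) = coeff d F := by
            rw [Finset.sum_eq_single (twE p d)]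
            · rw [if_pos (twE_twE hd), mul_comm, ← hs rfl _ (twE_le d) (by omega), twE_twE hd]
            · intro g hg hne
              rw [if_neg, mul_zero]
              intro e; apply hne; rw [← e, twE_twE (hS g hg).1]
            · intro h; exact absurd htS h
          rw [e1, e2]; ring
        simp [hc]
      · rw [(IsHomogeneous.sub (by rw [smul_eq_C_mul]; exact hh.C_mul _) hRh).coeff_eq_zero hdd]
    have : F = (2:K)⁻¹ • (R + ((2 : K) • F - R)) := by
      rw [add_sub_cancel, smul_smul, inv_mul_cancel₀ (two_ne (p := p) hodd), one_smul]
    rw [this]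
    exact Submodule.smul_mem _ _ (Submodule.add_mem_sup hR hN)
  · have hpl' : ¬ pl := fun h => hl (hpl h)
    rw [F.as_sum]
    refine Submodule.sum_mem _ fun g hg => ?_
    rw [mem_support_iff] at hg
    have hgd : g.degree = lam := by
      by_contra hne; exact hg (hh.coeff_eq_zero hne)
    have : monomial g (coeff g F) = coeff g F • (monomial g (1:K)) := by simp [smul_monomial]
    rw [this]
    refine Submodule.smul_mem _ _ ?_
    by_cases hr : g ≤ topE p m
    · exact Submodule.mem_sup_left (Submodule.subset_span ⟨g, hr, hgd, Or.inl ⟨hl, hpl', rfl⟩⟩)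
    · exact Submodule.mem_sup_right (Submodule.subset_span ⟨g, hr, hgd, rfl⟩)

theorem hom_mem_span (hodd : Odd p) {lam : ℕ} {F : MvPolynomial (Ix m) K} (hF : F.IsHomogeneous lam) :
    F ∈ Submodule.span K ((GenD K p m lam True ∪ GenD K p m lam False) ∪ NRD K p m lam) := by
  rw [F.as_sum]
  refine Submodule.sum_mem _ fun g hg => ?_
  rw [mem_support_iff] at hg
  have hgd : g.degree = lam := by
    by_contra hne; exact hg (hF.coeff_eq_zero hne)
  have : monomial g (coeff g F) = coeff g F • (monomial g (1:K)) := by simp [smul_monomial]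
  rw [this]
  refine Submodule.smul_mem _ _ ?_
  by_cases hr : g ≤ topE p m
  · rw [Submodule.span_union, Submodule.span_union]
    refine Submodule.mem_sup_left ?_
    by_cases hl : lam = m * (p - 1)
    · subst hl
      have h1 := pr_mem_span (K := K) (pl := True) hr hgd
      have h2 := pr_mem_span (K := K) (pl := False) hr hgd
      have h3 := Submodule.add_mem_sup h1 h2
      have h4 := Submodule.smul_mem _ (2:K)⁻¹ h3
      convert h4 using 1
      have h2' := two_ne (K := K) (p := p) hodd
      simp only [pm, if_true, if_false, smul_add, smul_monomial, smul_eq_mul]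
      ext d
      simp only [coeff_add, coeff_monomial]
      split_ifs <;> field_simp <;> ring
    · exact Submodule.mem_sup_right (Submodule.subset_span ⟨g, hr, hgd, Or.inl ⟨hl, not_false, rfl⟩⟩)
  · exact Submodule.subset_span (Or.inr ⟨g, hr, hgd, rfl⟩)

end PartA

section PartA2
open MvPolynomial
variable {K : Type} [Field K] {p : ℕ} [Fact p.Prime] [CharP K p] {m : ℕ}

/-- linear substitution -/
def thA (A : Matrix (Ix m) (Ix m) K) : MvPolynomial (Ix m) K →ₐ[K] MvPolynomial (Ix m) K :=
  aeval fun a => ∑ b, C (A a b) * X b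

@[simp] theorem thA_X (A : Matrix (Ix m) (Ix m) K) (a : Ix m) : thA A (X a) = ∑ b, C (A a b) * X b := by
  simp [thA]

theorem thA_hom (A : Matrix (Ix m) (Ix m) K) {n : ℕ} {F : MvPolynomial (Ix m) K} (h : F.IsHomogeneous n) :
    (thA A F).IsHomogeneous n := by
  have := h.aeval (S := K) (fun a => ∑ b, C (A a b) * X b) (n := 1) (fun a =>
    IsHomogeneous.sum _ _ _ fun b _ => (isHomogeneous_X _ _).C_mul _)
  rwa [one_mul] at this

theorem thA_comp (A B : Matrix (Ix m) (Ix m) K) (F : MvPolynomial (Ix m) K) :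
    thA A (thA B F) = thA (B * A) F := by
  have : (thA A).comp (thA B) = thA (B * A) := by
    ext1 a
    simp only [AlgHom.comp_apply, thA_X, map_sum, map_mul, Matrix.mul_apply]
    simp only [← MvPolynomial.algebraMap_eq, AlgHom.commutes, thA_X, Finset.mul_sum, Finset.sum_mul]
    rw [Finset.sum_comm]
    refine Finset.sum_congr rfl fun b _ => Finset.sum_congr rfl fun c _ => ?_
    ring
  exact DFunLike.congr_fun this F

theorem thA_one (F : MvPolynomial (Ix m) K) : thA 1 F = F := by
  have : thA (1 : Matrix (Ix m) (Ix m) K) = AlgHom.id K _ := by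
    ext1 a
    simp [Matrix.one_apply]
  rw [this]; rfl

theorem pderiv_thA (A : Matrix (Ix m) (Ix m) K) (b : Ix m) (H : MvPolynomial (Ix m) K) :
    pderiv b (thA A H) = ∑ a, C (A a b) * thA A (pderiv a H) := by
  induction H using MvPolynomial.induction_on with
  | C r => simp [← MvPolynomial.algebraMap_eq, -algebraMap_eq]
  | add f g hf hg => simp only [map_add, hf, hg, mul_add, Finset.sum_add_distrib]
  | mul_X f n hf =>
    rw [map_mul, Derivation.leibniz, hf]
    simp only [Derivation.leibniz, smul_eq_mul, map_add, map_mul, pderiv_X, thA_X, map_sum, pderiv_C, mul_zero, add_zero, zero_add]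
    simp only [Pi.single_apply, mul_ite, mul_one, mul_zero, Finset.sum_ite_eq', Finset.sum_ite_eq, Finset.mem_univ, if_true, mul_add, Finset.sum_add_distrib, apply_ite (thA A), map_one, map_zero]
    rw [Finset.mul_sum]
    congr 1
    · simp [mul_comm]
    · refine Finset.sum_congr rfl fun a _ => by ring

def sgnI (K : Type) [Field K] {m : ℕ} : Ix m → K := Sum.elim (fun _ => 1) (fun _ => -1)

def Bf (K : Type) [Field K] (m : ℕ) : MvPolynomial (Ix m) K →ₗ[K] MvPolynomial (Ix m) K →ₗ[K] K :=
  (basisMonomials (Ix m) K).constr K fun g => wE K g • lcoeff K (swE g)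

theorem Bf_monomial (g : Ex m) (c : K) (H : MvPolynomial (Ix m) K) :
    Bf K m (monomial g c) H = c * (wE K g * coeff (swE g) H) := by
  have h1 : monomial g c = c • (basisMonomials (Ix m) K g) := by simp [smul_monomial]
  rw [h1, map_smul, Bf, Module.Basis.constr_basis]
  simp [lcoeff_apply]

theorem wE_add (g : Ex m) (a : Ix m) :
    wE K (g + Finsupp.single a 1) = wE K g * sgnI K a * (g a + 1) := by
  have h1 : fct K (g + Finsupp.single a 1) = fct K g * (g a + 1) := by
    unfold fct
    rw [← Finset.mul_prod_erase _ _ (Finset.mem_univ a), ← Finset.mul_prod_erase _ _ (Finset.mem_univ a)]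
    have : ∏ x ∈ Finset.univ.erase a, (((g + Finsupp.single a 1 : Ex m) x).factorial : K) = ∏ x ∈ Finset.univ.erase a, ((g x).factorial : K) := by
      refine Finset.prod_congr rfl fun x hx => ?_
      rw [Finset.mem_erase] at hx
      simp [Finsupp.single_apply, Ne.symm hx.1]
    rw [this]
    simp [Nat.factorial_succ]; ring
  unfold wE
  rw [h1]
  cases a with
  | inl i => simp [sgnI, Finsupp.single_apply]; ring
  | inr i => simp [sgnI, Finsupp.single_apply, Finset.sum_add_distrib, pow_succ]; ring

theorem Bf_X_mul (a : Ix m) (F H : MvPolynomial (Ix m) K) :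
    Bf K m (F * X a) H = sgnI K a * Bf K m F (pderiv a.swap H) := by
  induction F using MvPolynomial.induction_on' with
  | monomial g c =>
    rw [X, monomial_mul, Bf_monomial, Bf_monomial, wE_add, coeff_pderiv]
    have : swE (g + Finsupp.single a 1) = swE g + Finsupp.single a.swap 1 := by
      ext b
      simp only [swE_apply, Finsupp.add_apply, Finsupp.single_apply]
      congr 1
      have : (a = b.swap) ↔ (a.swap = b) := ⟨fun e => by simp [e], fun e => by simp [← e]⟩
      simp [this]
    rw [this]
    simp; ring
  | add f g hf hg => rw [add_mul, map_add, LinearMap.add_apply, hf, hg, map_add, LinearMap.add_apply]; ring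

theorem Bf_C (c : K) (H : MvPolynomial (Ix m) K) : Bf K m (C c) H = c * coeff 0 H := by
  have : (C c : MvPolynomial (Ix m) K) = monomial 0 c := rfl
  rw [this, Bf_monomial]
  have : swE (0 : Ex m) = 0 := by ext; simp
  rw [this]
  simp [wE, fct]

theorem coeff0_thA (A : Matrix (Ix m) (Ix m) K) (H : MvPolynomial (Ix m) K) : coeff 0 (thA A H) = coeff 0 H := by
  induction H using MvPolynomial.induction_on with
  | C r => simp [thA]
  | add f g hf hg => simp [hf, hg]
  | mul_X f n hf =>
    simp only [map_mul, thA_X, ← constantCoeff_eq]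
    simp

theorem omega_id (A : Matrix (Ix m) (Ix m) K) (hA : A ∈ Matrix.symplecticGroup (Fin m) K) (a c : Ix m) :
    ∑ b, A a b * sgnI K b * A c b.swap = if c = a.swap then sgnI K a else 0 := by
  rw [SymplecticGroup.mem_iff] at hA
  have h := congrFun (congrFun hA a) c
  simp only [Matrix.mul_apply, Matrix.transpose_apply, Fintype.sum_sum_type, Matrix.J, Matrix.fromBlocks_apply₁₁,
    Matrix.fromBlocks_apply₁₂, Matrix.fromBlocks_apply₂₁, Matrix.fromBlocks_apply₂₂, Matrix.zero_apply, Matrix.one_apply, Matrix.neg_apply,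
    mul_zero, Finset.sum_const_zero, zero_add, add_zero, mul_neg, mul_ite, mul_one, Finset.sum_neg_distrib, Finset.sum_ite_eq', Finset.mem_univ, if_true] at h
  simp only [Fintype.sum_sum_type, sgnI, Sum.elim_inl, Sum.elim_inr, Sum.swap_inl, Sum.swap_inr]
  have h2 : (Matrix.fromBlocks 0 (-1) 1 0 : Matrix (Ix m) (Ix m) K) a c = - (if c = a.swap then sgnI K a else 0) := by
    rcases a with a | a <;> rcases c with c | c <;> simp [sgnI, Matrix.one_apply, eq_comm] <;> split_ifs <;> simp
  rw [h2] at h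
  simp only [sgnI] at h
  simp only [mul_one, mul_neg, neg_mul, Finset.sum_neg_distrib] at h ⊢
  linear_combination -h

theorem Bf_inv (A : Matrix (Ix m) (Ix m) K) (hA : A ∈ Matrix.symplecticGroup (Fin m) K)
    (F H : MvPolynomial (Ix m) K) : Bf K m (thA A F) (thA A H) = Bf K m F H := by
  induction F using MvPolynomial.induction_on generalizing H with
  | C r =>
    have : thA A (C r) = C r := by simp [thA]
    rw [this, Bf_C, Bf_C, coeff0_thA]
  | add f g hf hg => rw [map_add, map_add, LinearMap.add_apply, hf, hg, map_add, LinearMap.add_apply]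
  | mul_X F a hF =>
    rw [map_mul, thA_X, Finset.mul_sum, map_sum, LinearMap.sum_apply]
    have h1 : ∀ b ∈ Finset.univ, Bf K m (thA A F * (C (A a b) * X b)) (thA A H) =
        ∑ c, (A a b * sgnI K b * A c b.swap) * Bf K m F (pderiv c H) := by
      intro b _
      rw [mul_left_comm, ← smul_eq_C_mul, map_smul, LinearMap.smul_apply, Bf_X_mul, pderiv_thA, map_sum, smul_eq_mul,
        Finset.mul_sum, Finset.mul_sum]
      refine Finset.sum_congr rfl fun c _ => ?_
      rw [← smul_eq_C_mul, map_smul, hF, smul_eq_mul]; ring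
    rw [Finset.sum_congr rfl h1, Finset.sum_comm]
    simp_rw [← Finset.sum_mul, omega_id A hA]
    rw [Bf_X_mul]
    simp

/-- top coefficient -/
theorem top_nr (F : MvPolynomial (Ix m) K) (b : Ix m) : coeff (topE p m) (X b ^ p * F) = 0 := by
  have hp := (Fact.out : p.Prime).pos
  rw [X_pow_eq_monomial, coeff_monomial_mul', if_neg]
  intro h
  have := h b
  simp at this; omega

theorem split_nr {g : Ex m} (h : ¬ g ≤ topE p m) : ∃ a, ∃ g' : Ex m, g = Finsupp.single a p + g' := by
  rw [le_topE] at h; push Not at h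
  obtain ⟨a, ha⟩ := h
  refine ⟨a, g - Finsupp.single a p, (add_tsub_cancel_of_le ?_).symm⟩
  rw [Finsupp.single_le_iff]; omega

theorem thA_Xp (A : Matrix (Ix m) (Ix m) K) (a : Ix m) :
    thA A (X a ^ p) = ∑ b, C (A a b ^ p) * X b ^ p := by
  rw [map_pow, thA_X, sum_pow_char]
  simp [mul_pow]

theorem red_nr {g : Ex m} (hg : g ≤ topE p m) (F : MvPolynomial (Ix m) K) (b : Ix m) : coeff g (X b ^ p * F) = 0 := by
  have hp := (Fact.out : p.Prime).pos
  rw [X_pow_eq_monomial, coeff_monomial_mul', if_neg]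
  intro h
  have := h b
  have := hg b
  simp at *; omega

theorem top_thA_nr (A : Matrix (Ix m) (Ix m) K) {g : Ex m} (h : ¬ g ≤ topE p m) (c : K) :
    coeff (topE p m) (thA A (monomial g c)) = 0 := by
  obtain ⟨a, g', rfl⟩ := split_nr h
  rw [show monomial (Finsupp.single a p + g') c = X a ^ p * monomial g' c by
    rw [X_pow_eq_monomial, monomial_mul, one_mul], map_mul, thA_Xp, Finset.sum_mul, coeff_sum]
  refine Finset.sum_eq_zero fun b _ => ?_
  rw [mul_assoc, coeff_C_mul, top_nr, mul_zero]

theorem eq_top {g : Ex m} (h : g ≤ topE p m) (hd : g.degree = 2 * (m * (p-1))) : g = topE p m := by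
  rw [← deg_top] at hd
  ext a
  rw [deg_eq, deg_eq] at hd
  exact (Finset.sum_eq_sum_iff_of_le (fun i _ => h i)).1 hd a (Finset.mem_univ a)

theorem top_thA (A : Matrix (Ix m) (Ix m) K) {F : MvPolynomial (Ix m) K} (hF : F.IsHomogeneous (2 * (m * (p-1)))) :
    coeff (topE p m) (thA A F) = coeff (topE p m) F * coeff (topE p m) (thA A (monomial (topE p m) 1)) := by
  conv_lhs => rw [F.as_sum]
  rw [map_sum, coeff_sum]
  by_cases ht : topE p m ∈ F.support
  · rw [Finset.sum_eq_single_of_mem _ ht]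
    · have : monomial (topE p m) (coeff (topE p m) F) = coeff (topE p m) F • monomial (topE p m) (1:K) := by simp [smul_monomial]
      rw [this, map_smul, coeff_smul, smul_eq_mul]
    · intro g hg hne
      apply top_thA_nr
      intro hle
      apply hne
      refine eq_top hle ?_
      by_contra hc
      exact (mem_support_iff.1 hg) (hF.coeff_eq_zero hc)
  · rw [notMem_support_iff.1 ht, zero_mul]
    refine Finset.sum_eq_zero fun g hg => ?_
    apply top_thA_nr
    intro hle
    apply ht
    rw [← eq_top hle ?_]; exact hg
    by_contra hc
    exact (mem_support_iff.1 hg) (hF.coeff_eq_zero hc)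

theorem top_monomial : (monomial (topE p m) (1:K)) = ∏ a : Ix m, X a ^ (p - 1) := by
  rw [monomial_eq]
  simp [Finsupp.prod_fintype]

theorem top_det (A : Matrix (Ix m) (Ix m) K) (hA : A.det ≠ 0) :
    coeff (topE p m) (thA A (monomial (topE p m) 1)) = A.det ^ (p - 1) := by
  refine Matrix.diagonal_transvection_induction_of_det_ne_zero
    (fun A => coeff (topE p m) (thA A (monomial (topE p m) 1)) = A.det ^ (p - 1)) A hA ?_ ?_ ?_
  · intro D hD
    have : thA (Matrix.diagonal D) (monomial (topE p m) 1) = C (∏ a, D a ^ (p-1)) * monomial (topE p m) 1 := by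
      rw [top_monomial, map_prod, map_prod, ← Finset.prod_mul_distrib]
      refine Finset.prod_congr rfl fun a _ => ?_
      rw [map_pow, thA_X]
      simp [Matrix.diagonal_apply, mul_pow, apply_ite C, ite_mul, -Fintype.sum_sum_type]
    rw [this, coeff_C_mul, coeff_monomial, if_pos rfl, mul_one, Matrix.det_diagonal, Finset.prod_pow]
  · intro τ
    rw [Matrix.TransvectionStruct.det, one_pow]
    obtain ⟨i, j, hij, c⟩ := τ
    have hX : ∀ a, thA (Matrix.TransvectionStruct.toMatrix ⟨i, j, hij, c⟩) (X a) = X a + (if a = i then C c * X j else 0) := by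
      intro a
      rw [thA_X]
      simp only [Matrix.TransvectionStruct.toMatrix, Matrix.transvection, Matrix.add_apply, Matrix.one_apply, map_add, add_mul, Finset.sum_add_distrib, Matrix.single_apply]
      congr 1
      · simp
      · by_cases h : i = a
        · subst h; simp [apply_ite C, ite_mul, -Fintype.sum_sum_type]
        · simp [h, Ne.symm h]
    rw [top_monomial, map_prod, ← Finset.mul_prod_erase _ _ (Finset.mem_univ i), map_pow, hX, if_pos rfl]
    have h1 : ∏ x ∈ Finset.univ.erase i, thA (Matrix.TransvectionStruct.toMatrix ⟨i, j, hij, c⟩) (X x ^ (p-1)) =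
        ∏ x ∈ Finset.univ.erase i, X x ^ (p-1) := by
      refine Finset.prod_congr rfl fun x hx => ?_
      rw [map_pow, hX, if_neg (Finset.ne_of_mem_erase hx), add_zero]
    rw [h1]
    obtain ⟨R, hR⟩ : ∃ R, (X i + C c * X j : MvPolynomial (Ix m) K) ^ (p-1) = X i ^ (p-1) + X j * R := by
      have : (X j : MvPolynomial (Ix m) K) ∣ (X i + C c * X j) ^ (p-1) - X i ^ (p-1) := by
        refine dvd_trans ?_ (sub_dvd_pow_sub_pow _ _ _)
        rw [add_sub_cancel_left]; exact dvd_mul_left _ _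
      obtain ⟨R, hR⟩ := this
      exact ⟨R, by rw [← hR]; ring⟩
    rw [hR, add_mul, Finset.mul_prod_erase Finset.univ (fun a => (X a : MvPolynomial (Ix m) K) ^ (p-1)) (Finset.mem_univ i), ← top_monomial, coeff_add, coeff_monomial, if_pos rfl]
    have hj : j ∈ Finset.univ.erase i := by simp [hij.symm]
    rw [← Finset.mul_prod_erase _ _ hj, add_eq_left]
    have hp := (Fact.out : p.Prime).two_le
    have : X j * R * (X j ^ (p-1) * ∏ x ∈ (Finset.univ.erase i).erase j, X x ^ (p-1)) = X j ^ p * (R * ∏ x ∈ (Finset.univ.erase i).erase j, X x ^ (p-1)) := by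
      have e : p = (p - 1) + 1 := by omega
      conv_rhs => rw [e, pow_succ]
      simp only [Nat.add_sub_cancel]; ring
    rw [this, top_nr]
  · intro A B hA' hB' ha hb
    rw [← thA_comp, top_thA _ (thA_hom _ (monomial_hom _ deg_top)), ha, hb, Matrix.det_mul, mul_pow]

theorem top_inv (A : Matrix (Ix m) (Ix m) K) (hA : A ∈ Matrix.symplecticGroup (Fin m) K)
    {F : MvPolynomial (Ix m) K} (hF : F.IsHomogeneous (2 * (m * (p-1)))) :
    coeff (topE p m) (thA A F) = coeff (topE p m) F := by
  have := SymplecticGroup.det_eq_one hA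
  rw [top_thA A hF, top_det A (by rw [this]; exact one_ne_zero), this, one_pow, mul_one]

theorem top_sub_sw {g : Ex m} : topE p m - swE g = twE p g := by
  ext a; simp

theorem Bf_right_monomial (F : MvPolynomial (Ix m) K) (d : Ex m) : 
    Bf K m F (monomial d 1) = wE K (swE d) * coeff (swE d) F := by
  induction F using MvPolynomial.induction_on' with
  | monomial g c =>
    rw [Bf_monomial, coeff_monomial, coeff_monomial]
    have : (d = swE g) ↔ (g = swE d) := ⟨fun e => by rw [e, swE_swE], fun e => by rw [e, swE_swE]⟩
    simp only [this]
    split_ifs with h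
    · rw [h]; ring
    · ring
  | add f g hf hg => rw [map_add, LinearMap.add_apply, hf, hg, coeff_add]; ring

theorem SSg_iff (pl : Prop) {F : MvPolynomial (Ix m) K} (hF : F.IsHomogeneous (m * (p-1))) :
    SSg p m (m * (p-1)) pl F ↔ ∀ H, H.IsHomogeneous (m * (p-1)) →
      coeff (topE p m) (F * H) = pm K pl * (-1)^m * Bf K m F H := by
  constructor
  · rintro ⟨-, h⟩ H hH
    rw [H.as_sum, Finset.mul_sum, coeff_sum, map_sum, Finset.mul_sum]
    refine Finset.sum_congr rfl fun d hd => ?_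
    have hdd : d.degree = m * (p-1) := by
      by_contra hc
      exact (mem_support_iff.1 hd) (hH.coeff_eq_zero hc)
    have : monomial d (coeff d H) = coeff d H • monomial d (1:K) := by simp [smul_monomial]
    rw [this, map_smul, smul_eq_mul, Bf_right_monomial, mul_smul_comm, coeff_smul, smul_eq_mul, coeff_mul_monomial']
    by_cases hle : d ≤ topE p m
    · rw [if_pos hle]
      have h1 := h rfl (swE d) (fun a => hle a.swap) (by rw [deg_sw, hdd])
      rw [← top_sub_sw, swE_swE] at h1
      rw [h1, sgE, wE, pow_add]; ring
    · rw [if_neg hle, wE, fct_zero (p := p)]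
      · simp
      · intro h2; apply hle; intro a; simpa using h2 a.swap
  · intro h
    refine ⟨hF, fun _ g hg hd => ?_⟩
    have h1 := h (monomial (swE g) 1) (monomial_hom _ (by rw [deg_sw, hd]))
    rw [Bf_right_monomial, swE_swE, coeff_mul_monomial', if_pos (show swE g ≤ topE p m from fun a => hg a.swap), top_sub_sw, mul_one] at h1
    rw [h1, sgE, wE, pow_add]; ring

theorem SSg_thA (A : Matrix (Ix m) (Ix m) K) (hA : A ∈ Matrix.symplecticGroup (Fin m) K) {lam : ℕ} {pl : Prop}
    {F : MvPolynomial (Ix m) K} (hF : SSg p m lam pl F) : SSg p m lam pl (thA A F) := by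
  by_cases hl : lam = m * (p - 1)
  · subst hl
    rw [SSg_iff pl (thA_hom A hF.1)]
    have hF0 := hF.1
    rw [SSg_iff pl hF.1] at hF
    intro H hH
    let Ai : Matrix.symplecticGroup (Fin m) K := (⟨A, hA⟩ : Matrix.symplecticGroup (Fin m) K)⁻¹
    have hi : (Ai : Matrix (Ix m) (Ix m) K) * A = 1 := congrArg Subtype.val (inv_mul_cancel (⟨A, hA⟩ : Matrix.symplecticGroup (Fin m) K))
    have hH2 : H = thA A (thA Ai.1 H) := by rw [thA_comp, hi, thA_one]
    have hH3 := thA_hom Ai.1 hH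
    generalize thA Ai.1 H = H' at hH2 hH3
    subst hH2
    rw [← map_mul, top_inv A hA (by rw [two_mul]; exact hF0.mul hH3), hF _ hH3, Bf_inv A hA]
  · exact ⟨thA_hom A hF.1, fun h => absurd h hl⟩

end PartA2

section PartB1
open MvPolynomial

abbrev PV (p t m : ℕ) [Fact p.Prime] := MvPolynomial (Ix m) (GaloisField p t)
abbrev FV (p t m : ℕ) [Fact p.Prime] := SympV p t m → GaloisField p t

variable {p t m : ℕ} [Fact p.Prime] [NeZero t]

def crd (v : SympV p t m) : Ix m → GaloisField p t := Sum.elim v.1 v.2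

def evj (p t m : ℕ) [Fact p.Prime] (j : ℕ) : PV p t m →ₐ[GaloisField p t] FV p t m :=
  aeval fun a v => crd v a ^ p ^ j

theorem evj_apply (j : ℕ) (F : PV p t m) (v : SympV p t m) :
    evj p t m j F v = eval (fun a => crd v a ^ p ^ j) F := by
  have : (Pi.evalAlgHom (GaloisField p t) (fun _ => GaloisField p t) v).comp (evj p t m j) =
      aeval (fun a => crd v a ^ p ^ j) := by
    ext a; simp [evj]
  have h := DFunLike.congr_fun this F
  simpa [aeval_eq_eval] using h

def PhiM (p t m : ℕ) [Fact p.Prime] : MultilinearMap (GaloisField p t) (fun _ : Fin t => PV p t m) (FV p t m) :=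
  (MultilinearMap.mkPiAlgebra (GaloisField p t) (Fin t) (FV p t m)).compLinearMap
    fun j => (evj p t m j).toLinearMap

theorem PhiM_apply (F : Fin t → PV p t m) : PhiM p t m F = ∏ j : Fin t, evj p t m j (F j) := by
  simp [PhiM]

theorem PhiM_update_mul (F : Fin t → PV p t m) (j : Fin t) (H G : PV p t m) :
    PhiM p t m (Function.update F j (H * G)) = evj p t m j H * PhiM p t m (Function.update F j G) := by
  rw [PhiM_apply, PhiM_apply, ← Finset.mul_prod_erase _ _ (Finset.mem_univ j), ← Finset.mul_prod_erase Finset.univ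
    (fun i : Fin t => evj p t m i (Function.update F j G i)) (Finset.mem_univ j)]
  simp only [Function.update_self, map_mul]
  rw [mul_assoc]
  congr 2
  refine Finset.prod_congr rfl fun i hi => ?_
  rw [Function.update_of_ne (Finset.ne_of_mem_erase hi), Function.update_of_ne (Finset.ne_of_mem_erase hi)]

theorem frob_full (x : GaloisField p t) : x ^ p ^ t = x := by
  haveI : Fintype (GaloisField p t) := Fintype.ofFinite _
  have h := FiniteField.pow_card x
  rwa [← Nat.card_eq_fintype_card, GaloisField.card p t (NeZero.ne t)] at h

theorem evj_X_p (j : Fin t) (a : Ix m) : evj p t m j (X a ^ p) = evj p t m ((j + 1 : Fin t) : ℕ) (X a) := by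
  funext v
  rw [evj_apply, evj_apply]
  simp only [map_pow, eval_X]
  rw [← pow_mul, ← pow_succ]
  have hj := j.2
  rcases Nat.lt_or_ge (j.1 + 1) t with h | h
  · rw [Fin.val_add_one_of_lt' h]
  · have h1 : j.1 + 1 = t := by omega
    have h2 : ((j + 1 : Fin t) : ℕ) = 0 := by
      rw [Fin.val_add]
      rcases Nat.lt_or_ge 1 t with h3 | h3
      · rw [Fin.val_one', Nat.mod_eq_of_lt h3, h1, Nat.mod_self]
      · have : t = 1 := by have := NeZero.ne t; omega
        subst this; simp [Nat.mod_one]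
    rw [h1, h2, pow_zero, pow_one, frob_full]

theorem fin_succ_ne (ht : 1 < t) (j : Fin t) : j + 1 ≠ j := by
  intro h
  have h1 : (1 : Fin t) = 0 := by simpa using h
  have := congrArg Fin.val h1
  rw [Fin.val_one', Fin.val_zero, Nat.mod_eq_of_lt ht] at this
  omega

theorem PhiM_carry (F : Fin t → PV p t m) (j : Fin t) (a : Ix m) (G : PV p t m) :
    PhiM p t m (Function.update F j (X a ^ p * G)) =
      evj p t m ((j + 1 : Fin t) : ℕ) (X a) * PhiM p t m (Function.update F j G) := by
  rw [PhiM_update_mul, evj_X_p]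

theorem PhiM_carry' (ht : 1 < t) (F : Fin t → PV p t m) (j : Fin t) (a : Ix m) (G : PV p t m) :
    PhiM p t m (Function.update F j (X a ^ p * G)) =
      PhiM p t m (Function.update (Function.update F j G) (j+1) (X a * F (j+1))) := by
  rw [PhiM_carry]
  have := PhiM_update_mul (Function.update F j G) (j+1) (X a) (F (j+1))
  rw [this]
  congr 2
  funext i
  by_cases h : i = j + 1
  · subst h; rw [Function.update_self, Function.update_of_ne (fin_succ_ne ht j)]
  · rw [Function.update_of_ne h]

/-! symplectic basis functions -/

def exOf (α β : Fin m → ℕ) : Ex m := mkE (Sum.elim α β)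

theorem evj_monomial (j : ℕ) (g : Ex m) (c : GaloisField p t) (v : SympV p t m) :
    evj p t m j (monomial g c) v = c * (∏ a, crd v a ^ g a) ^ p ^ j := by
  rw [evj_apply, eval_monomial, Finsupp.prod_fintype _ _ (by simp), ← Finset.prod_pow]
  congr 1
  exact Finset.prod_congr rfl fun a _ => by rw [← pow_mul, ← pow_mul, mul_comm]

theorem mono_eq (g : Ex m) : (mono (fun i => g (.inl i)) (fun i => g (.inr i)) : FV p t m) = evj p t m 0 (monomial g 1) := by
  funext v
  rw [evj_monomial]
  simp [mono, crd, Finset.prod_mul_distrib]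

theorem mono_eq' (α β : Fin m → ℕ) : (mono α β : FV p t m) = evj p t m 0 (monomial (exOf α β) 1) := by
  rw [← mono_eq]; rfl

theorem cast_pow_p (n : ℤ) (j : ℕ) : ((n : ℤ) : GaloisField p t) ^ p ^ j = n := by
  have h := map_intCast (iterateFrobenius (GaloisField p t) p j) n
  rwa [iterateFrobenius_def] at h

theorem sg_int (g : Ex m) : ∃ n : ℤ, sgE (GaloisField p t) g = n := by
  refine ⟨(-1) ^ ((∑ i, g (.inr i)) + m) * ∏ a, ((g a).factorial : ℤ), ?_⟩
  simp [sgE, fct]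

theorem pmsg_int (pl : Prop) (g : Ex m) : ∃ n : ℤ, pm (GaloisField p t) pl * sgE (GaloisField p t) g = n := by
  obtain ⟨n, hn⟩ := sg_int (p := p) (t := t) g
  rw [hn]
  unfold pm; split_ifs
  · exact ⟨n, by simp⟩
  · exact ⟨-n, by simp⟩

theorem GenD_pow {lam : ℕ} {pl : Prop} {F : PV p t m} (hF : F ∈ GenD (GaloisField p t) p m lam pl) (j : ℕ) (v : SympV p t m) :
    (evj p t m 0 F v) ^ p ^ j = evj p t m j F v := by
  obtain ⟨g, h, hd, (⟨h1, h2, rfl⟩ | ⟨h1, h2, h3, rfl⟩ | ⟨h1, h2, rfl⟩)⟩ := hF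
  · simp [evj_monomial]
  · simp [evj_monomial]
  · obtain ⟨n, hn⟩ := pmsg_int (p := p) (t := t) pl g
    rw [hn, map_add, map_add, Pi.add_apply, Pi.add_apply, add_pow_char_pow]
    simp only [evj_monomial, mul_pow, cast_pow_p]
    simp

theorem sg_exOf (α β : Fin m → ℕ) : sgE (GaloisField p t) (exOf α β) = (-1) ^ ((∑ i, β i) + m) * factk p t α * factk p t β := by
  simp [sgE, fct, exOf, factk, mul_assoc]

theorem exOf_le {α β : Fin m → ℕ} : exOf α β ≤ topE p m ↔ (∀ i, α i ≤ p - 1) ∧ (∀ i, β i ≤ p - 1) := by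
  rw [le_topE]
  simp [exOf]

theorem exOf_deg (α β : Fin m → ℕ) : (exOf α β).degree = (∑ i, α i) + ∑ i, β i := by
  simp [deg_eq', exOf]

theorem tw_exOf (α β : Fin m → ℕ) : twE p (exOf α β) = exOf (abar p β) (abar p α) := by
  ext a; rcases a with a | a <;> simp [exOf, abar]

theorem exOf_inj {α β α' β' : Fin m → ℕ} : exOf α β = exOf α' β' ↔ α = α' ∧ β = β' := by
  constructor
  · intro h
    exact ⟨funext fun i => by simpa [exOf] using DFunLike.congr_fun h (.inl i), funext fun i => by simpa [exOf] using DFunLike.congr_fun h (.inr i)⟩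
  · rintro ⟨rfl, rfl⟩; rfl

theorem exOf_eta (g : Ex m) : exOf (fun i => g (.inl i)) (fun i => g (.inr i)) = g := by
  ext a; rcases a with a | a <;> simp [exOf]

theorem tw_self_iff {α β : Fin m → ℕ} (h : exOf α β ≤ topE p m) : twE p (exOf α β) = exOf α β ↔ β = abar p α := by
  rw [tw_exOf, exOf_inj]
  rw [exOf_le] at h
  constructor
  · rintro ⟨h1, h2⟩; exact h2.symm
  · rintro rfl
    refine ⟨?_, rfl⟩
    funext i; have := h.1 i; simp [abar]; omega

theorem digit_iff (lam : ℕ) (pl : Prop) (f : FV p t m) :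
    IsDigit p t m lam pl f ↔ ∃ F ∈ GenD (GaloisField p t) p m lam pl, f = evj p t m 0 F := by
  constructor
  · rintro (⟨h1, h2, α, β, ha, hb, hd, rfl⟩ | ⟨h1, h2, α, ha, rfl⟩ | ⟨h1, α, β, ha, hb, hd, hne, rfl⟩)
    · exact ⟨_, ⟨exOf α β, exOf_le.2 ⟨ha, hb⟩, by rw [exOf_deg, hd], Or.inl ⟨h1, h2, rfl⟩⟩, mono_eq' _ _⟩
    · have hle : exOf α (abar p α) ≤ topE p m := exOf_le.2 ⟨ha, fun i => by simp [abar]⟩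
      have hs := (tw_self_iff hle).2 rfl
      exact ⟨_, ⟨exOf α (abar p α), hle, by rw [deg_of_self hle hs, h1], Or.inr (Or.inl ⟨h1, h2, hs, rfl⟩)⟩, mono_eq' _ _⟩
    · have hle : exOf α β ≤ topE p m := exOf_le.2 ⟨ha, hb⟩
      refine ⟨_, ⟨exOf α β, hle, by rw [exOf_deg, hd, h1], Or.inr (Or.inr ⟨h1, fun h => hne ((tw_self_iff hle).1 h), rfl⟩)⟩, ?_⟩
      rw [map_add, ← mono_eq', tw_exOf, ← mul_one (pm _ pl * _), ← smul_eq_mul (_ : GaloisField p t) 1, ← smul_monomial, map_smul, ← mono_eq', sg_exOf]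
      rfl
  · rintro ⟨F, ⟨g, h, hd, hc⟩, rfl⟩
    obtain ⟨α, β, rfl⟩ : ∃ α β, g = exOf α β := ⟨_, _, (exOf_eta g).symm⟩
    have hle := exOf_le.1 h
    rw [exOf_deg] at hd
    rcases hc with ⟨h1, h2, rfl⟩ | ⟨h1, h2, h3, rfl⟩ | ⟨h1, h2, rfl⟩
    · exact Or.inl ⟨h1, h2, α, β, hle.1, hle.2, hd, (mono_eq' _ _).symm⟩
    · refine Or.inr (Or.inl ⟨h1, h2, α, hle.1, ?_⟩)
      rw [tw_self_iff h] at h3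
      rw [← h3, mono_eq']
    · refine Or.inr (Or.inr ⟨h1, α, β, hle.1, hle.2, by rw [hd, h1], fun e => h2 ((tw_self_iff h).2 e), ?_⟩)
      rw [map_add, ← mono_eq', tw_exOf, ← mul_one (pm _ pl * _), ← smul_eq_mul (_ : GaloisField p t) 1, ← smul_monomial, map_smul, ← mono_eq', sg_exOf]
      rfl

theorem SBF_iff (lam : Fin t → ℕ) (eps : Finset (Fin t)) (f : FV p t m) :
    IsSBF p t m lam eps f ↔ ∃ F : Fin t → PV p t m, (∀ j, F j ∈ GenD (GaloisField p t) p m (lam j) (j ∈ eps)) ∧ f = PhiM p t m F := by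
  constructor
  · rintro ⟨g, hg, rfl⟩
    simp only [digit_iff] at hg
    choose F hF hgF using hg
    refine ⟨F, hF, ?_⟩
    funext v
    rw [PhiM_apply, Finset.prod_apply]
    exact Finset.prod_congr rfl fun j _ => by rw [hgF, GenD_pow (hF j)]
  · rintro ⟨F, hF, rfl⟩
    refine ⟨fun j => evj p t m 0 (F j), fun j => (digit_iff _ _ _).2 ⟨F j, hF j, rfl⟩, ?_⟩
    funext v
    rw [PhiM_apply, Finset.prod_apply]
    exact Finset.prod_congr rfl fun j _ => by rw [GenD_pow (hF j)]

/-! group action -/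
def vecOf (u : Ix m → GaloisField p t) : SympV p t m := (fun i => u (.inl i), fun i => u (.inr i))

theorem crd_vecOf (u : Ix m → GaloisField p t) : crd (vecOf u : SympV p t m) = u := by
  funext a; rcases a with a | a <;> rfl
theorem vecOf_crd (v : SympV p t m) : vecOf (crd v) = v := rfl

def matOf (g : SympV p t m →ₗ[GaloisField p t] SympV p t m) : Matrix (Ix m) (Ix m) (GaloisField p t) :=
  fun a b => crd (g (vecOf (Pi.single b 1))) a

def crdL (p t m : ℕ) [Fact p.Prime] : SympV p t m ≃ₗ[GaloisField p t] (Ix m → GaloisField p t) where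
  toFun := crd
  invFun := vecOf
  left_inv := fun _ => rfl
  right_inv u := by funext a; rcases a with a | a <;> rfl
  map_add' v w := by funext a; rcases a with a | a <;> rfl
  map_smul' c v := by funext a; rcases a with a | a <;> rfl

theorem crd_matOf (g : SympV p t m →ₗ[GaloisField p t] SympV p t m) (v : SympV p t m) (a : Ix m) :
    crd (g v) a = ∑ b, matOf g a b * crd v b := by
  have h1 : v = ∑ b, crd v b • (vecOf (Pi.single b 1) : SympV p t m) := by
    apply (crdL p t m).injective
    rw [map_sum]
    simp_rw [map_smul]
    funext a
    have : ∀ b, (crdL p t m) (vecOf (Pi.single b 1)) = Pi.single b 1 := fun b => crd_vecOf _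
    simp only [this, Finset.sum_apply, Pi.smul_apply, smul_eq_mul, Pi.single_apply, mul_ite, mul_one, mul_zero, Finset.sum_ite_eq, Finset.mem_univ, if_true]
    rfl
  conv_lhs => rw [h1]
  rw [map_sum]
  have h2 : ∀ w : SympV p t m, crd w = crdL p t m w := fun _ => rfl
  rw [h2, map_sum, Finset.sum_apply]
  refine Finset.sum_congr rfl fun b _ => ?_
  rw [map_smul, map_smul, Pi.smul_apply, smul_eq_mul, mul_comm]
  rfl

theorem sform_crd (v w : SympV p t m) : sform v w = ∑ i, (crd v (.inl i) * crd w (.inr i) - crd v (.inr i) * crd w (.inl i)) := rfl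

theorem matOf_symp (g : SympV p t m →ₗ[GaloisField p t] SympV p t m) (hg : ∀ v w, sform (g v) (g w) = sform v w) :
    matOf g ∈ Matrix.symplecticGroup (Fin m) (GaloisField p t) := by
  rw [SymplecticGroup.mem_iff']
  ext b c
  have h := hg (vecOf (Pi.single b 1)) (vecOf (Pi.single c 1))
  rw [sform_crd, sform_crd] at h
  simp only [crd_vecOf] at h
  have e1 : (Matrix.transpose (matOf g) * Matrix.J (Fin m) (GaloisField p t) * matOf g) b c = 
     - ∑ i, (crd (g (vecOf (Pi.single b 1))) (.inl i) * crd (g (vecOf (Pi.single c 1))) (.inr i) - crd (g (vecOf (Pi.single b 1))) (.inr i) * crd (g (vecOf (Pi.single c 1))) (.inl i)) := by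
    simp only [Matrix.mul_apply, Matrix.transpose_apply, Fintype.sum_sum_type, Matrix.J, Matrix.fromBlocks_apply₁₁,
    Matrix.fromBlocks_apply₁₂, Matrix.fromBlocks_apply₂₁, Matrix.fromBlocks_apply₂₂, Matrix.zero_apply, Matrix.one_apply, Matrix.neg_apply,
    mul_zero, Finset.sum_const_zero, zero_add, add_zero, mul_neg, mul_ite, mul_one, Finset.sum_neg_distrib, Finset.sum_ite_eq', Finset.mem_univ, if_true, neg_mul, Finset.sum_sub_distrib]
    unfold matOf
    ring
  rw [e1, h]
  simp only [Pi.single_apply, Matrix.J]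
  rcases b with b | b <;> rcases c with c | c <;> simp [Matrix.one_apply, eq_comm]

theorem PhiM_sub (g : SympV p t m →ₗ[GaloisField p t] SympV p t m) (F : Fin t → PV p t m) :
    (fun v => PhiM p t m F (g v)) = PhiM p t m fun j => thA ((matOf g).map (iterateFrobenius (GaloisField p t) p j)) (F j) := by
  funext v
  rw [PhiM_apply, PhiM_apply, Finset.prod_apply, Finset.prod_apply]
  refine Finset.prod_congr rfl fun j _ => ?_
  rw [evj_apply, evj_apply, thA, ← aeval_eq_eval, ← aeval_eq_eval]
  change (aeval _) (F j) = (aeval _) (aeval _ (F j))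
  rw [← AlgHom.comp_apply, comp_aeval]
  congr 2
  funext a
  rw [crd_matOf, sum_pow_char_pow, map_sum]
  refine Finset.sum_congr rfl fun b _ => ?_
  simp [mul_pow, iterateFrobenius_def]

theorem map_frob_symp {A : Matrix (Ix m) (Ix m) (GaloisField p t)} (hA : A ∈ Matrix.symplecticGroup (Fin m) (GaloisField p t)) (f : GaloisField p t →+* GaloisField p t) :
    A.map f ∈ Matrix.symplecticGroup (Fin m) (GaloisField p t) := by
  rw [SymplecticGroup.mem_iff] at hA ⊢
  have h := congrArg (fun M => M.map f) hA
  simp only [Matrix.map_mul] at h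
  rw [← Matrix.transpose_map] 
  have hJ : (Matrix.J (Fin m) (GaloisField p t)).map f = Matrix.J (Fin m) (GaloisField p t) := by
    ext b c
    rcases b with b | b <;> rcases c with c | c <;> simp [Matrix.J, Matrix.one_apply, apply_ite f]
  rwa [hJ] at h

theorem symm_symp {g : SympV p t m ≃ₗ[GaloisField p t] SympV p t m} (hg : IsSymp g) :
    ∀ v w, sform (g.symm v) (g.symm w) = sform v w := by
  intro v w
  have := hg (g.symm v) (g.symm w)
  simpa using this.symm

theorem PhiM_act {g : SympV p t m ≃ₗ[GaloisField p t] SympV p t m} (hg : IsSymp g) :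
    ∃ A : Fin t → Matrix (Ix m) (Ix m) (GaloisField p t), (∀ j, A j ∈ Matrix.symplecticGroup (Fin m) (GaloisField p t)) ∧
    ∀ F, (fun v => PhiM p t m F (g.symm v)) = PhiM p t m fun j => thA (A j) (F j) := by
  have h := matOf_symp (g.symm : SympV p t m →ₗ[GaloisField p t] SympV p t m) (symm_symp hg)
  exact ⟨_, fun j => map_frob_symp h _, fun F => PhiM_sub _ F⟩

end PartB1

section PartB2
open MvPolynomial

variable {p t m d : ℕ} [Fact p.Prime] [NeZero t]

theorem ml_span {k M P : Type} [Field k] [AddCommGroup M] [Module k M] [AddCommGroup P] [Module k P]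
    {t : ℕ} (f : MultilinearMap k (fun _ : Fin t => P) M) (S : Fin t → Set P) (N : Submodule k M)
    (h : ∀ G, (∀ j, G j ∈ S j) → f G ∈ N) (F : Fin t → P) (hF : ∀ j, F j ∈ Submodule.span k (S j)) : f F ∈ N := by
  have key : ∀ T : Finset (Fin t), ∀ F : Fin t → P, (∀ j ∈ T, F j ∈ Submodule.span k (S j)) →
      (∀ j ∉ T, F j ∈ S j) → f F ∈ N := by
    intro T
    induction T using Finset.induction_on with
    | empty => intro F _ h2; exact h F fun j => h2 j (by simp)
    | insert a T ha ih =>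
      intro F h1 h2
      have h3 : ∀ x ∈ Submodule.span k (S a), f (Function.update F a x) ∈ N := by
        intro x hx
        induction hx using Submodule.span_induction with
        | mem x hx =>
          apply ih
          · intro j hj
            have : j ≠ a := by rintro rfl; exact ha hj
            rw [Function.update_of_ne this]; exact h1 j (by simp [hj])
          · intro j hj
            by_cases e : j = a
            · subst e; simpa using hx
            · rw [Function.update_of_ne e]; exact h2 j (by simp [e, hj])
        | zero => rw [MultilinearMap.map_update_zero]; exact N.zero_mem
        | add x y _ _ hx hy => rw [MultilinearMap.map_update_add]; exact N.add_mem hx hy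
        | smul c x _ hx => rw [MultilinearMap.map_update_smul]; exact N.smul_mem _ hx
      have := h3 (F a) (h1 a (by simp))
      rwa [Function.update_eq_self] at this
  exact key Finset.univ F (fun j _ => hF j) (fun j hj => absurd (Finset.mem_univ j) hj)

theorem val_succ' {j : Fin t} (h : j.1 + 1 < t) : (j + 1 : Fin t).1 = j.1 + 1 := Fin.val_add_one_of_lt' h

theorem last_succ {j : Fin t} (h : j.1 + 1 = t) : (j + 1 : Fin t) = 0 := by
  apply Fin.ext
  rw [Fin.val_add]
  rcases Nat.lt_or_ge 1 t with h3 | h3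
  · rw [Fin.val_one', Nat.mod_eq_of_lt h3, h, Nat.mod_self]; simp
  · have : t = 1 := by have := NeZero.ne t; omega
    subst this; simp [Nat.mod_one]

theorem cyc_down (P : Fin t → Prop) (h : ∀ j, P (j + 1) → P j) (j0 : Fin t) (h0 : P j0) : ∀ j, P j := by
  have key : ∀ i : Fin t, P i → ∀ n : ℕ, ∀ j : Fin t, j.1 + n = i.1 → P j := by
    intro i hi n
    induction n with
    | zero => intro j hj; rwa [show j = i from Fin.ext hj]
    | succ n ih =>
      intro j hj
      apply h
      apply ih
      rw [val_succ' (by have := i.2; omega)]; omega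
  have hz : P 0 := key j0 h0 j0.1 0 (by simp)
  have htp : 0 < t := Nat.pos_of_ne_zero (NeZero.ne t)
  let l : Fin t := ⟨t - 1, by omega⟩
  have hl : P l := by
    apply h
    rw [last_succ (show l.1 + 1 = t by simp [l]; omega)]; exact hz
  intro j
  exact key l hl (t - 1 - j.1) j (by simp [l]; omega)

theorem digit_lt (j : ℕ) : digitp p d j < p := Nat.mod_lt _ (Fact.out : p.Prime).pos

theorem digits_full (hd : d ≤ p ^ t - 2) (h : ∀ j : Fin t, digitp p d j = p - 1) : False := by
  have hp := (Fact.out : p.Prime).two_le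
  have key : ∀ n ≤ t, d % p ^ n + 1 = p ^ n := by
    intro n
    induction n with
    | zero => intro _; simp [Nat.mod_one]
    | succ n ih =>
      intro hn
      have h1 := ih (by omega)
      have h2 := h ⟨n, by omega⟩
      rw [digitp] at h2
      simp only at h2
      rw [Nat.mod_pow_succ, h2, pow_succ]
      have : p ^ n * p = p ^ n * (p - 1) + p ^ n := by
        rw [← Nat.mul_succ]; congr 1; omega
      omega
  have h1 := key t le_rfl
  have h2 : 2 ≤ p ^ t := le_trans hp (Nat.le_self_pow (NeZero.ne t) p)
  have h3 := Nat.mod_le d (p ^ t)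
  omega

theorem s_nonneg (hd : d ≤ p ^ t - 2) {s : Fin t → ℤ} (hl : ∀ j, 0 ≤ lamOf p t d s j) (h0 : d = 0 → s ≠ 0) :
    ∀ j, 0 ≤ s j ∧ (d = 0 → 1 ≤ s j) := by
  have hp : (2 : ℤ) ≤ p := by exact_mod_cast (Fact.out : p.Prime).two_le
  obtain ⟨j0, hj0⟩ := Finite.exists_min s
  have hdg : ∀ j : Fin t, (digitp p d j : ℤ) ≤ p - 1 := by
    intro j; have := digit_lt (p := p) (d := d) j; omega
  have hpred : ∀ j : Fin t, ∃ i : Fin t, i + 1 = j := fun j => ⟨j - 1, by simp⟩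
  have hM1 : -1 ≤ s j0 := by
    obtain ⟨i, hi⟩ := hpred j0
    have h1 := hl i
    rw [lamOf, hi] at h1
    have h2 := hj0 i
    have h3 := hdg i
    nlinarith
  have hM2 : s j0 ≠ -1 := by
    intro hM
    have hall : ∀ j, s j = -1 ∧ (∃ i : Fin t, i + 1 = j ∧ digitp p d i = p - 1) := by
      have hstep : ∀ j, s j = -1 → ∀ i : Fin t, i + 1 = j → s i = -1 ∧ digitp p d i = p - 1 := by
        intro j hj i hi
        have h1 := hl i
        rw [lamOf, hi, hj] at h1
        have h2 := hj0 i
        have h3 := hdg i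
        have h4 := digit_lt (p := p) (d := d) i
        constructor
        · omega
        · omega
      have hs : ∀ j, s j = -1 := cyc_down (fun j => s j = -1) (fun j h => (hstep _ h j rfl).1) j0 hM
      intro j
      obtain ⟨i, hi⟩ := hpred j
      exact ⟨hs j, i, hi, (hstep j (hs j) i hi).2⟩
    refine digits_full (p := p) (t := t) hd fun j => ?_
    obtain ⟨-, i, hi, h⟩ := hall (j + 1)
    have : i = j := by simpa using hi
    rwa [← this]
  intro j
  have hj := hj0 j
  refine ⟨by omega, fun hd0 => ?_⟩
  by_contra hc
  have hz : s j0 = 0 := by omega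
  apply h0 hd0
  have : ∀ j, s j = 0 := by
    refine cyc_down (fun j => s j = 0) (fun i h => ?_) j0 hz
    have h1 := hl i
    rw [lamOf, h] at h1
    subst hd0
    have h2 := hj0 i
    simp [digitp] at h1
    omega
  funext i; exact this i

theorem memCase_iff {s : Fin t → ℤ} {eps : Finset (Fin t)} : memCase p t m d s eps ↔
    (∀ j, 0 ≤ s j ∧ (d = 0 → 1 ≤ s j) ∧ s j ≤ 2 * m - 1) ∧
    (∀ j, 0 ≤ lamOf p t d s j ∧ lamOf p t d s j ≤ 2 * m * ((p : ℤ) - 1)) ∧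
    (∀ j ∈ eps, lamOf p t d s j = m * ((p : ℤ) - 1)) := by
  have hJ : ∀ d, (eps ⊆ Jset p t m d s) ↔ ∀ j ∈ eps, lamOf p t d s j = m * ((p : ℤ) - 1) := by
    intro d
    simp [Jset, Finset.subset_iff]
  unfold memCase
  split_ifs with h
  · subst h
    rw [memS, memH, hJ, and_assoc]
    refine and_congr_left fun _ => ?_
    refine forall_congr' fun j => ?_
    constructor
    · rintro ⟨h1, h2⟩; exact ⟨by omega, fun _ => h1, h2⟩
    · rintro ⟨h1, h2, h3⟩; exact ⟨h2 rfl, h3⟩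
  · rw [memSd, memHd, hJ, and_assoc]
    refine and_congr_left fun _ => ?_
    refine forall_congr' fun j => ?_
    constructor
    · rintro ⟨h1, h2⟩; exact ⟨h1, fun h' => absurd h' h, h2⟩
    · rintro ⟨h1, h2, h3⟩; exact ⟨h1, h3⟩

theorem le_iff {s' s : Fin t → ℤ} {eps' eps : Finset (Fin t)} : leSd p t m d s' eps' s eps ↔
    (∀ j, s' j ≤ s j) ∧ ∀ j, s' j = s j → s' (j+1) = s (j+1) → lamOf p t d s' j = m * ((p:ℤ)-1) → (j ∈ eps ↔ j ∈ eps') := by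
  unfold leSd
  refine and_congr_right fun _ => ?_
  rw [Finset.ext_iff]
  refine forall_congr' fun j => ?_
  simp only [Finset.mem_inter, Zset, Finset.mem_filter, Finset.mem_univ, true_and]
  constructor
  · intro h h1 h2 h3
    simpa [h1, h2, h3] using h
  · intro h
    constructor
    · rintro ⟨a, b, c, e⟩; exact ⟨(h b c e).1 a, b, c, e⟩
    · rintro ⟨a, b, c, e⟩; exact ⟨(h b c e).2 a, b, c, e⟩

theorem lam_congr {s' s : Fin t → ℤ} {j : Fin t} (h1 : s' j = s j) (h2 : s' (j+1) = s (j+1)) :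
    lamOf p t d s' j = lamOf p t d s j := by rw [lamOf, lamOf, h1, h2]

theorem leS_refl (s : Fin t → ℤ) (eps : Finset (Fin t)) : leSd p t m d s eps s eps :=
  ⟨fun _ => le_rfl, rfl⟩

theorem leS_trans {s1 s2 s3 : Fin t → ℤ} {e1 e2 e3 : Finset (Fin t)} (h12 : leSd p t m d s1 e1 s2 e2)
    (h23 : leSd p t m d s2 e2 s3 e3) : leSd p t m d s1 e1 s3 e3 := by
  rw [le_iff] at *
  refine ⟨fun j => (h12.1 j).trans (h23.1 j), fun j a b c => ?_⟩
  have a1 := h12.1 j; have a2 := h23.1 j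
  have b1 := h12.1 (j+1); have b2 := h23.1 (j+1)
  have c2 : s2 j = s3 j := by omega
  have c3 : s2 (j+1) = s3 (j+1) := by omega
  rw [h23.2 j c2 c3 (by rw [lam_congr c2 c3, ← lam_congr a b, c])]
  exact h12.2 j (by omega) (by omega) c

theorem le_same {s : Fin t → ℤ} {e1 e2 : Finset (Fin t)} (h1 : memCase p t m d s e1) (h2 : memCase p t m d s e2)
    (h : leSd p t m d s e1 s e2) : e1 = e2 := by
  rw [le_iff] at h
  rw [memCase_iff] at h1 h2
  ext j
  constructor
  · intro hj; exact (h.2 j rfl rfl (h1.2.2 j hj)).2 hj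
  · intro hj; exact (h.2 j rfl rfl (h2.2.2 j hj)).1 hj

theorem ltS_trans {s1 s2 s3 : Fin t → ℤ} {e1 e2 e3 : Finset (Fin t)} (m2 : memCase p t m d s2 e2) (m3 : memCase p t m d s3 e3)
    (h12 : leSd p t m d s1 e1 s2 e2)
    (h23 : leSd p t m d s2 e2 s3 e3) (hne : ¬ (s2 = s3 ∧ e2 = e3)) : ¬ (s1 = s3 ∧ e1 = e3) := by
  rintro ⟨rfl, rfl⟩
  have : s2 = s1 := by
    funext j; exact le_antisymm (h23.1 j) (h12.1 j)
  subst this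
  exact hne ⟨rfl, le_same m2 m3 h23⟩

theorem Y_mono {s1 s2 : Fin t → ℤ} {e1 e2 : Finset (Fin t)} (h : leSd p t m d s1 e1 s2 e2) :
    Ymod p t m d s1 e1 ≤ Ymod p t m d s2 e2 := by
  apply Submodule.span_mono
  rintro f ⟨s', e', a, b, c⟩
  exact ⟨s', e', a, leS_trans b h, c⟩

theorem Y_le_Ylt {s1 s2 : Fin t → ℤ} {e1 e2 : Finset (Fin t)} (m1 : memCase p t m d s1 e1) (m2 : memCase p t m d s2 e2)
    (h : leSd p t m d s1 e1 s2 e2) (hne : ¬ (s1 = s2 ∧ e1 = e2)) :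
    Ymod p t m d s1 e1 ≤ Yltmod p t m d s2 e2 := by
  apply Submodule.span_mono
  rintro f ⟨s', e', a, b, c⟩
  exact ⟨s', e', a, leS_trans b h, ltS_trans m1 m2 b h hne, c⟩

theorem Ylt_le_Y (s : Fin t → ℤ) (e : Finset (Fin t)) : Yltmod p t m d s e ≤ Ymod p t m d s e := by
  apply Submodule.span_mono
  rintro f ⟨s', e', a, b, c, h⟩
  exact ⟨s', e', a, b, h⟩

def drp (s : Fin t → ℤ) (j : Fin t) : Fin t → ℤ := Function.update s j (s j - 1)

theorem lam_drp (ht : 1 < t) (s : Fin t → ℤ) (j i : Fin t) :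
    lamOf p t d (drp s (j+1)) i = lamOf p t d s i - (if i = j then (p:ℤ) else 0) + (if i = j + 1 then 1 else 0) := by
  have h1 := fin_succ_ne ht j
  unfold lamOf drp
  simp only [Function.update_apply, add_left_inj]
  by_cases a : i = j
  · subst a; simp [h1.symm]; ring
  · by_cases b : i = j + 1
    · simp only [a, b, if_true, if_false]
      simp [h1]; ring
    · simp [a, b]

theorem lamN_cast {s : Fin t → ℤ} {j : Fin t} (h : 0 ≤ lamOf p t d s j) : (lamOfN p t d s j : ℤ) = lamOf p t d s j :=
  Int.toNat_of_nonneg h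

theorem p_cast : ((p - 1 : ℕ) : ℤ) = (p : ℤ) - 1 := by
  have := (Fact.out : p.Prime).pos
  push_cast [this]; rfl

theorem lamN_mu {s : Fin t → ℤ} {j : Fin t} (h : 0 ≤ lamOf p t d s j) :
    lamOfN p t d s j = m * (p-1) ↔ lamOf p t d s j = m * ((p:ℤ)-1) := by
  rw [← lamN_cast h, ← p_cast]
  norm_cast

theorem NR_split {lam : ℕ} {F : PV p t m} (hF : F ∈ NRD (GaloisField p t) p m lam) :
    ∃ a, ∃ G : PV p t m, p ≤ lam ∧ G.IsHomogeneous (lam - p) ∧ F = X a ^ p * G := by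
  obtain ⟨g, hg, hd, rfl⟩ := hF
  obtain ⟨a, g', rfl⟩ := split_nr hg
  have h1 : (Finsupp.single a p + g' : Ex m).degree = p + g'.degree := by simp [map_add]
  refine ⟨a, monomial g' 1, by omega, monomial_hom _ (by omega), ?_⟩
  rw [X_pow_eq_monomial, monomial_mul, one_mul]

theorem GenD_pl {lam : ℕ} {pl : Prop} {F : PV p t m} (hF : F ∈ GenD (GaloisField p t) p m lam pl) :
    (pl → lam = m * (p-1)) ∧ lam ≤ 2 * (m * (p-1)) := by
  obtain ⟨g, h, hd, hc⟩ := hF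
  have h2 := deg_tw h
  refine ⟨fun hpl => ?_, by omega⟩
  rcases hc with ⟨h1, h2, rfl⟩ | ⟨h1, h2, h3, rfl⟩ | ⟨h1, h2, rfl⟩
  · exact absurd hpl h2
  · exact h1
  · exact h1

theorem lemK (hodd : Odd p) (ht : 1 < t) (hd : d ≤ p ^ t - 2) {s : Fin t → ℤ} {eps : Finset (Fin t)}
    (hmem : memCase p t m d s eps) : ∀ n : ℕ, ∀ s' : Fin t → ℤ, (∑ j, s' j).toNat = n → (∀ j, s' j ≤ s j) →
    (∀ j, 0 ≤ lamOf p t d s' j) → (d = 0 → s' ≠ 0) → ∀ F : Fin t → PV p t m,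
    (∀ j, (F j).IsHomogeneous (lamOfN p t d s' j)) →
    (∀ j, s' j = s j → s' (j+1) = s (j+1) → SSg p m (lamOfN p t d s' j) (j ∈ eps) (F j)) →
    PhiM p t m F ∈ Ymod p t m d s eps ∧ (s' ≠ s → PhiM p t m F ∈ Yltmod p t m d s eps) := by
  intro n
  induction n using Nat.strong_induction_on with
  | _ n ih =>
  intro s' hn hle hl h0 F hF hS
  have hnn := s_nonneg hd hl h0
  suffices h : PhiM p t m F ∈ (if s' = s then Ymod p t m d s eps else Yltmod p t m d s eps) by
    split_ifs at h with c
    · exact ⟨h, fun h' => absurd c h'⟩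
    · exact ⟨Ylt_le_Y _ _ h, fun _ => h⟩
  let un : Fin t → Prop := fun j => s' j = s j ∧ s' (j+1) = s (j+1)
  let S : Fin t → Set (PV p t m) := fun j => if un j then
      GenD (GaloisField p t) p m (lamOfN p t d s' j) (j ∈ eps) ∪ NRD (GaloisField p t) p m (lamOfN p t d s' j)
    else (GenD (GaloisField p t) p m (lamOfN p t d s' j) True ∪ GenD (GaloisField p t) p m (lamOfN p t d s' j) False) ∪ NRD (GaloisField p t) p m (lamOfN p t d s' j)
  have hmem' := memCase_iff.1 hmem
  refine ml_span (PhiM p t m) S _ ?_ F ?_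
  · intro G hG
    have hGh : ∀ j, (G j).IsHomogeneous (lamOfN p t d s' j) := by
      intro j
      have h := hG j
      have hN : ∀ F ∈ NRD (GaloisField p t) p m (lamOfN p t d s' j), F.IsHomogeneous (lamOfN p t d s' j) := by
        rintro _ ⟨g, _, hg, rfl⟩; exact monomial_hom _ hg
      simp only [S] at h
      split_ifs at h
      · rcases h with h | h
        · exact (GenD_SSg hodd h).1
        · exact hN _ h
      · rcases h with (h | h) | h
        · exact (GenD_SSg hodd h).1
        · exact (GenD_SSg hodd h).1
        · exact hN _ h
    have hGs : ∀ j, un j → SSg p m (lamOfN p t d s' j) (j ∈ eps) (G j) ∨ G j ∈ NRD (GaloisField p t) p m (lamOfN p t d s' j) := by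
      intro j hu
      have h := hG j
      simp only [S, if_pos hu] at h
      rcases h with h | h
      · exact Or.inl (GenD_SSg hodd h)
      · exact Or.inr h
    have hNs : ∀ j, G j ∈ NRD (GaloisField p t) p m (lamOfN p t d s' j) → ∀ pl, SSg p m (lamOfN p t d s' j) pl (G j) := by
      intro j hj pl
      refine ⟨hGh j, fun _ g hg _ => ?_⟩
      obtain ⟨a, G', _, _, e⟩ := NR_split hj
      rw [e, red_nr (twE_le g), red_nr hg, mul_zero]
    by_cases hnr : ∃ j, G j ∈ NRD (GaloisField p t) p m (lamOfN p t d s' j)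
    · obtain ⟨j, hj⟩ := hnr
      obtain ⟨a, G', hpl, hG', e⟩ := NR_split hj
      have hcar := PhiM_carry' ht G j a G'
      rw [← e, Function.update_eq_self] at hcar
      have hne1 := fin_succ_ne ht j
      have hlj := hl j
      have hlc := lamN_cast hlj
      have hl' : ∀ i, 0 ≤ lamOf p t d (drp s' (j+1)) i := by
        intro i
        rw [lam_drp ht]
        have := hl i
        by_cases c : i = j
        · subst c; rw [if_pos rfl]; split_ifs <;> omega
        · rw [if_neg c]; split_ifs <;> omega
      have hsum : ∑ i, drp s' (j+1) i = ∑ i, s' i - 1 := by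
        unfold drp
        rw [Finset.sum_update_of_mem (Finset.mem_univ _), ← Finset.add_sum_erase Finset.univ s' (Finset.mem_univ (j+1)), Finset.sdiff_singleton_eq_erase]; ring
      have hlt : ∀ i, drp s' (j+1) i ≤ s' i := by
        intro i; unfold drp; rw [Function.update_apply]; split_ifs with c
        · subst c; omega
        · exact le_rfl
      have h0' : d = 0 → drp s' (j+1) ≠ 0 := by
        intro hd0 hz
        have h1 := lam_drp (p := p) (d := d) ht s' j (j+1)
        rw [hz, if_neg hne1, if_pos rfl] at h1
        have := hl (j+1)
        subst hd0
        simp [lamOf, digitp] at h1 this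
        omega
      have hnn' := s_nonneg hd hl' h0'
      have hsp : 0 ≤ ∑ i, drp s' (j+1) i := Finset.sum_nonneg fun i _ => (hnn' i).1
      have hj1 : drp s' (j+1) (j+1) = s' (j+1) - 1 := by simp [drp]
      have hlj1 := hle (j+1)
      have main := ih (∑ i, drp s' (j+1) i).toNat (by omega) (drp s' (j+1)) rfl (fun i => (hlt i).trans (hle i)) hl' h0'
        (Function.update (Function.update G j G') (j+1) (X a * G (j+1))) ?_ ?_
      · have := main.2 (fun h => by have := congrFun h (j+1); omega)
        rw [hcar]
        split_ifs
        · exact Ylt_le_Y _ _ this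
        · exact this
      · intro i
        by_cases c : i = j + 1
        · subst c
          rw [Function.update_self]
          have : lamOfN p t d (drp s' (j+1)) (j+1) = 1 + lamOfN p t d s' (j+1) := by
            have h1 := lam_drp (p := p) (d := d) ht s' j (j+1)
            rw [if_neg hne1, if_pos rfl] at h1
            have := hl (j+1)
            unfold lamOfN; omega
          rw [this]
          exact (isHomogeneous_X _ _).mul (hGh _)
        · rw [Function.update_of_ne c]
          by_cases c2 : i = j
          · subst c2
            rw [Function.update_self]
            have : lamOfN p t d (drp s' (i+1)) i = lamOfN p t d s' i - p := by
              have h1 := lam_drp (p := p) (d := d) ht s' i i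
              rw [if_neg c, if_pos rfl] at h1
              unfold lamOfN; omega
            rw [this]; exact hG'
          · rw [Function.update_of_ne c2]
            have h1 := lam_drp (p := p) (d := d) ht s' j i
            rw [if_neg c, if_neg c2, sub_zero, add_zero] at h1
            unfold lamOfN; rw [h1]; exact hGh i
      · intro i e1 e2
        have c : i ≠ j + 1 := by rintro rfl; omega
        have c2 : i ≠ j := by rintro rfl; omega
        rw [Function.update_of_ne c, Function.update_of_ne c2]
        have h1 := lam_drp (p := p) (d := d) ht s' j i
        rw [if_neg c, if_neg c2, sub_zero, add_zero] at h1
        unfold lamOfN; rw [h1]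
        have f1 := hlt i; have f2 := hlt (i+1); have f3 := hle i; have f4 := hle (i+1)
        rcases hGs i ⟨by omega, by omega⟩ with h | h
        · exact h
        · exact hNs i h _
    · push Not at hnr
      have hpl : ∀ j, ∃ pl : Prop, G j ∈ GenD (GaloisField p t) p m (lamOfN p t d s' j) pl ∧ (un j → (pl ↔ j ∈ eps)) := by
        intro j
        have h := hG j
        by_cases hu : un j
        · simp only [S, if_pos hu] at h
          exact ⟨_, h.resolve_right (hnr j), fun _ => Iff.rfl⟩
        · simp only [S, if_neg hu] at h
          rcases h.resolve_right (hnr j) with h | h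
          · exact ⟨_, h, fun h => absurd h hu⟩
          · exact ⟨_, h, fun h => absurd h hu⟩
      choose pl hpl1 hpl2 using hpl
      let e' : Finset (Fin t) := Finset.univ.filter pl
      have he' : ∀ j, j ∈ e' ↔ pl j := by intro j; simp [e']
      have hm' : memCase p t m d s' e' := by
        rw [memCase_iff]
        refine ⟨fun j => ⟨(hnn j).1, (hnn j).2, (hle j).trans (hmem'.1 j).2.2⟩, fun j => ⟨hl j, ?_⟩, fun j hj => ?_⟩
        · have h1 := (GenD_pl (hpl1 j)).2
          rw [← lamN_cast (hl j), ← p_cast]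
          have : (lamOfN p t d s' j : ℤ) ≤ ((2 * (m * (p-1)) : ℕ) : ℤ) := by exact_mod_cast h1
          push_cast at this ⊢; linarith
        · exact (lamN_mu (hl j)).1 ((GenD_pl (hpl1 j)).1 ((he' j).1 hj))
      have hle' : leSd p t m d s' e' s eps := by
        rw [le_iff]
        exact ⟨hle, fun j a b _ => by rw [he', hpl2 j ⟨a, b⟩]⟩
      have hsbf : IsSBF p t m (lamOfN p t d s') e' (PhiM p t m G) := by
        rw [SBF_iff]
        refine ⟨G, fun j => ?_, rfl⟩
        have : (j ∈ e') = pl j := propext (he' j)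
        rw [this]; exact hpl1 j
      split_ifs with c
      · exact Submodule.subset_span ⟨s', e', hm', hle', hsbf⟩
      · exact Submodule.subset_span ⟨s', e', hm', hle', fun h => c h.1, hsbf⟩
  · intro j
    simp only [S]
    split_ifs with hu
    · refine SSg_mem_span hodd ?_ (hS j hu.1 hu.2)
      intro hj
      rw [lamN_mu (hl j), lam_congr hu.1 hu.2]
      exact hmem'.2.2 j hj
    · exact hom_mem_span hodd (hF j)

theorem s_ne_zero {s : Fin t → ℤ} {eps : Finset (Fin t)} (h : memCase p t m d s eps) : d = 0 → s ≠ 0 := by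
  rintro hd rfl
  have h1 := ((memCase_iff.1 h).1 0).2.1 hd
  simp at h1

theorem Phi_mem_Y (hodd : Odd p) (ht : 1 < t) (hd : d ≤ p ^ t - 2) {s : Fin t → ℤ} {eps : Finset (Fin t)}
    (hmem : memCase p t m d s eps) (F : Fin t → PV p t m)
    (hS : ∀ j, SSg p m (lamOfN p t d s j) (j ∈ eps) (F j)) : PhiM p t m F ∈ Ymod p t m d s eps :=
  (lemK hodd ht hd hmem _ s rfl (fun _ => le_rfl) (fun j => ((memCase_iff.1 hmem).2.1 j).1) (s_ne_zero hmem) F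
    (fun j => (hS j).1) (fun j _ _ => hS j)).1

theorem Phi_act_mem (hodd : Odd p) (ht : 1 < t) (hd : d ≤ p ^ t - 2) {s : Fin t → ℤ} {eps : Finset (Fin t)}
    (hmem : memCase p t m d s eps) {f : FV p t m} (hf : IsSBF p t m (lamOfN p t d s) eps f)
    {g : SympV p t m ≃ₗ[GaloisField p t] SympV p t m} (hg : IsSymp g) : (fun v => f (g.symm v)) ∈ Ymod p t m d s eps := by
  rw [SBF_iff] at hf
  obtain ⟨F, hF, rfl⟩ := hf
  obtain ⟨A, hA, h⟩ := PhiM_act (p := p) (t := t) (m := m) hg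
  rw [h]
  exact Phi_mem_Y hodd ht hd hmem _ fun j => SSg_thA _ (hA j) (GenD_SSg hodd (hF j))

def actL (g : SympV p t m ≃ₗ[GaloisField p t] SympV p t m) : FV p t m →ₗ[GaloisField p t] FV p t m where
  toFun h := fun v => h (g.symm v)
  map_add' _ _ := rfl
  map_smul' _ _ := rfl

theorem stable_span {S : Set (FV p t m)} (h : ∀ f ∈ S, ∀ g : SympV p t m ≃ₗ[GaloisField p t] SympV p t m, IsSymp g →
    (fun v => f (g.symm v)) ∈ Submodule.span (GaloisField p t) S) : SpStable (Submodule.span (GaloisField p t) S) := by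
  intro g hg f hf
  have : Submodule.span (GaloisField p t) S ≤ (Submodule.span (GaloisField p t) S).comap (actL g) :=
    Submodule.span_le.2 fun f hf => h f hf g hg
  exact this hf

theorem Y_stable (hodd : Odd p) (ht : 1 < t) (hd : d ≤ p ^ t - 2) (s : Fin t → ℤ) (eps : Finset (Fin t)) :
    SpStable (Ymod p t m d s eps) := by
  refine stable_span ?_
  rintro f ⟨s', e', h1, h2, h3⟩ g hg
  exact Y_mono h2 (Phi_act_mem hodd ht hd h1 h3 hg)

theorem Ylt_stable (hodd : Odd p) (ht : 1 < t) (hd : d ≤ p ^ t - 2) {s : Fin t → ℤ} {eps : Finset (Fin t)}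
    (hmem : memCase p t m d s eps) :
    SpStable (Yltmod p t m d s eps) := by
  refine stable_span ?_
  rintro f ⟨s', e', h1, h2, h3, h4⟩ g hg
  exact Y_le_Ylt h1 hmem h2 h3 (Phi_act_mem hodd ht hd h1 h4 hg)

end PartB2

section PartB3
open MvPolynomial

variable {p t m d : ℕ} [Fact p.Prime] [NeZero t]

theorem digs_inj {f g : Fin t → ℕ} (hf : ∀ j, f j ≤ p - 1) (hg : ∀ j, g j ≤ p - 1)
    (h : ∑ j : Fin t, f j * p ^ (j:ℕ) = ∑ j : Fin t, g j * p ^ (j:ℕ)) : f = g := by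
  have hp := (Fact.out : p.Prime).pos
  let f' : Fin t → Fin p := fun j => ⟨f j, by have := hf j; omega⟩
  let g' : Fin t → Fin p := fun j => ⟨g j, by have := hg j; omega⟩
  have : f' = g' := by
    apply finFunctionFinEquiv.injective
    apply Fin.ext
    rw [finFunctionFinEquiv_apply, finFunctionFinEquiv_apply]; exact h
  funext j
  have := congrFun this j
  exact congrArg Fin.val this

theorem digs_lt {f : Fin t → ℕ} (hf : ∀ j, f j ≤ p - 1) : ∑ j : Fin t, f j * p ^ (j:ℕ) < p ^ t := by
  have hp := (Fact.out : p.Prime).pos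
  let f' : Fin t → Fin p := fun j => ⟨f j, by have := hf j; omega⟩
  have := (finFunctionFinEquiv f').2
  rw [finFunctionFinEquiv_apply] at this; exact this

def RedT (p : ℕ) {t m : ℕ} (e : Fin t → Ex m) : Prop := ∀ j, e j ≤ topE p m

def mf (p : ℕ) {t m : ℕ} [Fact p.Prime] (e : Fin t → Ex m) : FV p t m := PhiM p t m fun j => monomial (e j) 1

def NE (p : ℕ) {t m : ℕ} (e : Fin t → Ex m) : Ex m := mkE fun a => ∑ j : Fin t, e j a * p ^ (j:ℕ)

theorem mf_eval (e : Fin t → Ex m) (v : SympV p t m) : mf p e v = eval (crd v) (monomial (NE p e) (1 : GaloisField p t)) := by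
  rw [mf, PhiM_apply, Finset.prod_apply, eval_monomial, one_mul, Finsupp.prod_fintype _ _ (by simp)]
  simp only [evj_monomial, one_mul, NE, mkE_apply]
  simp only [← Finset.prod_pow, ← pow_mul]
  rw [Finset.prod_comm]
  refine Finset.prod_congr rfl fun a _ => ?_
  rw [Finset.prod_pow_eq_pow_sum]

theorem cardK : Nat.card (GaloisField p t) = p ^ t := GaloisField.card p t (NeZero.ne t)

theorem mf_indep : LinearIndependent (GaloisField p t) (fun e : {e : Fin t → Ex m // RedT p e} => mf p e.1) := by
  letI : Fintype (GaloisField p t) := Fintype.ofFinite _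
  have hc : Fintype.card (GaloisField p t) = p ^ t := by rw [← Nat.card_eq_fintype_card, cardK]
  let v : {e : Fin t → Ex m // RedT p e} → restrictDegree (Ix m) (GaloisField p t) (p ^ t - 1) := fun e =>
    ⟨monomial (NE p e.1) 1, by
      rw [mem_restrictDegree]
      intro s hs a
      have : s = NE p e.1 := by
        have := support_monomial_subset hs
        simpa using this
      subst this
      have := digs_lt (p := p) (f := fun j => e.1 j a) (fun j => e.2 j a)
      simp only [NE, mkE_apply]; omega⟩
  have hv : LinearIndependent (GaloisField p t) v := by
    apply LinearIndependent.of_comp (Submodule.subtype _)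
    have hb := (basisMonomials (Ix m) (GaloisField p t)).linearIndependent.comp (fun e : {e : Fin t → Ex m // RedT p e} => NE p e.1) (by
      intro e e' h
      apply Subtype.ext
      have : ∀ a, (fun j => e.1 j a) = (fun j => e'.1 j a) := by
        intro a
        refine digs_inj (p := p) (fun j => e.2 j a) (fun j => e'.2 j a) ?_
        have := DFunLike.congr_fun h a
        simpa [NE] using this
      funext j; ext a
      exact congrFun (this a) j)
    rw [coe_basisMonomials] at hb
    exact hb
  let f : restrictDegree (Ix m) (GaloisField p t) (p ^ t - 1) →ₗ[GaloisField p t] FV p t m :=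
    { toFun := fun P v => eval (crd v) P.1
      map_add' := by intro P Q; funext v; simp
      map_smul' := by intro c P; funext v; simp [smul_eval] }
  have := hv.map' f (by
    rw [LinearMap.ker_eq_bot']
    intro P hP
    apply Subtype.ext
    refine eq_zero_of_eval_eq_zero _ _ P.1 (fun u => ?_) (by rw [hc]; exact P.2)
    have := congrFun hP (vecOf u)
    simpa [f, crd_vecOf] using this)
  have he : (fun e : {e : Fin t → Ex m // RedT p e} => mf p e.1) = f ∘ v := by
    funext e v
    exact mf_eval _ _
  rw [he]; exact this

theorem exists_cf : ∃ g : FV p t m →ₗ[GaloisField p t] ({e : Fin t → Ex m // RedT p e} →₀ GaloisField p t),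
    ∀ e, g (mf p e.1) = Finsupp.single e 1 := by
  obtain ⟨g, hg⟩ := LinearMap.exists_leftInverse_of_injective
    (Finsupp.linearCombination (GaloisField p t) (fun e : {e : Fin t → Ex m // RedT p e} => mf p e.1)) (LinearMap.ker_eq_bot.2 mf_indep)
  refine ⟨g, fun e => ?_⟩
  have := LinearMap.congr_fun hg (Finsupp.single e 1)
  simpa using this

def cfL (p t m : ℕ) [Fact p.Prime] [NeZero t] := Classical.choose (exists_cf (p := p) (t := t) (m := m))
theorem cfL_mf (e : {e : Fin t → Ex m // RedT p e}) : cfL p t m (mf p e.1) = Finsupp.single e 1 :=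
  Classical.choose_spec (exists_cf (p := p) (t := t) (m := m)) e

abbrev LF (p t m : ℕ) [Fact p.Prime] := (Fin t → Ex m) → GaloisField p t

/-- reduced of type `λ(s)` -/
def RT (p t m d : ℕ) [Fact p.Prime] [NeZero t] (s : Fin t → ℤ) (e : Fin t → Ex m) : Prop :=
  RedT p e ∧ ∀ j, ((e j).degree : ℤ) = lamOf p t d s j

def lead (p t m d : ℕ) [Fact p.Prime] [NeZero t] (s : Fin t → ℤ) : FV p t m →ₗ[GaloisField p t] LF p t m where
  toFun w e := if h : RT p t m d s e then cfL p t m w ⟨e, h.1⟩ else 0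
  map_add' a b := by funext e; by_cases h : RT p t m d s e <;> simp [h]
  map_smul' a b := by funext e; by_cases h : RT p t m d s e <;> simp [h]

theorem lead_def (s : Fin t → ℤ) (w : FV p t m) (e : Fin t → Ex m) :
    lead p t m d s w e = if h : RT p t m d s e then cfL p t m w ⟨e, h.1⟩ else 0 := rfl

theorem lead_out {s : Fin t → ℤ} (w : FV p t m) {e : Fin t → Ex m} (h : ¬ RT p t m d s e) : lead p t m d s w e = 0 := by
  rw [lead_def, dif_neg h]

theorem lam_inj {s s' : Fin t → ℤ} (hle : ∀ j, s' j ≤ s j) (h : ∀ j, lamOf p t d s j = lamOf p t d s' j) : s' = s := by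
  have hp : (2 : ℤ) ≤ p := by exact_mod_cast (Fact.out : p.Prime).two_le
  obtain ⟨j0, hj0⟩ := Finite.exists_max (fun j => s j - s' j)
  have h1 := h (j0 - 1)
  simp only [lamOf, sub_add_cancel] at h1
  have h2 := hj0 (j0 - 1)
  have h3 := hle j0
  have h4 : s j0 - s' j0 = 0 := by nlinarith
  funext j
  have := hj0 j
  have := hle j
  omega

theorem lead_mf (ht : 1 < t) (s : Fin t → ℤ) : ∀ n : ℕ, ∀ (e0 : Fin t → Ex m) (s' : Fin t → ℤ), ∑ j, (e0 j).degree = n →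
    (∀ j, ((e0 j).degree : ℤ) = lamOf p t d s' j) → (∀ j, s' j ≤ s j) → ∀ e,
    lead p t m d s (mf p e0) e = if e0 = e ∧ RedT p e ∧ s' = s then 1 else 0 := by
  intro n
  induction n using Nat.strong_induction_on with
  | _ n ih =>
  intro e0 s' hn hdeg hle e
  by_cases hR : RedT p e0
  · rw [lead_def]
    have h1 := cfL_mf ⟨e0, hR⟩
    simp only at h1
    rw [h1]
    by_cases hh : RT p t m d s e
    · rw [dif_pos hh, Finsupp.single_apply]
      by_cases he : e0 = e
      · subst he
        have : s' = s := lam_inj hle fun j => by rw [← hh.2 j, ← hdeg j]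
        rw [if_pos rfl, if_pos ⟨rfl, hR, this⟩]
      · rw [if_neg (fun h => he (congrArg Subtype.val h)), if_neg (fun h => he h.1)]
    · rw [dif_neg hh, if_neg]
      rintro ⟨rfl, -, rfl⟩
      exact hh ⟨hR, hdeg⟩
  · rw [if_neg (by rintro ⟨rfl, h, -⟩; exact hR h)]
    unfold RedT at hR
    push Not at hR
    obtain ⟨j, hj⟩ := hR
    obtain ⟨a, g', hg⟩ := split_nr hj
    have hne1 := fin_succ_ne ht j
    have hcar := PhiM_carry' (p := p) (t := t) (m := m) ht (fun j => monomial (e0 j) 1) j a (monomial g' 1)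
    rw [X_pow_eq_monomial, monomial_mul, one_mul, ← hg, Function.update_eq_self_iff.2 rfl] at hcar
    let e1 := Function.update (Function.update e0 j g') (j+1) (Finsupp.single a 1 + e0 (j+1))
    have he1 : mf p e0 = mf p e1 := by
      rw [mf, hcar, mf]
      congr 1
      funext i
      simp only [e1, Function.update_apply]
      split_ifs with c1 c2
      · rw [X, monomial_mul, one_mul]
      · rfl
      · rfl
    have hp := (Fact.out : p.Prime).two_le
    have hdj : (e0 j).degree = p + g'.degree := by rw [hg]; simp [map_add]
    have hd1 : ∀ i, ((e1 i).degree : ℤ) = lamOf p t d (drp s' (j+1)) i := by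
      intro i
      rw [lam_drp ht, ← hdeg i]
      simp only [e1, Function.update_apply]
      by_cases c1 : i = j + 1
      · subst c1; simp [hne1, map_add]; ring
      · by_cases c2 : i = j
        · subst c2; simp [c1, hdj]
        · simp [c1, c2]
    have hlt : ∑ i, (e1 i).degree < ∑ i, (e0 i).degree := by
      have : ∑ i, ((e1 i).degree : ℤ) = ∑ i, ((e0 i).degree : ℤ) - p + 1 := by
        simp only [hd1, lam_drp ht, Finset.sum_add_distrib, Finset.sum_sub_distrib, hdeg]
        simp
      have h2 : ((∑ i, (e1 i).degree : ℕ) : ℤ) = ((∑ i, (e0 i).degree : ℕ) : ℤ) - p + 1 := by push_cast; exact this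
      omega
    have hd' : ∀ i, drp s' (j+1) i ≤ s' i := by
      intro i; unfold drp; rw [Function.update_apply]; split_ifs with c
      · subst c; omega
      · exact le_rfl
    rw [he1, ih _ (hn ▸ hlt) e1 (drp s' (j+1)) rfl hd1 (fun i => (hd' i).trans (hle i)), if_neg]
    rintro ⟨-, -, h⟩
    have h1 := congrFun h (j+1)
    have h2 := hle (j+1)
    simp [drp] at h1
    omega

def cfM (p t m : ℕ) [Fact p.Prime] (e : Fin t → Ex m) : MultilinearMap (GaloisField p t) (fun _ : Fin t => PV p t m) (GaloisField p t) :=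
  (MultilinearMap.mkPiAlgebra (GaloisField p t) (Fin t) (GaloisField p t)).compLinearMap
    fun j => lcoeff (GaloisField p t) (e j)

theorem cfM_apply (e : Fin t → Ex m) (F : Fin t → PV p t m) : cfM p t m e F = ∏ j, coeff (e j) (F j) := by
  simp [cfM]

theorem hom_span_mono {lam : ℕ} {F : PV p t m} (hF : F.IsHomogeneous lam) :
    F ∈ Submodule.span (GaloisField p t) {G | ∃ g : Ex m, g.degree = lam ∧ G = monomial g 1} := by
  rw [F.as_sum]
  refine Submodule.sum_mem _ fun g hg => ?_
  rw [show monomial g (coeff g F) = coeff g F • monomial g (1 : GaloisField p t) by rw [smul_monomial, smul_eq_mul, mul_one]]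
  refine Submodule.smul_mem _ _ (Submodule.subset_span ⟨g, ?_, rfl⟩)
  have := hF (mem_support_iff.1 hg)
  rwa [Finsupp.degree_eq_weight_one]

/-- product formula for leads -/
theorem lead_Phi (ht : 1 < t) {s s' : Fin t → ℤ} (hle : ∀ j, s' j ≤ s j) (hl : ∀ j, 0 ≤ lamOf p t d s' j)
    {F : Fin t → PV p t m} (hF : ∀ j, (F j).IsHomogeneous (lamOfN p t d s' j)) (e : Fin t → Ex m) :
    lead p t m d s (PhiM p t m F) e = if RedT p e ∧ s' = s then ∏ j, coeff (e j) (F j) else 0 := by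
  let c : GaloisField p t := if RedT p e ∧ s' = s then 1 else 0
  let f : MultilinearMap (GaloisField p t) (fun _ : Fin t => PV p t m) (GaloisField p t) :=
    ((LinearMap.proj e).comp (lead p t m d s)).compMultilinearMap (PhiM p t m) - c • cfM p t m e
  have : f F ∈ (⊥ : Submodule (GaloisField p t) (GaloisField p t)) := by
    refine ml_span f (fun j => {G | ∃ g : Ex m, g.degree = lamOfN p t d s' j ∧ G = monomial g 1}) ⊥ ?_ F (fun j => hom_span_mono (hF j))
    intro G hG
    choose g hg1 hg2 using hG
    have hG' : G = fun j => monomial (g j) 1 := funext hg2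
    rw [Submodule.mem_bot]
    simp only [f, MultilinearMap.sub_apply, LinearMap.compMultilinearMap_apply, LinearMap.comp_apply, LinearMap.proj_apply,
      MultilinearMap.smul_apply, cfM_apply, c]
    rw [hG']
    have := lead_mf (p := p) (d := d) ht s _ g s' rfl (fun j => by rw [hg1, lamN_cast (hl j)]) hle e
    rw [mf] at this
    rw [this, sub_eq_zero]
    by_cases c1 : RedT p e ∧ s' = s
    · rw [if_pos c1]
      by_cases c2 : g = e
      · subst c2; rw [if_pos ⟨rfl, c1⟩]; simp
      · rw [if_neg (fun h => c2 h.1)]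
        have : ∃ j, g j ≠ e j := by by_contra h; push Not at h; exact c2 (funext h)
        obtain ⟨j, hj⟩ := this
        rw [Finset.prod_eq_zero (Finset.mem_univ j)]
        · simp
        · rw [coeff_monomial, if_neg hj]
    · rw [if_neg c1, if_neg (fun h => c1 h.2)]; simp
  rw [Submodule.mem_bot] at this
  simp only [f, MultilinearMap.sub_apply, LinearMap.compMultilinearMap_apply, LinearMap.comp_apply, LinearMap.proj_apply,
      MultilinearMap.smul_apply, cfM_apply, c, sub_eq_zero] at this
  rw [this]
  split_ifs <;> simp

end PartB3

section PartB4
open MvPolynomial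

variable {p t m d : ℕ} [Fact p.Prime] [NeZero t]

theorem lead_low (ht : 1 < t) {s s' : Fin t → ℤ} {eps eps' : Finset (Fin t)} (hodd : Odd p) (hm' : memCase p t m d s' eps') (hle : leSd p t m d s' eps' s eps)
    (hne : s' ≠ s) {f : FV p t m} (hf : IsSBF p t m (lamOfN p t d s') eps' f) : lead p t m d s f = 0 := by
  obtain ⟨F, hF, rfl⟩ := (SBF_iff _ _ _).1 hf
  funext e
  rw [lead_Phi ht hle.1 (fun j => ((memCase_iff.1 hm').2.1 j).1) (fun j => (GenD_SSg hodd (hF j)).1), if_neg (fun h => hne h.2)]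
  rfl

theorem lead_Ylt (ht : 1 < t) {s : Fin t → ℤ} {eps : Finset (Fin t)} (hodd : Odd p) (hm : memCase p t m d s eps) {w : FV p t m}
    (hw : w ∈ Yltmod p t m d s eps) : lead p t m d s w = 0 := by
  have : Yltmod p t m d s eps ≤ (lead p t m d s).ker := by
    refine Submodule.span_le.2 ?_
    rintro f ⟨s', e', h1, h2, h3, h4⟩
    refine lead_low ht hodd h1 h2 ?_ h4
    rintro rfl
    exact h3 ⟨rfl, le_same h1 hm h2⟩
  exact this hw

def boxT (p t m : ℕ) : Finset (Fin t → Ex m) := Fintype.piFinset (fun _ => Finset.Iic (topE p m))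

theorem mem_box {e : Fin t → Ex m} : e ∈ boxT p t m ↔ RedT p e := by
  simp [boxT, RedT]

def recL (p t m : ℕ) [Fact p.Prime] [NeZero t] : LF p t m →ₗ[GaloisField p t] FV p t m where
  toFun c := ∑ e ∈ boxT p t m, c e • mf p e
  map_add' a b := by simp [add_smul, Finset.sum_add_distrib]
  map_smul' a b := by simp [Finset.smul_sum, smul_smul]

theorem GenD_red {lam : ℕ} {pl : Prop} {F : PV p t m} (hF : F ∈ GenD (GaloisField p t) p m lam pl) {g : Ex m}
    (hg : coeff g F ≠ 0) : g ≤ topE p m := by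
  obtain ⟨g', h, hd, hc⟩ := hF
  by_contra hn
  have h1 : g' ≠ g := by rintro rfl; exact hn h
  have h2 : twE p g' ≠ g := by rintro rfl; exact hn (twE_le _)
  rcases hc with ⟨_, _, rfl⟩ | ⟨_, _, _, rfl⟩ | ⟨_, _, rfl⟩
  · simp [coeff_monomial, h1] at hg
  · simp [coeff_monomial, h1] at hg
  · simp [coeff_monomial, h1, h2] at hg

theorem red_sum {F : PV p t m} (hF : ∀ g, coeff g F ≠ 0 → g ≤ topE p m) :
    F = ∑ g ∈ Finset.Iic (topE p m), coeff g F • monomial g (1 : GaloisField p t) := by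
  conv_lhs => rw [F.as_sum]
  rw [← Finset.sum_subset (s₁ := F.support) (s₂ := Finset.Iic (topE p m)) (f := fun g => coeff g F • monomial g (1 : GaloisField p t))]
  · refine Finset.sum_congr rfl fun g _ => ?_
    rw [smul_monomial, smul_eq_mul, mul_one]
  · intro g hg; rw [Finset.mem_Iic]; exact hF g (mem_support_iff.1 hg)
  · intro g _ hg; rw [notMem_support_iff.1 hg, zero_smul]

theorem Phi_red_sum {F : Fin t → PV p t m} (hF : ∀ j g, coeff g (F j) ≠ 0 → g ≤ topE p m) :
    PhiM p t m F = ∑ e ∈ boxT p t m, (∏ j, coeff (e j) (F j)) • mf p e := by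
  have : F = fun j => ∑ g ∈ Finset.Iic (topE p m), coeff g (F j) • monomial g (1 : GaloisField p t) := by
    funext j; exact red_sum (hF j)
  conv_lhs => rw [this]
  rw [MultilinearMap.map_sum_finset]
  refine Finset.sum_congr rfl fun e _ => ?_
  rw [MultilinearMap.map_smul_univ]; rfl

theorem Y_rec (ht : 1 < t) {s : Fin t → ℤ} {eps : Finset (Fin t)} (hodd : Odd p) (hm : memCase p t m d s eps) {w : FV p t m}
    (hw : w ∈ Ymod p t m d s eps) : w - recL p t m (lead p t m d s w) ∈ Yltmod p t m d s eps := by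
  have : Ymod p t m d s eps ≤ (Yltmod p t m d s eps).comap (LinearMap.id - (recL p t m).comp (lead p t m d s)) := by
    refine Submodule.span_le.2 ?_
    rintro f ⟨s', e', h1, h2, h4⟩
    simp only [Submodule.comap_coe, Set.mem_preimage, LinearMap.sub_apply, LinearMap.id_apply, LinearMap.comp_apply, SetLike.mem_coe]
    by_cases hs : s' = s
    · subst hs
      have he := le_same h1 hm h2
      subst he
      obtain ⟨F, hF, rfl⟩ := (SBF_iff _ _ _).1 h4
      convert Submodule.zero_mem _
      rw [sub_eq_zero]
      conv_lhs => rw [Phi_red_sum (fun j g => GenD_red (hF j))]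
      simp only [recL, LinearMap.coe_mk, AddHom.coe_mk]
      refine Finset.sum_congr rfl fun e he => ?_
      rw [lead_Phi ht (fun _ => le_rfl) (fun j => ((memCase_iff.1 hm).2.1 j).1) (fun j => (GenD_SSg hodd (hF j)).1),
        if_pos ⟨mem_box.1 he, rfl⟩]
    · rw [lead_low ht hodd h1 h2 hs h4, map_zero, sub_zero]
      exact Submodule.subset_span ⟨s', e', h1, h2, fun h => hs h.1, h4⟩
  exact this hw

theorem Ylt_of_lead (ht : 1 < t) {s : Fin t → ℤ} {eps : Finset (Fin t)} (hodd : Odd p) (hm : memCase p t m d s eps) {w : FV p t m}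
    (hw : w ∈ Ymod p t m d s eps) (h : lead p t m d s w = 0) : w ∈ Yltmod p t m d s eps := by
  have := Y_rec ht hodd hm hw
  rwa [h, map_zero, sub_zero] at this

theorem lead_sign (ht : 1 < t) {s : Fin t → ℤ} {eps : Finset (Fin t)} (hodd : Odd p) (hm : memCase p t m d s eps) {w : FV p t m}
    (hw : w ∈ Ymod p t m d s eps) {e : Fin t → Ex m} (he : RT p t m d s e) {j : Fin t}
    (hj : lamOf p t d s j = m * ((p:ℤ)-1)) :
    lead p t m d s w (Function.update e j (twE p (e j))) = pm (GaloisField p t) (j ∈ eps) * sgE (GaloisField p t) (e j) * lead p t m d s w e := by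
  let L : FV p t m →ₗ[GaloisField p t] GaloisField p t := (LinearMap.proj (Function.update e j (twE p (e j)))).comp (lead p t m d s)
    - (pm (GaloisField p t) (j ∈ eps) * sgE (GaloisField p t) (e j)) • (LinearMap.proj e).comp (lead p t m d s)
  have hL : Ymod p t m d s eps ≤ L.ker := by
    refine Submodule.span_le.2 ?_
    rintro f ⟨s', e', h1, h2, h4⟩
    simp only [SetLike.mem_coe, LinearMap.mem_ker, L, LinearMap.sub_apply, LinearMap.smul_apply, LinearMap.comp_apply, LinearMap.proj_apply, sub_eq_zero, smul_eq_mul]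
    by_cases hs : s' = s
    · subst hs
      have he' := le_same h1 hm h2
      subst he'
      obtain ⟨F, hF, rfl⟩ := (SBF_iff _ _ _).1 h4
      have hl := fun j => ((memCase_iff.1 hm).2.1 j).1
      have hR : RedT p (Function.update e j (twE p (e j))) := by
        intro i
        by_cases c : i = j
        · subst c; rw [Function.update_self]; exact twE_le _
        · rw [Function.update_of_ne c]; exact he.1 i
      rw [lead_Phi ht (fun _ => le_rfl) hl (fun j => (GenD_SSg hodd (hF j)).1),
        lead_Phi ht (fun _ => le_rfl) hl (fun j => (GenD_SSg hodd (hF j)).1), if_pos ⟨hR, rfl⟩, if_pos ⟨he.1, rfl⟩]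
      rw [← Finset.mul_prod_erase Finset.univ _ (Finset.mem_univ j), ← Finset.mul_prod_erase Finset.univ (fun j => coeff (e j) (F j)) (Finset.mem_univ j), Function.update_self]
      have hN := (lamN_mu (hl j)).2 hj
      have hd : (e j).degree = m * (p-1) := by
        have := he.2 j
        rw [hj, ← p_cast] at this
        exact_mod_cast this
      rw [(GenD_SSg hodd (hF j)).2 hN (e j) (he.1 j) hd, mul_assoc, mul_assoc, mul_assoc]
      congr 3
      refine Finset.prod_congr rfl fun i hi => ?_
      rw [Function.update_of_ne (Finset.ne_of_mem_erase hi)]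
    · rw [lead_low ht hodd h1 h2 hs h4]; simp
  have := hL hw
  simpa only [LinearMap.mem_ker, L, LinearMap.sub_apply, LinearMap.smul_apply, LinearMap.comp_apply, LinearMap.proj_apply, sub_eq_zero, smul_eq_mul] using this

end PartB4

section PartC1
open MvPolynomial

variable {p t m d : ℕ} [Fact p.Prime] [NeZero t]

def lc {m : ℕ} (w : Ix m → ℤ) : Ix m → ℤ := Sum.elim (fun i => w (.inr i)) (fun i => - w (.inl i))

def ellP (p t : ℕ) {m : ℕ} [Fact p.Prime] (w : Ix m → ℤ) : PV p t m := ∑ a, C ((lc w a : ℤ) : GaloisField p t) * X a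

def S1 (p t : ℕ) {m : ℕ} [Fact p.Prime] (w : Ix m → ℤ) : PV p t m →ₐ[GaloisField p t] Polynomial (PV p t m) :=
  aeval fun b => Polynomial.C (X b) + Polynomial.X * Polynomial.C (C ((w b : ℤ) : GaloisField p t))

def DL (p t : ℕ) {m : ℕ} [Fact p.Prime] (w : Ix m → ℤ) (l : ℕ) : PV p t m →ₗ[GaloisField p t] PV p t m where
  toFun F := ellP p t w ^ l * (S1 p t w F).coeff l
  map_add' F G := by simp [mul_add]
  map_smul' c F := by simp

theorem DL_apply (w : Ix m → ℤ) (l : ℕ) (F : PV p t m) : DL p t w l F = ellP p t w ^ l * (S1 p t w F).coeff l := rfl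

theorem S1_X (w : Ix m → ℤ) (b : Ix m) : S1 p t w (X b) = Polynomial.C (X b) + Polynomial.X * Polynomial.C (C ((w b : ℤ) : GaloisField p t)) := by
  simp [S1]

theorem S1_coeff_zero (w : Ix m → ℤ) (F : PV p t m) : (S1 p t w F).coeff 0 = F := by
  induction F using MvPolynomial.induction_on with
  | C c => 
    have : S1 p t w (C c) = Polynomial.C (C c) := by
      rw [← algebraMap_eq, AlgHom.commutes]; rfl
    rw [this]; simp
  | add F G hF hG => rw [map_add, Polynomial.coeff_add, hF, hG]
  | mul_X F b hF => rw [map_mul, Polynomial.mul_coeff_zero, hF, S1_X]; simp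

theorem S1_C (w : Ix m → ℤ) (c : GaloisField p t) : S1 p t w (C c) = Polynomial.C (C c) := by
  rw [← algebraMap_eq, AlgHom.commutes]; rfl

theorem S1_coeff_one (w : Ix m → ℤ) (F : PV p t m) : (S1 p t w F).coeff 1 = ∑ b, C ((w b : ℤ) : GaloisField p t) * pderiv b F := by
  induction F using MvPolynomial.induction_on with
  | C c => rw [S1_C]; simp [Polynomial.coeff_C]
  | add F G hF hG => simp only [map_add, Polynomial.coeff_add, hF, hG, mul_add, Finset.sum_add_distrib]
  | mul_X F b hF =>
    rw [map_mul, Polynomial.mul_coeff_one, hF, S1_coeff_zero, S1_X]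
    simp only [Polynomial.coeff_add, Polynomial.coeff_C_zero, Polynomial.coeff_X_mul_zero, add_zero, Polynomial.coeff_X_mul, Derivation.leibniz, pderiv_X, smul_eq_mul]
    rw [show (Polynomial.C (X b : PV p t m)).coeff 1 = 0 by simp [Polynomial.coeff_C], zero_add]
    simp only [mul_add, Finset.sum_add_distrib, Finset.sum_mul]
    have h1 : ∑ c, C ((w c : ℤ) : GaloisField p t) * (F * (Pi.single c 1 : Ix m → PV p t m) b) = F * C ((w b : ℤ) : GaloisField p t) := by
      rw [Finset.sum_eq_single b]
      · rw [Pi.single_eq_same]; ring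
      · intro c _ hc
        rw [Pi.single_eq_of_ne hc.symm]; simp
      · simp
    rw [h1]
    congr 1
    refine Finset.sum_congr rfl fun c _ => ?_
    ring

theorem DL_zero (w : Ix m → ℤ) (F : PV p t m) : DL p t w 0 F = F := by
  rw [DL_apply, S1_coeff_zero]; simp

theorem DL_one (w : Ix m → ℤ) (F : PV p t m) : DL p t w 1 F =
    ∑ a, ∑ b, C (((lc w a : ℤ) : GaloisField p t) * ((w b : ℤ) : GaloisField p t)) * (X a * pderiv b F) := by
  rw [DL_apply, S1_coeff_one, pow_one, ellP, Finset.sum_mul_sum]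
  refine Finset.sum_congr rfl fun a _ => Finset.sum_congr rfl fun b _ => ?_
  rw [C_mul]; ring

theorem ell_hom (w : Ix m → ℤ) : (ellP p t w).IsHomogeneous 1 :=
  IsHomogeneous.sum _ _ _ fun a _ => (isHomogeneous_X _ a).C_mul _

/-- joint homogeneity -/
theorem S1_hom (w : Ix m → ℤ) {n : ℕ} {F : PV p t m} (hF : F.IsHomogeneous n) (l : ℕ) :
    (DL p t w l F).IsHomogeneous n := by
  have hmul : ∀ n n' : ℕ, ∀ A B : Polynomial (PV p t m), (∀ l, (ellP p t w ^ l * A.coeff l).IsHomogeneous n) →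
      (∀ l, (ellP p t w ^ l * B.coeff l).IsHomogeneous n') → ∀ l, (ellP p t w ^ l * (A * B).coeff l).IsHomogeneous (n + n') := by
    intro n n' A B hA hB l
    rw [Polynomial.coeff_mul, Finset.mul_sum]
    refine IsHomogeneous.sum _ _ _ fun x hx => ?_
    have : ellP p t w ^ l * (A.coeff x.1 * B.coeff x.2) = (ellP p t w ^ x.1 * A.coeff x.1) * (ellP p t w ^ x.2 * B.coeff x.2) := by
      rw [← Finset.HasAntidiagonal.mem_antidiagonal.1 hx, pow_add]; ring
    rw [this]
    exact (hA _).mul (hB _)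
  have hX : ∀ b l, (ellP p t w ^ l * (S1 p t w (X b)).coeff l).IsHomogeneous 1 := by
    intro b l
    rw [S1_X]
    rcases l with _ | _ | l
    · simp; exact isHomogeneous_X _ _
    · simp [Polynomial.coeff_C]
      rw [mul_comm]
      have := (ell_hom (p := p) (t := t) w).C_mul ((w b : ℤ) : GaloisField p t)
      simpa using this
    · rw [Polynomial.coeff_add, Polynomial.coeff_C_succ, Polynomial.coeff_X_mul, Polynomial.coeff_C_succ, add_zero, mul_zero]
      exact isHomogeneous_zero _ _ _
  have hmon : ∀ g : Ex m, ∀ l, (DL p t w l (monomial g 1)).IsHomogeneous g.degree := by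
    intro g
    induction g using Finsupp.induction_linear with
    | zero =>
      intro l
      rw [DL_apply, show (monomial (0 : Ex m) (1 : GaloisField p t)) = C 1 from rfl, S1_C]
      rcases l with _ | l
      · simp; exact isHomogeneous_one _ _
      · rw [Polynomial.coeff_C_succ, mul_zero]; exact isHomogeneous_zero _ _ _
    | add f g hf hg =>
      intro l
      rw [DL_apply, show (monomial (f + g) (1 : GaloisField p t)) = monomial f 1 * monomial g 1 by simp [monomial_mul], map_mul, map_add]
      exact hmul _ _ _ _ hf hg l
    | single b n =>
      induction n with
      | zero =>
        intro l
        rw [Finsupp.single_zero, DL_apply, show (monomial (0 : Ex m) (1 : GaloisField p t)) = C 1 from rfl, S1_C]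
        rcases l with _ | l
        · simp; exact isHomogeneous_one _ _
        · rw [Polynomial.coeff_C_succ, mul_zero]; exact isHomogeneous_zero _ _ _
      | succ n ih =>
        intro l
        rw [DL_apply, show (monomial (Finsupp.single b (n+1)) (1 : GaloisField p t)) = monomial (Finsupp.single b n) 1 * X b by
          rw [X, monomial_mul, ← Finsupp.single_add, mul_one], map_mul,
          show (Finsupp.single b (n+1) : Ex m).degree = (Finsupp.single b n : Ex m).degree + 1 by simp]
        exact hmul _ _ _ _ ih (hX b) l
  rw [F.as_sum, map_sum]
  refine IsHomogeneous.sum _ _ _ fun g hg => ?_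
  have h1 := hF (mem_support_iff.1 hg)
  have h1 : g.degree = n := by rw [Finsupp.degree_eq_weight_one]; exact h1
  rw [show monomial g (coeff g F) = coeff g F • monomial g (1 : GaloisField p t) by rw [smul_monomial, smul_eq_mul, mul_one], map_smul, ← h1,
    smul_eq_C_mul]
  exact (hmon g l).C_mul _

theorem DL_red (w : Ix m → ℤ) {l : ℕ} (hl : p ≤ l) (F : PV p t m) {g : Ex m} (hg : g ≤ topE p m) : coeff g (DL p t w l F) = 0 := by
  obtain ⟨r, rfl⟩ := Nat.exists_eq_add_of_le hl
  rw [DL_apply, pow_add, mul_assoc, ellP]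
  haveI : ExpChar (PV p t m) p := inferInstance
  rw [sum_pow_char p, Finset.sum_mul, coeff_sum]
  refine Finset.sum_eq_zero fun a _ => ?_
  rw [mul_pow, mul_comm (_ ^ p), mul_assoc, red_nr hg]

theorem S1_eval (w : Ix m → ℤ) (u : Ix m → GaloisField p t) (y : GaloisField p t) (F : PV p t m) :
    eval (fun b => u b + y * w b) F = (S1 p t w F).eval₂ (eval u) y := by
  induction F using MvPolynomial.induction_on with
  | C c => rw [S1_C]; simp
  | add F G hF hG => simp only [map_add, Polynomial.eval₂_add, hF, hG]
  | mul_X F b hF =>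
    rw [map_mul, map_mul, Polynomial.eval₂_mul, hF, S1_X, Polynomial.eval₂_add, Polynomial.eval₂_C, Polynomial.eval₂_mul,
      Polynomial.eval₂_X, Polynomial.eval₂_C, eval_X, eval_X, eval_C]

end PartC1

section PartC2
open MvPolynomial

variable {p t m d : ℕ} [Fact p.Prime] [NeZero t]

instance fintypeGF : Fintype (GaloisField p t) := Fintype.ofFinite _

theorem cardF : Fintype.card (GaloisField p t) = p ^ t := by rw [← Nat.card_eq_fintype_card, cardK]

theorem sum_pow_all {M : ℕ} (hM : 0 < M) : ∑ x : GaloisField p t, x ^ M = if p ^ t - 1 ∣ M then -1 else 0 := by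
  rw [← cardF (p := p) (t := t), ← FiniteField.sum_pow_units (GaloisField p t) M]
  rw [← Finset.sum_filter_add_sum_filter_not Finset.univ (fun x : GaloisField p t => x ≠ 0)]
  have : ∑ x ∈ Finset.univ.filter (fun x : GaloisField p t => ¬ x ≠ 0), x ^ M = 0 := by
    refine Finset.sum_eq_zero fun x hx => ?_
    have : x = 0 := by simpa using hx
    rw [this, zero_pow hM.ne']
  rw [this, add_zero]
  rw [← Equiv.sum_comp (unitsEquivNeZero (G₀ := GaloisField p t)).symm]
  rw [Finset.sum_subtype (p := fun x : GaloisField p t => x ≠ 0) (F := inferInstance)]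
  · refine Finset.sum_congr rfl fun x _ => ?_
    simp
  · simp

def wv (p t : ℕ) {m : ℕ} [Fact p.Prime] (w : Ix m → ℤ) : SympV p t m := vecOf fun a => ((w a : ℤ) : GaloisField p t)

theorem sform_wv (w : Ix m → ℤ) (v : SympV p t m) : sform v (wv p t w) = ∑ a, ((lc w a : ℤ) : GaloisField p t) * crd v a := by
  rw [sform_crd, wv, crd_vecOf, Fintype.sum_sum_type, ← Finset.sum_add_distrib]
  refine Finset.sum_congr rfl fun i _ => ?_
  simp [lc]; ring

theorem sform_add_left (u v w : SympV p t m) : sform (u + v) w = sform u w + sform v w := by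
  simp only [sform, ← Finset.sum_add_distrib]
  refine Finset.sum_congr rfl fun i _ => ?_
  simp; ring
theorem sform_smul_left (c : GaloisField p t) (v w : SympV p t m) : sform (c • v) w = c * sform v w := by
  simp only [sform, Finset.mul_sum]
  refine Finset.sum_congr rfl fun i _ => ?_
  simp; ring
theorem sform_swap (v w : SympV p t m) : sform v w = - sform w v := by
  simp only [sform, ← Finset.sum_neg_distrib]
  refine Finset.sum_congr rfl fun i _ => ?_
  ring
theorem sform_self (v : SympV p t m) : sform v v = 0 := by
  simp only [sform]
  refine Finset.sum_eq_zero fun i _ => ?_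
  ring
theorem sform_add_right (u v w : SympV p t m) : sform u (v + w) = sform u v + sform u w := by
  rw [sform_swap, sform_add_left, sform_swap v, sform_swap w]; ring
theorem sform_smul_right (c : GaloisField p t) (v w : SympV p t m) : sform v (c • w) = c * sform v w := by
  rw [sform_swap, sform_smul_left, sform_swap w]; ring

def tvL (a : GaloisField p t) (u : SympV p t m) : SympV p t m →ₗ[GaloisField p t] SympV p t m where
  toFun v := v + (a * sform v u) • u
  map_add' v w := by rw [sform_add_left, mul_add, add_smul]; abel
  map_smul' c v := by
    rw [sform_smul_left, RingHom.id_apply, smul_add, smul_smul]; congr 2; ring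

theorem tvL_apply (a : GaloisField p t) (u v : SympV p t m) : tvL a u v = v + (a * sform v u) • u := rfl

theorem tv_inv (a : GaloisField p t) (u v : SympV p t m) : tvL (-a) u (tvL a u v) = v := by
  rw [tvL_apply, tvL_apply, sform_add_left, sform_smul_left, sform_self, mul_zero, add_zero, add_assoc, ← add_smul]
  simp

def tvE (a : GaloisField p t) (u : SympV p t m) : SympV p t m ≃ₗ[GaloisField p t] SympV p t m :=
  { tvL (-a) u with
    invFun := tvL a u
    left_inv := fun v => by have := tv_inv (-a) u v; rw [neg_neg] at this; exact this
    right_inv := fun v => tv_inv a u v }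

theorem tvE_symm (a : GaloisField p t) (u v : SympV p t m) : (tvE a u).symm v = v + (a * sform v u) • u := rfl

theorem tvE_symp (a : GaloisField p t) (u : SympV p t m) : IsSymp (tvE a u) := by
  intro v w
  change sform (v + (-a * sform v u) • u) (w + (-a * sform w u) • u) = _
  simp only [sform_add_left, sform_add_right, sform_smul_left, sform_smul_right, sform_self, sform_swap u w]
  ring

def Xop (w : Ix m → ℤ) (n : ℕ) : FV p t m →ₗ[GaloisField p t] FV p t m :=
  - ∑ a : GaloisField p t, a ^ n • actL (tvE a (wv p t w))

theorem Xop_apply (w : Ix m → ℤ) (n : ℕ) (f : FV p t m) (v : SympV p t m) :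
    Xop w n f v = - ∑ a : GaloisField p t, a ^ n * f (v + (a * sform v (wv p t w)) • wv p t w) := by
  simp only [Xop, LinearMap.neg_apply, LinearMap.sum_apply, Pi.neg_apply, Finset.sum_apply, LinearMap.smul_apply, Pi.smul_apply, smul_eq_mul]
  rfl

theorem Xop_stable {W : Submodule (GaloisField p t) (FV p t m)} (hW : SpStable W) (w : Ix m → ℤ) (n : ℕ) {f : FV p t m} (hf : f ∈ W) :
    Xop w n f ∈ W := by
  simp only [Xop, LinearMap.neg_apply, LinearMap.sum_apply, LinearMap.smul_apply]
  exact W.neg_mem (W.sum_mem fun a _ => W.smul_mem _ (hW _ (tvE_symp _ _) f hf))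

theorem evj_tv (w : Ix m → ℤ) (j : ℕ) (a : GaloisField p t) (F : PV p t m) {N : ℕ} (hN : (S1 p t w F).natDegree < N) (v : SympV p t m) :
    evj p t m j F (v + (a * sform v (wv p t w)) • wv p t w) = ∑ l ∈ Finset.range N, a ^ (l * p ^ j) * evj p t m j (DL p t w l F) v := by
  rw [evj_apply]
  have h1 : (fun b => crd (v + (a * sform v (wv p t w)) • wv p t w) b ^ p ^ j) =
      fun b => (crd v b ^ p ^ j) + (a * sform v (wv p t w)) ^ p ^ j * w b := by
    funext b
    have : crd (v + (a * sform v (wv p t w)) • wv p t w) b = crd v b + (a * sform v (wv p t w)) * w b := by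
      rw [← smul_eq_mul]
      rcases b with b | b <;> rfl
    rw [this, add_pow_char_pow, mul_pow, cast_pow_p]
  have h2 : eval (fun b => crd v b ^ p ^ j) (ellP p t w) = sform v (wv p t w) ^ p ^ j := by
    rw [sform_wv, sum_pow_char_pow, ellP, map_sum]
    refine Finset.sum_congr rfl fun b _ => ?_
    rw [map_mul, eval_C, eval_X, mul_pow, cast_pow_p]
  rw [h1, S1_eval, Polynomial.eval₂_eq_sum_range' _ hN]
  refine Finset.sum_congr rfl fun l _ => ?_
  rw [evj_apply, DL_apply, map_mul, map_pow, h2]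
  ring

theorem Xop_Phi (w : Ix m → ℤ) {n : ℕ} (hn : 0 < n) (F : Fin t → PV p t m) {N : ℕ} (hN : ∀ j, (S1 p t w (F j)).natDegree < N) :
    Xop w n (PhiM p t m F) = ∑ l ∈ Fintype.piFinset (fun _ : Fin t => Finset.range N),
      if p ^ t - 1 ∣ n + ∑ j : Fin t, l j * p ^ (j:ℕ) then PhiM p t m (fun j => DL p t w (l j) (F j)) else 0 := by
  funext v
  rw [Xop_apply, Finset.sum_apply]
  simp only [PhiM_apply, Finset.prod_apply]
  have h1 : ∀ a : GaloisField p t, a ^ n * ∏ j : Fin t, evj p t m j (F j) (v + (a * sform v (wv p t w)) • wv p t w) =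
      ∑ l ∈ Fintype.piFinset (fun _ : Fin t => Finset.range N), a ^ (n + ∑ j : Fin t, l j * p ^ (j:ℕ)) * ∏ j : Fin t, evj p t m j (DL p t w (l j) (F j)) v := by
    intro a
    rw [Finset.prod_congr rfl fun (j : Fin t) _ => evj_tv w j a (F j) (hN j) v, Finset.prod_univ_sum, Finset.mul_sum]
    refine Finset.sum_congr rfl fun l _ => ?_
    rw [Finset.prod_mul_distrib, Finset.prod_pow_eq_pow_sum, pow_add, mul_assoc]
  simp only [h1]
  rw [Finset.sum_comm, ← Finset.sum_neg_distrib]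
  refine Finset.sum_congr rfl fun l _ => ?_
  rw [← Finset.sum_mul, sum_pow_all (by omega)]
  split_ifs
  · simp
  · simp

def nI (p t : ℕ) (i : ℕ) : ℕ := p ^ t - 1 - p ^ i

theorem pow_lt_q (ht : 1 < t) (hodd : Odd p) (i : Fin t) : p ^ (i:ℕ) + 1 < p ^ t - 1 ∧ 0 < p ^ (i:ℕ) := by
  have hp : 3 ≤ p := by
    have h2 := (Fact.out : p.Prime).two_le
    rcases hodd with ⟨r, hr⟩; omega
  have h1 : p ^ (i:ℕ) ≤ p ^ (t-1) := Nat.pow_le_pow_right (by omega) (by have := i.2; omega)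
  have h2 : p ^ t = p ^ (t-1) * p := by rw [← pow_succ]; congr 1; omega
  have h3 : p ≤ p ^ (t-1) := Nat.le_self_pow (by omega) p
  have h4 : p ^ (t-1) * 3 ≤ p ^ (t-1) * p := Nat.mul_le_mul_left _ hp
  exact ⟨by omega, pow_pos (by omega) _⟩

theorem nI_dvd (ht : 1 < t) (hodd : Odd p) (i : Fin t) {M : ℕ} (hM : M ≤ p ^ t - 1) : p ^ t - 1 ∣ nI p t i + M ↔ M = p ^ (i:ℕ) := by
  obtain ⟨h1, h2⟩ := pow_lt_q ht hodd i
  unfold nI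
  constructor
  · rintro ⟨c, hc⟩
    have : c = 1 := by
      rcases c with _ | _ | c
      · omega
      · rfl
      · exfalso
        have : p ^ t - 1 - p ^ (i:ℕ) + M = (p^t - 1) * c + 2 * (p^t-1) := by rw [hc]; ring
        have := Nat.zero_le ((p^t-1)*c)
        omega
    subst this; omega
  · rintro rfl; exact ⟨1, by omega⟩

theorem single_digs (i : Fin t) (c : ℕ) : ∑ j : Fin t, (Pi.single i c : Fin t → ℕ) j * p ^ (j:ℕ) = c * p ^ (i:ℕ) := by
  rw [Finset.sum_eq_single i]
  · simp
  · intro j _ hj; rw [Pi.single_eq_of_ne hj, zero_mul]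
  · simp

theorem l_single (ht : 1 < t) (hodd : Odd p) (i : Fin t) {l : Fin t → ℕ} (hl : ∀ j, l j ≤ p - 1) :
    p ^ t - 1 ∣ nI p t i + ∑ j : Fin t, l j * p ^ (j:ℕ) ↔ l = Pi.single i 1 := by
  have h := digs_lt hl
  have hp := (Fact.out : p.Prime).two_le
  rw [nI_dvd ht hodd i (by omega)]
  constructor
  · intro h
    refine digs_inj (p := p) hl ?_ ?_
    · intro j
      by_cases c : j = i
      · subst c; simp; omega
      · rw [Pi.single_eq_of_ne c]; omega
    · rw [single_digs, h, one_mul]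
  · rintro rfl; rw [single_digs, one_mul]

theorem exists_N (w : Ix m → ℤ) (F : Fin t → PV p t m) : ∃ N, 1 < N ∧ p < N ∧ ∀ j, (S1 p t w (F j)).natDegree < N := by
  refine ⟨(Finset.univ.sup fun j => (S1 p t w (F j)).natDegree) + p + 2, by omega, by omega, fun j => ?_⟩
  have := Finset.le_sup (f := fun j => (S1 p t w (F j)).natDegree) (Finset.mem_univ j)
  omega

theorem DL_single (w : Ix m → ℤ) (F : Fin t → PV p t m) (i : Fin t) (c : ℕ) :
    (fun j => DL p t w ((Pi.single i c : Fin t → ℕ) j) (F j)) = Function.update F i (DL p t w c (F i)) := by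
  funext j
  by_cases h : j = i
  · subst h; simp
  · rw [Pi.single_eq_of_ne h, Function.update_of_ne h, DL_zero]

theorem lead_Xop (ht : 1 < t) (hodd : Odd p) {s s' : Fin t → ℤ} (hle : ∀ j, s' j ≤ s j) (hl : ∀ j, 0 ≤ lamOf p t d s' j)
    {F : Fin t → PV p t m} (hF : ∀ j, (F j).IsHomogeneous (lamOfN p t d s' j)) (w : Ix m → ℤ) (i : Fin t) :
    lead p t m d s (Xop w (nI p t i) (PhiM p t m F)) = lead p t m d s (PhiM p t m (Function.update F i (DL p t w 1 (F i)))) := by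
  obtain ⟨N, hN1, hNp, hN⟩ := exists_N w F
  have hn : 0 < nI p t i := by have := pow_lt_q ht hodd i; unfold nI; omega
  rw [Xop_Phi w hn F hN, map_sum, Finset.sum_eq_single (Pi.single i 1)]
  · rw [if_pos, DL_single]
    rw [l_single ht hodd]
    intro j
    have hp := (Fact.out : p.Prime).two_le
    by_cases c : j = i
    · subst c; simp; omega
    · rw [Pi.single_eq_of_ne c]; omega
  · intro l _ hl1
    split_ifs with hc
    · funext e
      rw [lead_Phi ht hle hl (fun j => S1_hom w (hF j) (l j))]
      split_ifs with hR
      · have : ∃ j, p ≤ l j := by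
          by_contra h
          push Not at h
          exact hl1 ((l_single ht hodd i (fun j => by have := h j; omega)).1 hc)
        obtain ⟨j, hj⟩ := this
        exact Finset.prod_eq_zero (Finset.mem_univ j) (DL_red w hj _ (hR.1 j))
      · rfl
    · exact map_zero _
  · intro h
    exfalso; apply h
    rw [Fintype.mem_piFinset]
    intro j
    by_cases c : j = i
    · subst c; simpa using hN1
    · rw [Pi.single_eq_of_ne c, Finset.mem_range]; omega

end PartC2

section PartC3
open MvPolynomial

variable {p t m d : ℕ} [Fact p.Prime] [NeZero t]

/-- digit-level operator `z_a ∂_b` on coefficient functions -/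
def dop (p : ℕ) {m : ℕ} {K : Type} [Field K] (a b : Ix m) (c : Ex m → K) (g : Ex m) : K :=
  if 1 ≤ g a ∧ g ≤ topE p m then (((g - Finsupp.single a 1 : Ex m) b : ℕ) + 1 : K) * c (g - Finsupp.single a 1 + Finsupp.single b 1) else 0

theorem dop_coeff (a b : Ix m) (F : PV p t m) {g : Ex m} (hg : g ≤ topE p m) :
    coeff g (X a * pderiv b F) = dop p a b (fun g => coeff g F) g := by
  rw [coeff_X_mul', dop]
  by_cases h : 1 ≤ g a
  · rw [if_pos (by simp; omega), if_pos ⟨h, hg⟩, coeff_pderiv, mul_comm]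
  · rw [if_neg (by simp; omega), if_neg (fun h' => h h'.1)]

theorem dop_add {K : Type} [Field K] (a b : Ix m) (c : Ex m → K) {h : Ex m} (hg : h + Finsupp.single a 1 ≤ topE p m) :
    dop p a b c (h + Finsupp.single a 1) = ((h b : ℕ) + 1 : K) * c (h + Finsupp.single b 1) := by
  rw [dop, if_pos ⟨by simp, hg⟩, add_tsub_cancel_right]

theorem dop_zero {K : Type} [Field K] (a b : Ix m) (c : Ex m → K) {g : Ex m} (hg : g a = 0) : dop p a b c g = 0 := by
  rw [dop, if_neg (by omega)]

def LOp (p t m : ℕ) [Fact p.Prime] (i : Fin t) (a b : Ix m) : LF p t m →ₗ[GaloisField p t] LF p t m where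
  toFun c e := dop p a b (fun g => c (Function.update e i g)) (e i)
  map_add' c c' := by
    funext e; simp only [dop, Pi.add_apply]; split_ifs <;> ring
  map_smul' r c := by
    funext e; simp only [dop, Pi.smul_apply, smul_eq_mul, RingHom.id_apply]; split_ifs <;> ring

theorem LOp_apply (i : Fin t) (a b : Ix m) (c : LF p t m) (e : Fin t → Ex m) :
    LOp p t m i a b c e = dop p a b (fun g => c (Function.update e i g)) (e i) := rfl

theorem LOp_Phi (ht : 1 < t) {s s' : Fin t → ℤ} (hle : ∀ j, s' j ≤ s j) (hl : ∀ j, 0 ≤ lamOf p t d s' j)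
    {F : Fin t → PV p t m} (hF : ∀ j, (F j).IsHomogeneous (lamOfN p t d s' j)) (i : Fin t) (a b : Ix m) (e : Fin t → Ex m) :
    LOp p t m i a b (lead p t m d s (PhiM p t m F)) e =
      if RedT p e ∧ s' = s then ∏ j, coeff (e j) (Function.update F i (X a * pderiv b (F i)) j) else 0 := by
  rw [LOp_apply]
  by_cases hs : s' = s
  swap
  · rw [if_neg (fun h => hs h.2), dop]
    simp only [lead_Phi ht hle hl hF, hs, and_false, if_false, mul_zero, ite_self]
  by_cases hR : RedT p e
  · rw [if_pos ⟨hR, hs⟩]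
    have key : ∀ G : PV p t m, ∏ j, coeff (e j) (Function.update F i G j) = coeff (e i) G * ∏ j ∈ Finset.univ.erase i, coeff (e j) (F j) := by
      intro G
      rw [← Finset.mul_prod_erase _ _ (Finset.mem_univ i), Function.update_self]
      congr 1
      exact Finset.prod_congr rfl fun j hj => by rw [Function.update_of_ne (Finset.ne_of_mem_erase hj)]
    rw [key, dop_coeff _ _ _ (hR i)]
    simp only [dop]
    split_ifs with h1
    · rw [lead_Phi ht hle hl hF, mul_assoc]
      by_cases h2 : e i - Finsupp.single a 1 + Finsupp.single b 1 ≤ topE p m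
      · rw [if_pos]
        · congr 1
          rw [← Finset.mul_prod_erase _ _ (Finset.mem_univ i), Function.update_self]
          congr 1
          exact Finset.prod_congr rfl fun j hj => by rw [Function.update_of_ne (Finset.ne_of_mem_erase hj)]
        · refine ⟨fun j => ?_, hs⟩
          by_cases hj : j = i
          · subst hj; rw [Function.update_self]; exact h2
          · rw [Function.update_of_ne hj]; exact hR j
      · have : (((e i - Finsupp.single a 1 : Ex m) b : ℕ) + 1 : GaloisField p t) = 0 := by
          have h3 := (le_topE _).1 (hR i)
          have : ((e i - Finsupp.single a 1 : Ex m) b) + 1 = p := by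
            have hp := (Fact.out : p.Prime).two_le
            have hle := h3 b
            have : (e i - Finsupp.single a 1 : Ex m) b ≤ e i b := by simp
            by_contra hne
            apply h2
            rw [le_topE]
            intro x
            have hx := h3 x
            by_cases hxb : x = b
            · subst hxb; simp only [Finsupp.add_apply, Finsupp.single_eq_same]; omega
            · simp only [Finsupp.add_apply, Finsupp.single_eq_of_ne hxb, Finsupp.tsub_apply]; omega
          rw [← Nat.cast_succ, Nat.succ_eq_add_one, this, CharP.cast_eq_zero]
        rw [this, zero_mul, zero_mul]
    · rw [zero_mul]
  · rw [if_neg (fun h => hR h.1), dop]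
    split_ifs with h1
    · rw [lead_Phi ht hle hl hF, if_neg, mul_zero]
      rintro ⟨h2, -⟩
      apply hR
      intro j
      by_cases hj : j = i
      · subst hj; exact h1.2
      · have := h2 j; rwa [Function.update_of_ne hj] at this
    · rfl

theorem lead_XopL (ht : 1 < t) (hodd : Odd p) {s : Fin t → ℤ} {eps : Finset (Fin t)} (w : Ix m → ℤ) (i : Fin t) {f : FV p t m}
    (hf : f ∈ Ymod p t m d s eps) :
    lead p t m d s (Xop w (nI p t i) f) =
      ∑ a, ∑ b, (((lc w a : ℤ) : GaloisField p t) * ((w b : ℤ) : GaloisField p t)) • LOp p t m i a b (lead p t m d s f) := by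
  let L : FV p t m →ₗ[GaloisField p t] LF p t m := (lead p t m d s).comp (Xop w (nI p t i)) -
    ∑ a, ∑ b, (((lc w a : ℤ) : GaloisField p t) * ((w b : ℤ) : GaloisField p t)) • (LOp p t m i a b).comp (lead p t m d s)
  have hL : ∀ f, L f = lead p t m d s (Xop w (nI p t i) f) -
      ∑ a, ∑ b, (((lc w a : ℤ) : GaloisField p t) * ((w b : ℤ) : GaloisField p t)) • LOp p t m i a b (lead p t m d s f) := by
    intro f; simp [L, LinearMap.sub_apply, LinearMap.sum_apply, LinearMap.smul_apply]
  have : Ymod p t m d s eps ≤ L.ker := by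
    refine Submodule.span_le.2 ?_
    rintro f ⟨s', e', h1, h2, h4⟩
    obtain ⟨F, hF, rfl⟩ := (SBF_iff _ _ _).1 h4
    have hh : ∀ j, (F j).IsHomogeneous (lamOfN p t d s' j) := fun j => (GenD_SSg hodd (hF j)).1
    have hl : ∀ j, 0 ≤ lamOf p t d s' j := fun j => ((memCase_iff.1 h1).2.1 j).1
    rw [SetLike.mem_coe, LinearMap.mem_ker, hL, sub_eq_zero, lead_Xop ht hodd h2.1 hl hh]
    funext e
    have hh2 : ∀ j, (Function.update F i (DL p t w 1 (F i)) j).IsHomogeneous (lamOfN p t d s' j) := by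
      intro j
      by_cases hj : j = i
      · subst hj; rw [Function.update_self]; exact S1_hom w (hh j) 1
      · rw [Function.update_of_ne hj]; exact hh j
    rw [lead_Phi ht h2.1 hl hh2]
    simp only [Finset.sum_apply, Pi.smul_apply, LOp_Phi ht h2.1 hl hh, smul_eq_mul]
    split_ifs with hR
    · have key : ∀ G : PV p t m, ∏ j, coeff (e j) (Function.update F i G j) = coeff (e i) G * ∏ j ∈ Finset.univ.erase i, coeff (e j) (F j) := by
        intro G
        rw [← Finset.mul_prod_erase _ _ (Finset.mem_univ i), Function.update_self]
        congr 1
        exact Finset.prod_congr rfl fun j hj => by rw [Function.update_of_ne (Finset.ne_of_mem_erase hj)]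
      simp only [key, DL_one, coeff_sum, coeff_C_mul, Finset.sum_mul, mul_assoc]
    · simp
  have h := this hf
  rw [LinearMap.mem_ker, hL, sub_eq_zero] at h
  exact h

/-- closed under the symplectic Lie algebra operators -/
def LClosed (D : Submodule (GaloisField p t) (LF p t m)) : Prop :=
  (∀ i a, ∀ c ∈ D, LOp p t m i (.inl a) (.inr a) c ∈ D) ∧ (∀ i a, ∀ c ∈ D, LOp p t m i (.inr a) (.inl a) c ∈ D) ∧
  (∀ i a b, a ≠ b → ∀ c ∈ D, LOp p t m i (.inl a) (.inl b) c - LOp p t m i (.inr b) (.inr a) c ∈ D)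

theorem lead_closed' {s : Fin t → ℤ} {W : Submodule (GaloisField p t) (FV p t m)}
    (hW : SpStable W) (hX : ∀ (w : Ix m → ℤ) (i : Fin t), ∀ f ∈ W, lead p t m d s (Xop w (nI p t i) f) =
      ∑ a, ∑ b, (((lc w a : ℤ) : GaloisField p t) * ((w b : ℤ) : GaloisField p t)) • LOp p t m i a b (lead p t m d s f)) : LClosed (W.map (lead p t m d s)) := by
  have base : ∀ (w : Ix m → ℤ) (i : Fin t), ∀ c ∈ W.map (lead p t m d s),
      (∑ a, ∑ b, (((lc w a : ℤ) : GaloisField p t) * ((w b : ℤ) : GaloisField p t)) • LOp p t m i a b c) ∈ W.map (lead p t m d s) := by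
    rintro w i _ ⟨f, hf, rfl⟩
    rw [← hX w i _ hf]
    exact ⟨_, Xop_stable hW w _ hf, rfl⟩
  have h1 : ∀ i a, ∀ c ∈ W.map (lead p t m d s), LOp p t m i (.inl a) (.inr a) c ∈ W.map (lead p t m d s) := by
    intro i a c hc
    have := base (Pi.single (.inr a) 1) i c hc
    rw [Finset.sum_eq_single (.inl a), Finset.sum_eq_single (.inr a)] at this
    · simpa [lc] using this
    · intro b _ hb; rw [Pi.single_eq_of_ne hb]; simp
    · simp
    · rintro (b | b) _ hb
      · have : b ≠ a := fun h => hb (by rw [h])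
        simp [lc, Pi.single_apply, this]
      · simp [lc]
    · simp
  have h2 : ∀ i a, ∀ c ∈ W.map (lead p t m d s), LOp p t m i (.inr a) (.inl a) c ∈ W.map (lead p t m d s) := by
    intro i a c hc
    have := base (Pi.single (.inl a) 1) i c hc
    rw [Finset.sum_eq_single (.inr a), Finset.sum_eq_single (.inl a)] at this
    · simpa [lc] using this
    · intro b _ hb; rw [Pi.single_eq_of_ne hb]; simp
    · simp
    · rintro (b | b) _ hb
      · simp [lc]
      · have : b ≠ a := fun h => hb (by rw [h])
        simp [lc, Pi.single_apply, this]
    · simp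
  refine ⟨h1, h2, ?_⟩
  intro i a b hab c hc
  have := base (Pi.single (.inl b) 1 + Pi.single (.inr a) 1) i c hc
  have e1 : ∑ x, ∑ y, (((lc (Pi.single (.inl b) 1 + Pi.single (.inr a) 1 : Ix m → ℤ) x : ℤ) : GaloisField p t) *
      (((Pi.single (.inl b) 1 + Pi.single (.inr a) 1 : Ix m → ℤ) y : ℤ) : GaloisField p t)) • LOp p t m i x y c =
      LOp p t m i (.inl a) (.inl b) c + LOp p t m i (.inl a) (.inr a) c - LOp p t m i (.inr b) (.inl b) c - LOp p t m i (.inr b) (.inr a) c := by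
    have hlc : ∀ x, lc (Pi.single (.inl b) 1 + Pi.single (.inr a) 1 : Ix m → ℤ) x = (Pi.single (.inl a) 1 - Pi.single (.inr b) 1 : Ix m → ℤ) x := by
      rintro (x | x)
      · simp [lc, Pi.single_apply]
      · simp [lc, Pi.single_apply]
    simp only [hlc, Pi.sub_apply, Pi.add_apply, Int.cast_sub, Int.cast_add, sub_mul, mul_add, sub_smul, add_smul, Finset.sum_sub_distrib, Finset.sum_add_distrib]
    simp [Pi.single_apply, ite_smul]
    abel
  rw [e1] at this
  have e2 := h1 i a c hc
  have e3 := h2 i b c hc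
  have := Submodule.add_mem _ (Submodule.sub_mem _ this e2) e3
  convert this using 1
  abel

theorem lead_closed (ht : 1 < t) (hodd : Odd p) {s : Fin t → ℤ} {eps : Finset (Fin t)} {W : Submodule (GaloisField p t) (FV p t m)}
    (hW : SpStable W) (hWY : W ≤ Ymod p t m d s eps) : LClosed (W.map (lead p t m d s)) :=
  lead_closed' hW fun w i f hf => lead_XopL ht hodd w i (hWY hf)

end PartC3

section PartD1
open MvPolynomial

variable {p t m d : ℕ} [Fact p.Prime] [NeZero t]
variable {K : Type} [Field K] [CharP K p]

/-- killed by the raising operators -/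
def Kil (p : ℕ) {m : ℕ} {K : Type} [Field K] (c : Ex m → K) : Prop :=
  (∀ a g, dop p (.inl a) (.inr a) c g = 0) ∧
  (∀ a b : Fin m, a < b → ∀ g, dop p (.inl a) (.inl b) c g = dop p (.inr b) (.inr a) c g)

def DSupp (p m lam : ℕ) {K : Type} [Field K] (pl : Prop) (c : Ex m → K) : Prop :=
  (∀ g, c g ≠ 0 → g ≤ topE p m ∧ g.degree = lam) ∧ (lam = m * (p - 1) → ∀ g : Ex m, g ≤ topE p m → g.degree = m * (p - 1) →
    c (twE p g) = pm K pl * sgE K g * c g)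

theorem cast_ne {n : ℕ} (h0 : 1 ≤ n) (h : n ≤ p - 1) : (n : K) ≠ 0 := by
  have hp := (Fact.out : p.Prime).two_le
  intro hn
  rw [CharP.cast_eq_zero_iff K p] at hn
  exact absurd (Nat.le_of_dvd (by omega) hn) (by omega)

theorem dop_mv (a b : Ix m) (c : Ex m → K) {g : Ex m} (hb : 1 ≤ g b) (hg : g - Finsupp.single b 1 + Finsupp.single a 1 ≤ topE p m) :
    dop p a b c (g - Finsupp.single b 1 + Finsupp.single a 1) = (g b : K) * c g := by
  rw [dop_add _ _ _ hg]
  have h1 : g - Finsupp.single b 1 + Finsupp.single b 1 = g := by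
    apply tsub_add_cancel_of_le
    simpa using hb
  rw [h1, Finsupp.tsub_apply, Finsupp.single_eq_same]
  congr 1
  push_cast [hb]; ring

theorem p_ge3 (hodd : Odd p) : 3 ≤ p := by
  have h2 := (Fact.out : p.Prime).two_le
  rcases hodd with ⟨r, hr⟩; omega

theorem suppL {lam : ℕ} {pl : Prop} {c : Ex m → K} (hk : Kil p c) (hs : DSupp p m lam pl c) {g : Ex m} (hg : c g ≠ 0) (a : Fin m) :
    g (.inr a) = 0 ∨ g (.inl a) = p - 1 := by
  have h1 := (le_topE _).1 (hs.1 g hg).1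
  by_contra h
  push Not at h
  have h2 := h1 (.inl a)
  have h3 := h1 (.inr a)
  have := dop_mv (p := p) (.inl a) (.inr a) c (g := g) (by omega) (by
    rw [le_topE]; intro x
    have hx := h1 x
    by_cases hxb : x = .inl a
    · subst hxb; simp only [Finsupp.add_apply, Finsupp.single_eq_same, Finsupp.tsub_apply]; omega
    · simp only [Finsupp.add_apply, Finsupp.single_eq_of_ne hxb, Finsupp.tsub_apply]; omega)
  rw [hk.1] at this
  exact mul_ne_zero (cast_ne (p := p) (by omega) h3) hg this.symm

theorem stepA (hodd : Odd p) {lam : ℕ} {pl : Prop} {c : Ex m → K} (hk : Kil p c) (hs : DSupp p m lam pl c) {g : Ex m} (hg : c g ≠ 0) {a b : Fin m}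
    (hab : a < b) (hxa : g (.inl a) < p - 1) (hxb : 1 ≤ g (.inl b)) :
    g (.inl a) = p - 2 ∧ g (.inr a) = 0 ∧ g (.inl b) = p - 1 ∧ g (.inr b) = 1 ∧
    c (g - Finsupp.single (.inl b) 1 + Finsupp.single (.inl a) 1 - Finsupp.single (.inr b) 1 + Finsupp.single (.inr a) 1) = - c g := by
  have hp := p_ge3 hodd
  have h1 := (le_topE _).1 (hs.1 g hg).1
  have hne : a ≠ b := hab.ne
  have hL := suppL hk hs hg
  have hLa := hL a
  have hLb := hL b
  have hred : g - Finsupp.single (.inl b) 1 + Finsupp.single (.inl a) 1 ≤ topE p m := by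
    rw [le_topE]; intro x
    have hx := h1 x
    by_cases hxb : x = .inl a
    · subst hxb; simp only [Finsupp.add_apply, Finsupp.single_eq_same, Finsupp.tsub_apply]; omega
    · simp only [Finsupp.add_apply, Finsupp.single_eq_of_ne hxb, Finsupp.tsub_apply]; omega
  have e1 := dop_mv (p := p) (.inl a) (.inl b) c (g := g) hxb hred
  rw [hk.2 a b hab, dop] at e1
  have hnz : (g (.inl b) : K) * c g ≠ 0 := mul_ne_zero (cast_ne (p := p) hxb (h1 _)) hg
  split_ifs at e1 with hc
  swap
  · exact absurd e1.symm hnz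
  set g' := g - Finsupp.single (.inl b) 1 + Finsupp.single (.inl a) 1 - Finsupp.single (.inr b) 1 + Finsupp.single (.inr a) 1 with hg'
  have hc' : c g' ≠ 0 := by
    intro h0; rw [h0, mul_zero] at e1; exact hnz e1.symm
  have h1' := (le_topE _).1 (hs.1 g' hc').1
  have hL' := suppL hk hs hc'
  have v1 : g' (.inl a) = g (.inl a) + 1 := by simp [hg', Finsupp.single_apply, hne, hne.symm]
  have v2 : g' (.inr a) = g (.inr a) + 1 := by simp [hg', Finsupp.single_apply, hne, hne.symm]
  have v3 : g' (.inl b) = g (.inl b) - 1 := by simp [hg', Finsupp.single_apply, hne, hne.symm]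
  have v4 : g' (.inr b) = g (.inr b) - 1 := by simp [hg', Finsupp.single_apply, hne, hne.symm]
  have v5 : 1 ≤ g (.inr b) := by simpa [Finsupp.single_apply] using hc.1
  have hLa' := hL' a
  have hLb' := hL' b
  rw [v1, v2] at hLa'
  rw [v3, v4] at hLb'
  have q1 := h1 (.inl a)
  have q2 := h1 (.inl b)
  have r1 : g (.inl a) = p - 2 := by omega
  have r2 : g (.inr a) = 0 := by omega
  have r3 : g (.inl b) = p - 1 := by omega
  have r4 : g (.inr b) = 1 := by omega
  refine ⟨r1, r2, r3, r4, ?_⟩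
  have v6 : (g - Finsupp.single (.inl b) 1 + Finsupp.single (.inl a) 1 - Finsupp.single (.inr b) 1 : Ex m) (.inr a) = 0 := by
    simp [Finsupp.single_apply, r2]
  rw [v6, r3] at e1
  have v7 : ((p - 1 : ℕ) : K) = -1 := by
    rw [Nat.cast_sub (by omega), CharP.cast_eq_zero]; simp
  rw [v7] at e1
  simpa using e1

theorem stepB (hodd : Odd p) {lam : ℕ} {pl : Prop} {c : Ex m → K} (hk : Kil p c) (hs : DSupp p m lam pl c) {g : Ex m} (hg : c g ≠ 0) {a b : Fin m}
    (hab : a < b) (hya : 1 ≤ g (.inr a)) (hyb : g (.inr b) < p - 1) :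
    g (.inl a) = p - 1 ∧ g (.inr a) = 1 ∧ g (.inl b) = p - 2 ∧ g (.inr b) = 0 ∧
    c (g - Finsupp.single (.inr a) 1 + Finsupp.single (.inr b) 1 - Finsupp.single (.inl a) 1 + Finsupp.single (.inl b) 1) ≠ 0 := by
  have hp := p_ge3 hodd
  have h1 := (le_topE _).1 (hs.1 g hg).1
  have hne : a ≠ b := hab.ne
  have hL := suppL hk hs hg
  have hLa := hL a
  have hLb := hL b
  have hred : g - Finsupp.single (.inr a) 1 + Finsupp.single (.inr b) 1 ≤ topE p m := by
    rw [le_topE]; intro x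
    have hx := h1 x
    by_cases hxb : x = .inr b
    · subst hxb; simp only [Finsupp.add_apply, Finsupp.single_eq_same, Finsupp.tsub_apply]; omega
    · simp only [Finsupp.add_apply, Finsupp.single_eq_of_ne hxb, Finsupp.tsub_apply]; omega
  have e1 := dop_mv (p := p) (.inr b) (.inr a) c (g := g) hya hred
  rw [← hk.2 a b hab, dop] at e1
  have hnz : (g (.inr a) : K) * c g ≠ 0 := mul_ne_zero (cast_ne (p := p) hya (h1 _)) hg
  split_ifs at e1 with hc
  swap
  · exact absurd e1.symm hnz
  set g' := g - Finsupp.single (.inr a) 1 + Finsupp.single (.inr b) 1 - Finsupp.single (.inl a) 1 + Finsupp.single (.inl b) 1 with hg'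
  have hc' : c g' ≠ 0 := by
    intro h0; rw [h0, mul_zero] at e1; exact hnz e1.symm
  have h1' := (le_topE _).1 (hs.1 g' hc').1
  have hL' := suppL hk hs hc'
  have v1 : g' (.inl a) = g (.inl a) - 1 := by simp [hg', Finsupp.single_apply, hne, hne.symm]
  have v2 : g' (.inr a) = g (.inr a) - 1 := by simp [hg', Finsupp.single_apply, hne, hne.symm]
  have v3 : g' (.inl b) = g (.inl b) + 1 := by simp [hg', Finsupp.single_apply, hne, hne.symm]
  have v4 : g' (.inr b) = g (.inr b) + 1 := by simp [hg', Finsupp.single_apply, hne, hne.symm]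
  have hLa' := hL' a
  have hLb' := hL' b
  have w3 := h1' (.inl b)
  rw [v3] at w3
  rw [v1, v2] at hLa'
  rw [v3, v4] at hLb'
  have q1 := h1 (.inl a)
  have q2 := h1 (.inl b)
  exact ⟨by omega, by omega, by omega, by omega, hc'⟩

def muE (p : ℕ) {m : ℕ} (g : Ex m) (a : Fin m) : ℤ := (g (.inl a) : ℤ) + g (.inr a) - ((p:ℤ) - 1)

theorem mu_deg (g : Ex m) : ∑ a, muE p g a = (g.degree : ℤ) - m * ((p:ℤ) - 1) := by
  unfold muE
  rw [deg_eq']; push_cast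
  rw [Finset.sum_sub_distrib, Finset.sum_add_distrib]; simp; ring

/-- shape relation for supports of killed vectors -/
theorem mu_rel (hodd : Odd p) {lam : ℕ} {pl : Prop} {c : Ex m → K} (hk : Kil p c) (hs : DSupp p m lam pl c) {g : Ex m} (hg : c g ≠ 0) {a b : Fin m}
    (hab : a < b) : (0 ≤ muE p g a ∨ muE p g b = -((p:ℤ)-1) ∨ (muE p g a = -1 ∧ muE p g b = 1)) ∧
      (muE p g a ≤ 0 ∨ muE p g b = (p:ℤ)-1 ∨ (muE p g a = 1 ∧ muE p g b = -1)) := by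
  have hp := p_ge3 hodd
  have h1 := (le_topE _).1 (hs.1 g hg).1
  have hLa := suppL hk hs hg a
  have hLb := suppL hk hs hg b
  have q1 := h1 (.inl a)
  have q2 := h1 (.inl b)
  have q3 := h1 (.inr a)
  have q4 := h1 (.inr b)
  unfold muE
  constructor
  · by_cases hx : g (.inl a) < p - 1 ∧ 1 ≤ g (.inl b)
    · have := stepA hodd hk hs hg hab hx.1 hx.2
      obtain ⟨u1, u2, u3, u4, -⟩ := this
      omega
    · omega
  · by_cases hx : 1 ≤ g (.inr a) ∧ g (.inr b) < p - 1
    · have := stepB hodd hk hs hg hab hx.1 hx.2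
      obtain ⟨u1, u2, u3, u4, -⟩ := this
      omega
    · omega

theorem mu_inj {g g' : Ex m} (h : g ≤ topE p m) (h' : g' ≤ topE p m) (hL : ∀ a, g (.inr a) = 0 ∨ g (.inl a) = p - 1)
    (hL' : ∀ a, g' (.inr a) = 0 ∨ g' (.inl a) = p - 1) (e : ∀ a, muE p g a = muE p g' a) : g = g' := by
  rw [le_topE] at h h'
  have : ∀ a, g (.inl a) = g' (.inl a) ∧ g (.inr a) = g' (.inr a) := by
    intro a
    have := e a; unfold muE at this
    have := hL a; have := hL' a; have := h (.inl a); have := h' (.inl a)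
    omega
  ext x
  rcases x with a | a
  · exact (this a).1
  · exact (this a).2

/-- non-exceptional shapes -/
def NEx (p : ℕ) {m : ℕ} (f : Fin m → ℤ) : Prop :=
  (∀ a, -((p:ℤ)-1) ≤ f a ∧ f a ≤ (p:ℤ)-1) ∧
  ∀ a b : Fin m, a < b → (0 ≤ f a ∨ f b = -((p:ℤ)-1)) ∧ (f a ≤ 0 ∨ f b = (p:ℤ)-1)

theorem NEx_uniq {f f' : Fin m → ℤ} (h : NEx p f) (h' : NEx p f') (hs : ∑ a, f a = ∑ a, f' a) : f = f' := by
  have key : ∀ f f' : Fin m → ℤ, NEx p f → NEx p f' → ∀ a, (∀ b < a, f b = f' b) → f a < f' a → ∑ a, f a < ∑ a, f' a := by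
    intro f f' h h' a hb hlt
    refine Finset.sum_lt_sum (fun x _ => ?_) ⟨a, Finset.mem_univ _, hlt⟩
    rcases lt_trichotomy x a with hx | hx | hx
    · exact (hb x hx).le
    · subst hx; exact hlt.le
    · have h1 := h.2 a x hx
      have h2 := h'.2 a x hx
      have h3 := h.1 x
      have h4 := h'.1 x
      omega
  have : ∀ n : ℕ, ∀ a : Fin m, a.1 = n → f a = f' a := by
    intro n
    induction n using Nat.strong_induction_on with
    | _ n ih =>
      intro a ha
      have hb : ∀ b < a, f b = f' b := fun b hb => ih b.1 (by rw [← ha]; exact hb) b rfl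
      rcases lt_trichotomy (f a) (f' a) with h1 | h1 | h1
      · exact absurd (key f f' h h' a hb h1) (by rw [hs]; exact lt_irrefl _)
      · exact h1
      · exact absurd (key f' f h' h a (fun b hb' => (hb b hb').symm) h1) (by rw [hs]; exact lt_irrefl _)
  funext a; exact this _ a rfl

/-- exceptional at the last two positions -/
def Exc {m : ℕ} (f : Fin m → ℤ) (a b : Fin m) : Prop :=
  a.1 + 1 = b.1 ∧ b.1 + 1 = m ∧ (∀ c, c ≠ a → c ≠ b → f c = 0) ∧ ((f a = -1 ∧ f b = 1) ∨ (f a = 1 ∧ f b = -1))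

theorem exc_of {hodd : Odd p} {f : Fin m → ℤ} (h : ∀ a b : Fin m, a < b →
      (0 ≤ f a ∨ f b = -((p:ℤ)-1) ∨ (f a = -1 ∧ f b = 1)) ∧ (f a ≤ 0 ∨ f b = (p:ℤ)-1 ∨ (f a = 1 ∧ f b = -1)))
    {a b : Fin m} (hab : a < b) (he : (f a = -1 ∧ f b = 1) ∨ (f a = 1 ∧ f b = -1)) : Exc f a b := by
  have hp := p_ge3 hodd
  have h0 := h a b hab
  have hA : ∀ c : Fin m, ¬ (b < c) := by
    intro c hc
    have h1 := h a c (hab.trans hc)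
    have h2 := h b c hc
    omega
  have hB : ∀ c : Fin m, ¬ (a < c ∧ c < b) := by
    rintro c ⟨hc1, hc2⟩
    have h1 := h a c hc1
    have h2 := h c b hc2
    omega
  have hab' : a.1 < b.1 := hab
  refine ⟨?_, ?_, ?_, he⟩
  · by_contra hne
    exact hB ⟨a.1 + 1, by have := b.2; omega⟩ ⟨by rw [Fin.lt_def]; simp, by rw [Fin.lt_def]; simp; omega⟩
  · by_contra hne
    exact hA ⟨b.1 + 1, by have := b.2; omega⟩ (by rw [Fin.lt_def]; simp)
  · intro c hca hcb
    rcases lt_trichotomy c a with hc | hc | hc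
    · have h1 := h c a hc
      have h2 := h c b (hc.trans hab)
      omega
    · exact absurd hc hca
    · rcases lt_trichotomy c b with hc' | hc' | hc'
      · exact absurd ⟨hc, hc'⟩ (hB c)
      · exact absurd hc' hcb
      · exact absurd hc' (hA c)

theorem shape (hodd : Odd p) {lam : ℕ} {pl : Prop} {c : Ex m → K} (hk : Kil p c) (hs : DSupp p m lam pl c) {g : Ex m} (hg : c g ≠ 0) :
    NEx p (muE p g) ∨ ∃ a b, Exc (muE p g) a b := by
  by_cases h : ∃ a b : Fin m, a < b ∧ ((muE p g a = -1 ∧ muE p g b = 1) ∨ (muE p g a = 1 ∧ muE p g b = -1))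
  · obtain ⟨a, b, hab, he⟩ := h
    exact Or.inr ⟨a, b, exc_of (hodd := hodd) (fun a b hab => mu_rel hodd hk hs hg hab) hab he⟩
  · left
    push Not at h
    refine ⟨fun a => ?_, fun a b hab => ?_⟩
    · have h1 := (le_topE _).1 (hs.1 g hg).1
      have q1 := h1 (.inl a)
      have q3 := h1 (.inr a)
      have hp := p_ge3 hodd
      unfold muE; omega
    · have h1 := mu_rel hodd hk hs hg hab
      have h2 := h a b hab
      omega

theorem exc_lam {lam : ℕ} {g : Ex m} (hd : g.degree = lam) {a b : Fin m} (he : Exc (muE p g) a b) : lam = m * (p - 1) := by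
  have h1 := mu_deg (p := p) g
  have hab : a ≠ b := by intro h; have := he.1; rw [h] at this; omega
  rw [← Finset.add_sum_erase _ _ (Finset.mem_univ a), ← Finset.add_sum_erase _ _ (Finset.mem_erase.2 ⟨hab.symm, Finset.mem_univ b⟩),
    Finset.sum_eq_zero] at h1
  · have := he.2.2.2
    have hp := p_cast (p := p)
    have : (g.degree : ℤ) = m * ((p - 1 : ℕ) : ℤ) := by rw [hp]; omega
    rw [← hd]; exact_mod_cast this
  · intro c hc
    simp only [Finset.mem_erase, Finset.mem_univ, and_true] at hc
    exact he.2.2.1 c hc.2 hc.1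

theorem exc_uniq (hodd : Odd p) {g g' : Ex m} (h : g ≤ topE p m) (h' : g' ≤ topE p m) (hL : ∀ a, g (.inr a) = 0 ∨ g (.inl a) = p - 1)
    (hL' : ∀ a, g' (.inr a) = 0 ∨ g' (.inl a) = p - 1) {a b a' b' : Fin m} (he : Exc (muE p g) a b) (he' : Exc (muE p g') a' b') :
    g' = g ∨ g' = twE p g := by
  have hp := p_ge3 hodd
  have hb : b' = b := by apply Fin.ext; have := he.2.1; have := he'.2.1; omega
  have ha : a' = a := by apply Fin.ext; have := he.1; have := he'.1; rw [hb] at this; omega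
  subst hb; subst ha
  have r := (le_topE _).1 h
  have r' := (le_topE _).1 h'
  by_cases hsame : muE p g' a' = muE p g a'
  · left
    refine mu_inj h' h hL' hL fun c => ?_
    by_cases hc : c = a'
    · subst hc; exact hsame
    by_cases hc' : c = b'
    · subst hc'; have := he.2.2.2; have := he'.2.2.2; omega
    rw [he.2.2.1 c hc hc', he'.2.2.1 c hc hc']
  · right
    have hx := he.2.2.2
    have hx' := he'.2.2.2
    have key : ∀ c, g' (.inl c) = p - 1 - g (.inr c) ∧ g' (.inr c) = p - 1 - g (.inl c) := by
      intro c
      have l1 := hL c; have l2 := hL' c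
      have r1 := r (.inl c); have r2 := r' (.inl c); have r3 := r (.inr c); have r4 := r' (.inr c)
      have e1 : muE p g' c = - muE p g c := by
        by_cases hc : c = a'
        · subst hc; omega
        by_cases hc' : c = b'
        · subst hc'; omega
        rw [he.2.2.1 c hc hc', he'.2.2.1 c hc hc']; rfl
      unfold muE at e1
      omega
    ext x
    rcases x with c | c
    · exact (key c).1
    · exact (key c).2

end PartD1

section PartD2
open MvPolynomial

variable {p t m d : ℕ} [Fact p.Prime] [NeZero t]
variable {K : Type} [Field K] [CharP K p]

theorem fct_add_single (g : Ex m) (a : Ix m) : fct K (g + Finsupp.single a 1) = ((g a : K) + 1) * fct K g := by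
  unfold fct
  rw [← Finset.mul_prod_erase _ _ (Finset.mem_univ a), ← Finset.mul_prod_erase (Finset.univ) (fun x => ((g x).factorial : K)) (Finset.mem_univ a)]
  rw [← mul_assoc]
  congr 1
  · simp only [Finsupp.add_apply, Finsupp.single_eq_same, Nat.factorial_succ]; push_cast; ring
  · refine Finset.prod_congr rfl fun x hx => ?_
    rw [Finsupp.add_apply, Finsupp.single_eq_of_ne (Finset.ne_of_mem_erase hx), add_zero]

def hE (p m : ℕ) : Ex m := mkE (Sum.elim (fun _ => p - 1) (fun _ => 0))

@[simp] theorem hE_inl (a : Fin m) : hE p m (.inl a) = p - 1 := rfl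
@[simp] theorem hE_inr (a : Fin m) : hE p m (.inr a) = 0 := rfl

theorem hE_le : hE p m ≤ topE p m := by
  rw [le_topE]; rintro (a | a) <;> simp

theorem hE_tw : twE p (hE p m) = hE p m := by
  ext x; rcases x with a | a <;> simp

theorem pm1_cast (hodd : Odd p) : ((p - 1 : ℕ) : K) = -1 := by
  have := p_ge3 hodd
  rw [Nat.cast_sub (by omega), CharP.cast_eq_zero]; simp

/-- coordinates of type one exceptional elements -/
theorem exc_coord (hodd : Odd p) {g : Ex m} (h : g ≤ topE p m) (hL : ∀ a, g (.inr a) = 0 ∨ g (.inl a) = p - 1)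
    {a b : Fin m} (he : Exc (muE p g) a b) (h1 : muE p g a = -1) :
    g (.inl a) = p - 2 ∧ g (.inr a) = 0 ∧ g (.inl b) = p - 1 ∧ g (.inr b) = 1 ∧ ∀ c, c ≠ a → c ≠ b → g (.inl c) = p - 1 ∧ g (.inr c) = 0 := by
  have hp := p_ge3 hodd
  have r := (le_topE _).1 h
  have h2 : muE p g b = 1 := by have := he.2.2.2; omega
  have q : ∀ c, g (.inl c) ≤ p - 1 := fun c => r (.inl c)
  refine ⟨?_, ?_, ?_, ?_, ?_⟩
  · have := hL a; have := q a; unfold muE at h1; omega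
  · have := hL a; have := q a; unfold muE at h1; omega
  · have := hL b; have := q b; unfold muE at h2; omega
  · have := hL b; have := q b; unfold muE at h2; omega
  · intro c hc hc'
    have h3 := he.2.2.1 c hc hc'
    have := hL c; have := q c; unfold muE at h3; omega

theorem exc_sg (hodd : Odd p) {g : Ex m} (h : g ≤ topE p m) (hL : ∀ a, g (.inr a) = 0 ∨ g (.inl a) = p - 1)
    {a b : Fin m} (he : Exc (muE p g) a b) (h1 : muE p g a = -1) : sgE K g = 1 := by
  have hp := p_ge3 hodd
  obtain ⟨u1, u2, u3, u4, u5⟩ := exc_coord hodd h hL he h1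
  have hab : a ≠ b := by intro h; have := he.1; rw [h] at this; omega
  have e1 : g + Finsupp.single (.inl a) 1 = hE p m + Finsupp.single (.inr b) 1 := by
    ext x
    rcases x with c | c
    · by_cases hc : c = a
      · subst hc; simp [u1]; omega
      by_cases hc' : c = b
      · subst hc'; simp [u3, Finsupp.single_apply, hab]
      simp [(u5 c hc hc').1, Finsupp.single_apply, Ne.symm hc]
    · by_cases hc : c = a
      · subst hc; simp [u2, Finsupp.single_apply, hab.symm]
      by_cases hc' : c = b
      · subst hc'; simp [u4]
      simp [(u5 c hc hc').2, Finsupp.single_apply, Ne.symm hc']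
  have e2 := fct_add_single (K := K) g (.inl a)
  rw [e1, fct_add_single, u1] at e2
  have e3 : ((p - 2 : ℕ) : K) + 1 = -1 := by
    rw [← pm1_cast (K := K) hodd, ← Nat.cast_succ]; congr 1; omega
  rw [e3] at e2
  have e4 := sg_self (K := K) (hE_le (p := p) (m := m)) hE_tw
  unfold sgE at e4 ⊢
  have e5 : ∑ i, g (.inr i) = 1 := by
    rw [Finset.sum_eq_single b, u4]
    · intro c _ hc
      by_cases hc' : c = a
      · subst hc'; exact u2
      · exact (u5 c hc' hc).2
    · simp
  rw [e5]
  simp only [hE_inr, Finset.sum_const_zero, zero_add] at e4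
  simp only [hE_inr, Nat.cast_zero, zero_add, one_mul] at e2
  rw [e2] at e4
  rw [pow_add, pow_one]; linear_combination e4

theorem mu_tw {g : Ex m} (h : g ≤ topE p m) (a : Fin m) : muE p (twE p g) a = - muE p g a := by
  have r := (le_topE _).1 h
  have r1 := r (.inl a); have r2 := r (.inr a)
  have hp := (Fact.out : p.Prime).two_le
  unfold muE
  simp only [twE_apply, Sum.swap_inl, Sum.swap_inr]
  omega

theorem sg_ne (hodd : Odd p) {g : Ex m} (h : g ≤ topE p m) : sgE K g ≠ 0 := by
  intro h0
  have := sg_tw (K := K) hodd h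
  rw [h0, mul_zero] at this
  exact zero_ne_one this

theorem pm_ne (pl : Prop) : pm K pl ≠ 0 := by
  unfold pm; split_ifs <;> simp

theorem exc_not_plus (hodd : Odd p) {lam : ℕ} {pl : Prop} (hpl : pl) {c : Ex m → K} (hk : Kil p c) (hs : DSupp p m lam pl c)
    {g : Ex m} (hg : c g ≠ 0) {a b : Fin m} (he : Exc (muE p g) a b) : False := by
  have hlam : lam = m * (p - 1) := exc_lam (hs.1 g hg).2 he
  have hp := p_ge3 hodd
  have main : ∀ g : Ex m, c g ≠ 0 → Exc (muE p g) a b → muE p g a = -1 → False := by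
    intro g hg he h1
    have hr := (hs.1 g hg).1
    have hL := suppL hk hs hg
    obtain ⟨u1, u2, u3, u4, u5⟩ := exc_coord hodd hr hL he h1
    have hab : a < b := by rw [Fin.lt_def]; have := he.1; omega
    obtain ⟨-, -, -, -, h5⟩ := stepA hodd hk hs hg hab (by omega) (by omega)
    have e1 : g - Finsupp.single (.inl b) 1 + Finsupp.single (.inl a) 1 - Finsupp.single (.inr b) 1 + Finsupp.single (.inr a) 1 = twE p g := by
      ext x
      rcases x with c | c
      · by_cases hc : c = a
        · subst hc; simp [Finsupp.single_apply, u1, u2, hab.ne, hab.ne']; omega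
        by_cases hc' : c = b
        · subst hc'; simp [u3, u4, Finsupp.single_apply, hab.ne, hab.ne']
        simp [(u5 c hc hc').1, (u5 c hc hc').2, Finsupp.single_apply, Ne.symm hc, Ne.symm hc']
      · by_cases hc : c = a
        · subst hc; simp [u1, u2, Finsupp.single_apply, hab.ne']; omega
        by_cases hc' : c = b
        · subst hc'; simp [u3, u4, Finsupp.single_apply, hab.ne, hab.ne']
        simp [(u5 c hc hc').1, (u5 c hc hc').2, Finsupp.single_apply, Ne.symm hc, Ne.symm hc']
    rw [e1, hs.2 hlam g hr (by rw [(hs.1 g hg).2, hlam]), exc_sg hodd hr hL he h1, pm, if_pos hpl] at h5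
    have : (2 : K) * c g = 0 := by linear_combination h5
    exact mul_ne_zero (two_ne (p := p) hodd) hg this
  rcases he.2.2.2 with h1 | h1
  · exact main g hg he h1.1
  · have hr := (hs.1 g hg).1
    have hc : c (twE p g) ≠ 0 := by
      rw [hs.2 hlam g hr (by rw [(hs.1 g hg).2, hlam])]
      exact mul_ne_zero (mul_ne_zero (pm_ne _) (sg_ne hodd hr)) hg
    refine main (twE p g) hc ⟨he.1, he.2.1, fun c h1 h2 => ?_, ?_⟩ ?_
    · rw [mu_tw hr, he.2.2.1 c h1 h2]; rfl
    · rw [mu_tw hr, mu_tw hr]; omega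
    · rw [mu_tw hr]; omega

/-- structure of killed vectors -/
theorem lemR (hodd : Odd p) (lam : ℕ) (pl : Prop) : ∃ (v0 : Ex m → K) (g : Ex m), v0 g = 1 ∧
    (∑ x ∈ Finset.Iic (topE p m), fct K x * (v0 x * v0 x) ≠ 0) ∧
    ∀ c : Ex m → K, Kil p c → DSupp p m lam pl c → ∀ x, c x = c g * v0 x := by
  have hp := p_ge3 hodd
  have single : ∀ g : Ex m, g ≤ topE p m → (∀ c : Ex m → K, Kil p c → DSupp p m lam pl c → ∀ x, c x ≠ 0 → x = g) →
      ∃ (v0 : Ex m → K) (g : Ex m), v0 g = 1 ∧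
    (∑ x ∈ Finset.Iic (topE p m), fct K x * (v0 x * v0 x) ≠ 0) ∧
    ∀ c : Ex m → K, Kil p c → DSupp p m lam pl c → ∀ x, c x = c g * v0 x := by
    intro g hg h
    refine ⟨Pi.single g 1, g, by simp, ?_, fun c hk hs x => ?_⟩
    · rw [Finset.sum_eq_single g]
      · simp only [Pi.single_eq_same, mul_one]; exact fct_ne hg
      · intro b _ hb; rw [Pi.single_eq_of_ne hb]; ring
      · intro h'; exact absurd (Finset.mem_Iic.2 hg) h'
    · by_cases hx : x = g
      · subst hx; simp
      · rw [Pi.single_eq_of_ne hx, mul_zero]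
        by_contra h0; exact hx (h c hk hs x h0)
  by_cases hall : ∀ c : Ex m → K, Kil p c → DSupp p m lam pl c → ∀ x, c x = 0
  · exact single 0 (by rw [le_topE]; intro a; simp) fun c hk hs x hx => absurd (hall c hk hs x) hx
  push Not at hall
  obtain ⟨c0, hk0, hs0, g, hg⟩ := hall
  have hr := (hs0.1 g hg).1
  have hdg := (hs0.1 g hg).2
  have hL := suppL hk0 hs0 hg
  have ne_uniq : ∀ c : Ex m → K, Kil p c → DSupp p m lam pl c → ∀ x, c x ≠ 0 → NEx p (muE p g) → NEx p (muE p x) → x = g := by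
    intro c hk hs x hx h1 h2
    refine mu_inj (hs.1 x hx).1 hr (suppL hk hs hx) hL fun a => ?_
    have : muE p x = muE p g := NEx_uniq h2 h1 (by rw [mu_deg, mu_deg, hdg, (hs.1 x hx).2])
    rw [this]
  by_cases hcase : lam = m * (p - 1) ∧ ¬ pl
  swap
  · have hne : ∀ c : Ex m → K, Kil p c → DSupp p m lam pl c → ∀ x, c x ≠ 0 → NEx p (muE p x) := by
      intro c hk hs x hx
      rcases shape hodd hk hs hx with h | ⟨a, b, h⟩
      · exact h
      · exfalso
        have := exc_lam (hs.1 x hx).2 h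
        have hpl : pl := by by_contra hn; exact hcase ⟨this, hn⟩
        exact exc_not_plus hodd hpl hk hs hx h
    exact single g hr fun c hk hs x hx => ne_uniq c hk hs x hx (hne c0 hk0 hs0 g hg) (hne c hk hs x hx)
  · obtain ⟨hlam, hpl⟩ := hcase
    have hexc : ∀ c : Ex m → K, Kil p c → DSupp p m lam pl c → ∀ x, c x ≠ 0 → ∃ a b, Exc (muE p x) a b := by
      intro c hk hs x hx
      rcases shape hodd hk hs hx with h | h
      · exfalso
        have hx1 := (hs.1 x hx).1
        have hx2 := (hs.1 x hx).2
        have e1 : muE p x = fun _ => 0 := by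
          refine NEx_uniq h ⟨fun a => ⟨by show _ ≤ (0:ℤ); omega, by show (0:ℤ) ≤ _; omega⟩, fun a b _ => ⟨Or.inl le_rfl, Or.inl le_rfl⟩⟩ ?_
          rw [mu_deg, hx2, hlam]
          have := p_cast (p := p)
          push_cast; rw [this]; simp
        have e2 : twE p x = x := by
          have r := (le_topE _).1 hx1
          have hLx := suppL hk hs hx
          have key : ∀ a, x (.inl a) = p - 1 ∧ x (.inr a) = 0 := by
            intro a
            have h1 := congrFun e1 a
            have := hLx a
            have : x (.inl a) ≤ p - 1 := r (.inl a)
            unfold muE at h1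
            omega
          ext y; rcases y with a | a <;> simp [key a]
        have e3 := hs.2 hlam x hx1 (by rw [hx2, hlam])
        rw [e2, sg_self hx1 e2, pm, if_neg hpl] at e3
        have : (2 : K) * c x = 0 := by linear_combination e3
        exact mul_ne_zero (two_ne (p := p) hodd) hx this
      · exact h
    obtain ⟨a, b, he⟩ := hexc c0 hk0 hs0 g hg
    have htw : twE p g ≠ g := by
      intro h
      have h1 := mu_tw hr a
      rw [h] at h1
      have := he.2.2.2
      omega
    refine ⟨Pi.single g 1 + Pi.single (twE p g) (- sgE K g), g, by simp [Pi.single_apply, htw.symm], ?_, fun c hk hs x => ?_⟩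
    · rw [← Finset.sum_subset (s₁ := {g, twE p g}), Finset.sum_pair htw.symm]
      · have h1 := fct_tw_sq (K := K) hodd hr (by rw [hdg, hlam])
        have : fct K g * ((Pi.single g 1 + Pi.single (twE p g) (- sgE K g) : Ex m → K) g * (Pi.single g 1 + Pi.single (twE p g) (- sgE K g) : Ex m → K) g) +
            fct K (twE p g) * ((Pi.single g 1 + Pi.single (twE p g) (- sgE K g) : Ex m → K) (twE p g) * (Pi.single g 1 + Pi.single (twE p g) (- sgE K g) : Ex m → K) (twE p g)) = 2 * fct K g := by
          simp only [Pi.add_apply, Pi.single_eq_same, Pi.single_eq_of_ne htw, Pi.single_eq_of_ne htw.symm]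
          linear_combination h1
        rw [this]
        exact mul_ne_zero (two_ne (p := p) hodd) (fct_ne hr)
      · intro x hx
        simp only [Finset.mem_insert, Finset.mem_singleton] at hx
        rw [Finset.mem_Iic]
        rcases hx with rfl | rfl
        · exact hr
        · exact twE_le _
      · intro x _ hx
        simp only [Finset.mem_insert, Finset.mem_singleton, not_or] at hx
        simp [Pi.single_apply, hx.1, hx.2]
    · by_cases h1 : x = g
      · subst h1; simp [Pi.single_apply, htw.symm]
      by_cases h2 : x = twE p g
      · subst h2
        rw [hs.2 hlam g hr (by rw [hdg, hlam])]
        simp [Pi.single_apply, htw, pm, hpl]; ring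
      · have : c x = 0 := by
          by_contra hx
          obtain ⟨a', b', he'⟩ := hexc c hk hs x hx
          rcases exc_uniq hodd hr (hs.1 x hx).1 hL (suppL hk hs hx) he he' with h | h
          · exact h1 h
          · exact h2 h
        rw [this]; simp [Pi.single_apply, h1, h2]

end PartD2

section PartD3
open MvPolynomial

variable {p t m d : ℕ} [Fact p.Prime] [NeZero t]

def kap {m : ℕ} : Ix m → ℤ := Sum.elim (fun a => (m:ℤ) - a.1) (fun a => -((m:ℤ) - a.1))
def wt1 {m : ℕ} (g : Ex m) : ℤ := ∑ x, kap x * (g x : ℤ)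
def wtE {t m : ℕ} (e : Fin t → Ex m) : ℤ := ∑ j, wt1 (e j)

theorem wt1_add (h : Ex m) (a : Ix m) : wt1 (h + Finsupp.single a 1) = wt1 h + kap a := by
  unfold wt1
  simp only [Finsupp.add_apply, Nat.cast_add, mul_add, Finset.sum_add_distrib]
  congr 1
  rw [Finset.sum_eq_single a]
  · simp
  · intro b _ hb; simp [Finsupp.single_eq_of_ne hb]
  · simp

theorem wt_update (e : Fin t → Ex m) (i : Fin t) (g : Ex m) : wtE (Function.update e i g) = wtE e - wt1 (e i) + wt1 g := by
  unfold wtE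
  rw [← Finset.add_sum_erase _ _ (Finset.mem_univ i), ← Finset.add_sum_erase Finset.univ (fun j => wt1 (e j)) (Finset.mem_univ i), Function.update_self]
  rw [Finset.sum_congr rfl (g := fun j => wt1 (e j)) (fun j hj => by rw [Function.update_of_ne (Finset.ne_of_mem_erase hj)])]
  ring

theorem LOp_wt {i : Fin t} {a b : Ix m} {c : LF p t m} {e : Fin t → Ex m} (h : LOp p t m i a b c e ≠ 0) :
    ∃ e', c e' ≠ 0 ∧ wtE e = wtE e' + kap a - kap b := by
  rw [LOp_apply, dop] at h
  split_ifs at h with h1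
  · refine ⟨_, right_ne_zero_of_mul h, ?_⟩
    rw [wt_update, wt1_add]
    have : e i - Finsupp.single a 1 + Finsupp.single a 1 = e i := tsub_add_cancel_of_le (by simpa using h1.1)
    have h2 := wt1_add (e i - Finsupp.single a 1) a
    rw [this] at h2
    omega
  · exact absurd rfl h

def Raised (c : LF p t m) : Prop :=
  (∀ i a, LOp p t m i (.inl a) (.inr a) c = 0) ∧
  (∀ i, ∀ a b : Fin m, a < b → LOp p t m i (.inl a) (.inl b) c - LOp p t m i (.inr b) (.inr a) c = 0)

theorem engel {N : Submodule (GaloisField p t) (LF p t m)} (hN : LClosed N) (hsup : ∀ c ∈ N, ∀ e, c e ≠ 0 → RedT p e)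
    {c0 : LF p t m} (h0 : c0 ∈ N) (hne : c0 ≠ 0) : ∃ c ∈ N, c ≠ 0 ∧ Raised c := by
  by_contra hcon
  push Not at hcon
  let B : ℤ := ∑ e ∈ boxT p t m, |wtE e|
  have hB : ∀ e, RedT p e → |wtE e| ≤ B := fun e he =>
    Finset.single_le_sum (f := fun e => |wtE e|) (fun _ _ => abs_nonneg _) (mem_box.2 he)
  have key : ∀ n : ℕ, ∃ c ∈ N, c ≠ 0 ∧ ∀ e, c e ≠ 0 → - B + n ≤ wtE e := by
    intro n
    induction n with
    | zero =>
      refine ⟨c0, h0, hne, fun e he => ?_⟩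
      have := hB e (hsup c0 h0 e he)
      have := neg_abs_le (wtE e)
      push_cast; omega
    | succ n ih =>
      obtain ⟨c, hc, hcn, hw⟩ := ih
      have h1 := hcon c hc hcn
      unfold Raised at h1
      rw [not_and_or] at h1
      rcases h1 with h1 | h1
      · push Not at h1
        obtain ⟨i, a, h2⟩ := h1
        refine ⟨_, hN.1 i a c hc, h2, fun e he => ?_⟩
        obtain ⟨e', he', hw'⟩ := LOp_wt he
        have := hw e' he'
        have ha := a.2
        simp only [kap, Sum.elim_inl, Sum.elim_inr] at hw'
        push_cast; omega
      · push Not at h1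
        obtain ⟨i, a, b, hab, h2⟩ := h1
        refine ⟨_, hN.2.2 i a b hab.ne c hc, h2, fun e he => ?_⟩
        rw [Fin.lt_def] at hab
        have : LOp p t m i (.inl a) (.inl b) c e ≠ 0 ∨ LOp p t m i (.inr b) (.inr a) c e ≠ 0 := by
          by_contra h3
          push Not at h3
          apply he
          rw [Pi.sub_apply, h3.1, h3.2, sub_zero]
        rcases this with h3 | h3
        · obtain ⟨e', he', hw'⟩ := LOp_wt h3
          have := hw e' he'
          simp only [kap, Sum.elim_inl, Sum.elim_inr] at hw'
          push_cast; omega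
        · obtain ⟨e', he', hw'⟩ := LOp_wt h3
          have := hw e' he'
          simp only [kap, Sum.elim_inl, Sum.elim_inr] at hw'
          push_cast; omega
  obtain ⟨c, hc, hcn, hw⟩ := key (2 * B + 1).toNat
  apply hcn
  funext e
  by_contra he
  have h1 := hw e he
  have h2 := hB e (hsup c hc e he)
  have h3 := le_abs_self (wtE e)
  have : 0 ≤ B := Finset.sum_nonneg fun _ _ => abs_nonneg _
  omega

/-- properties of leads of elements of `Y` -/
def LGood (p t m d : ℕ) [Fact p.Prime] [NeZero t] (s : Fin t → ℤ) (eps : Finset (Fin t)) (c : LF p t m) : Prop :=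
  (∀ e, c e ≠ 0 → RT p t m d s e) ∧
  ∀ e, RT p t m d s e → ∀ j, lamOf p t d s j = m * ((p:ℤ)-1) →
    c (Function.update e j (twE p (e j))) = pm (GaloisField p t) (j ∈ eps) * sgE (GaloisField p t) (e j) * c e

theorem lead_good (ht : 1 < t) {s : Fin t → ℤ} {eps : Finset (Fin t)} (hodd : Odd p) (hm : memCase p t m d s eps) {w : FV p t m}
    (hw : w ∈ Ymod p t m d s eps) : LGood p t m d s eps (lead p t m d s w) := by
  refine ⟨fun e he => ?_, fun e he j hj => lead_sign ht hodd hm hw he hj⟩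
  by_contra h
  exact he (lead_out w h)

theorem RT_update {s : Fin t → ℤ} {e : Fin t → Ex m} {i : Fin t} {g g' : Ex m} (h : RT p t m d s (Function.update e i g))
    (h1 : g' ≤ topE p m) (h2 : (g'.degree : ℤ) = lamOf p t d s i) : RT p t m d s (Function.update e i g') := by
  constructor
  · intro j
    by_cases hj : j = i
    · subst hj; rw [Function.update_self]; exact h1
    · have := h.1 j; rw [Function.update_of_ne hj] at this ⊢; exact this
  · intro j
    by_cases hj : j = i
    · subst hj; rw [Function.update_self]; exact h2
    · have := h.2 j; rw [Function.update_of_ne hj] at this ⊢; exact this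

theorem slice_supp {s : Fin t → ℤ} {eps : Finset (Fin t)} (hm : memCase p t m d s eps) {c : LF p t m} (hc : LGood p t m d s eps c)
    (e : Fin t → Ex m) (i : Fin t) : DSupp p m (lamOfN p t d s i) (i ∈ eps) (fun g => c (Function.update e i g)) := by
  have hl := ((memCase_iff.1 hm).2.1 i).1
  constructor
  · intro g hg
    have := hc.1 _ hg
    have h1 := this.1 i
    have h2 := this.2 i
    rw [Function.update_self] at h1 h2
    refine ⟨h1, ?_⟩
    rw [← lamN_cast hl] at h2
    exact_mod_cast h2
  · intro hlam g hg hdeg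
    have hlz := (lamN_mu hl).1 hlam
    have hpc := p_cast (p := p)
    have hgz : (g.degree : ℤ) = lamOf p t d s i := by rw [hlz, hdeg]; push_cast; rw [hpc]
    by_cases hR : RT p t m d s (Function.update e i g)
    · have := hc.2 _ hR i hlz
      simp only [Function.update_self, Function.update_idem] at this
      exact this
    · have h0 : c (Function.update e i g) = 0 := by by_contra h; exact hR (hc.1 _ h)
      have h1 : c (Function.update e i (twE p g)) = 0 := by
        by_contra h
        exact hR (RT_update (hc.1 _ h) hg hgz)
      simp only [h0, h1, mul_zero]

theorem slice_kil {c : LF p t m} (hc : Raised c) (e : Fin t → Ex m) (i : Fin t) : Kil p (fun g => c (Function.update e i g)) := by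
  constructor
  · intro a g
    have := congrFun (hc.1 i a) (Function.update e i g)
    rw [LOp_apply] at this
    simpa only [Function.update_self, Function.update_idem, Pi.zero_apply] using this
  · intro a b hab g
    have := congrFun (hc.2 i a b hab) (Function.update e i g)
    rw [Pi.sub_apply, LOp_apply, LOp_apply] at this
    simp only [Function.update_self, Function.update_idem, Pi.zero_apply] at this
    exact sub_eq_zero.1 this

def formL (p t m : ℕ) [Fact p.Prime] : LF p t m →ₗ[GaloisField p t] LF p t m →ₗ[GaloisField p t] GaloisField p t :=
  LinearMap.mk₂ (GaloisField p t) (fun c c' => ∑ e ∈ boxT p t m, (∏ j, fct (GaloisField p t) (e j)) * (c e * c' e))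
    (fun a b c => by simp only [Pi.add_apply, add_mul, mul_add, Finset.sum_add_distrib])
    (fun r a b => by simp only [Pi.smul_apply, smul_eq_mul, Finset.mul_sum]; exact Finset.sum_congr rfl fun _ _ => by ring)
    (fun a b c => by simp only [Pi.add_apply, add_mul, mul_add, Finset.sum_add_distrib])
    (fun r a b => by simp only [Pi.smul_apply, smul_eq_mul, Finset.mul_sum]; exact Finset.sum_congr rfl fun _ _ => by ring)

theorem formL_apply (c c' : LF p t m) : formL p t m c c' = ∑ e ∈ boxT p t m, (∏ j, fct (GaloisField p t) (e j)) * (c e * c' e) := rfl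

theorem adj_term (i : Fin t) (a b : Ix m) (c c' : LF p t m) {e : Fin t → Ex m} (ha : 1 ≤ e i a) 
    (hR' : e i - Finsupp.single a 1 + Finsupp.single b 1 ≤ topE p m) (hR : e i ≤ topE p m) :
    (∏ j, fct (GaloisField p t) (e j)) * (LOp p t m i a b c e * c' e) =
    (∏ j, fct (GaloisField p t) (Function.update e i (e i - Finsupp.single a 1 + Finsupp.single b 1) j)) *
      (c (Function.update e i (e i - Finsupp.single a 1 + Finsupp.single b 1)) * LOp p t m i b a c' (Function.update e i (e i - Finsupp.single a 1 + Finsupp.single b 1))) := by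
  have he : e i - Finsupp.single a 1 + Finsupp.single a 1 = e i := tsub_add_cancel_of_le (by simpa using ha)
  set h := e i - Finsupp.single a 1 with hh
  have e1 : LOp p t m i a b c e = ((h b : GaloisField p t) + 1) * c (Function.update e i (h + Finsupp.single b 1)) := by
    rw [LOp_apply]
    conv_lhs => rw [← he]
    rw [dop_add _ _ _ (by rw [he]; exact hR)]
  have e2 : LOp p t m i b a c' (Function.update e i (h + Finsupp.single b 1)) = ((h a : GaloisField p t) + 1) * c' e := by
    rw [LOp_apply, Function.update_self, dop_add _ _ _ hR', Function.update_idem, he, Function.update_eq_self]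
  rw [e1, e2]
  rw [← Finset.mul_prod_erase _ _ (Finset.mem_univ i), ← Finset.mul_prod_erase Finset.univ
    (fun j => fct (GaloisField p t) (Function.update e i (h + Finsupp.single b 1) j)) (Finset.mem_univ i), Function.update_self]
  rw [Finset.prod_congr rfl (s₁ := Finset.univ.erase i) (f := fun j => fct (GaloisField p t) (Function.update e i (h + Finsupp.single b 1) j))
    (g := fun j => fct (GaloisField p t) (e j)) (fun j hj => by rw [Function.update_of_ne (Finset.ne_of_mem_erase hj)])]
  have e3 := fct_add_single (K := GaloisField p t) h a
  rw [he] at e3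
  rw [e3, fct_add_single]
  ring

theorem form_adj (i : Fin t) (a b : Ix m) (c c' : LF p t m) :
    formL p t m (LOp p t m i a b c) c' = formL p t m c (LOp p t m i b a c') := by
  have step : ∀ (a b : Ix m) (c c' : LF p t m), ∑ e ∈ boxT p t m, (∏ j, fct (GaloisField p t) (e j)) * (LOp p t m i a b c e * c' e) =
      ∑ e ∈ (boxT p t m).filter (fun e => 1 ≤ e i a ∧ e i - Finsupp.single a 1 + Finsupp.single b 1 ≤ topE p m),
        (∏ j, fct (GaloisField p t) (e j)) * (LOp p t m i a b c e * c' e) := by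
    intro a b c c'
    symm
    refine Finset.sum_filter_of_ne fun e he hne => ?_
    have hR := (mem_box.1 he) i
    have h1 : LOp p t m i a b c e ≠ 0 := fun h => hne (by rw [h]; ring)
    rw [LOp_apply, dop] at h1
    split_ifs at h1 with h2
    · refine ⟨h2.1, ?_⟩
      by_contra h3
      apply left_ne_zero_of_mul h1
      have h4 := (le_topE _).1 hR
      have : ((e i - Finsupp.single a 1 : Ex m) b) + 1 = p := by
        have hp := (Fact.out : p.Prime).two_le
        have hle := h4 b
        have : (e i - Finsupp.single a 1 : Ex m) b ≤ e i b := by simp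
        by_contra hne
        apply h3
        rw [le_topE]
        intro x
        have hx := h4 x
        by_cases hxb : x = b
        · subst hxb; simp only [Finsupp.add_apply, Finsupp.single_eq_same]; omega
        · simp only [Finsupp.add_apply, Finsupp.single_eq_of_ne hxb, Finsupp.tsub_apply]; omega
      rw [← Nat.cast_succ, Nat.succ_eq_add_one, this, CharP.cast_eq_zero]
    · exact absurd rfl h1
  rw [formL_apply, formL_apply, step]
  have e2 := step b a c' c
  have e3 : ∑ e ∈ boxT p t m, (∏ j, fct (GaloisField p t) (e j)) * (c e * LOp p t m i b a c' e)
      = ∑ e ∈ boxT p t m, (∏ j, fct (GaloisField p t) (e j)) * (LOp p t m i b a c' e * c e) :=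
    Finset.sum_congr rfl fun _ _ => by ring
  rw [e3, e2]
  have inv : ∀ (a b : Ix m) (g : Ex m), 1 ≤ g a → g - Finsupp.single a 1 + Finsupp.single b 1 - Finsupp.single b 1 + Finsupp.single a 1 = g := by
    intro a b g hg
    rw [add_tsub_cancel_right]
    exact tsub_add_cancel_of_le (by simpa using hg)
  have mem : ∀ (a b : Ix m) (e : Fin t → Ex m), e ∈ (boxT p t m).filter (fun e => 1 ≤ e i a ∧ e i - Finsupp.single a 1 + Finsupp.single b 1 ≤ topE p m) →
      Function.update e i (e i - Finsupp.single a 1 + Finsupp.single b 1) ∈ (boxT p t m).filter (fun e => 1 ≤ e i b ∧ e i - Finsupp.single b 1 + Finsupp.single a 1 ≤ topE p m) := by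
    intro a b e he
    rw [Finset.mem_filter] at he ⊢
    obtain ⟨h1, h2, h3⟩ := he
    rw [mem_box] at h1 ⊢
    refine ⟨fun j => ?_, ?_, ?_⟩
    · by_cases hj : j = i
      · subst hj; rw [Function.update_self]; exact h3
      · rw [Function.update_of_ne hj]; exact h1 j
    · rw [Function.update_self]; simp
    · rw [Function.update_self, inv a b _ h2]; exact h1 i
  refine Finset.sum_nbij' (fun e => Function.update e i (e i - Finsupp.single a 1 + Finsupp.single b 1))
    (fun e => Function.update e i (e i - Finsupp.single b 1 + Finsupp.single a 1)) (mem a b) (mem b a) ?_ ?_ ?_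
  · intro e he
    rw [Finset.mem_filter] at he
    simp only [Function.update_self, Function.update_idem]
    rw [inv a b _ he.2.1, Function.update_eq_self]
  · intro e he
    rw [Finset.mem_filter] at he
    simp only [Function.update_self, Function.update_idem]
    rw [inv b a _ he.2.1, Function.update_eq_self]
  · intro e he
    rw [Finset.mem_filter] at he
    rw [adj_term i a b c c' he.2.1 he.2.2 (mem_box.1 he.1 i)]
    ring

theorem killed_form (hodd : Odd p) {s : Fin t → ℤ} {eps : Finset (Fin t)} (hm : memCase p t m d s eps) :
    ∃ (v : LF p t m) (g : Fin t → Ex m), formL p t m v v ≠ 0 ∧ ∀ c, LGood p t m d s eps c → Raised c → c = c g • v := by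
  choose v0 g h1 h2 h3 using fun j : Fin t => lemR (m := m) (K := GaloisField p t) hodd (lamOfN p t d s j) (j ∈ eps)
  refine ⟨fun e => ∏ j, v0 j (e j), g, ?_, ?_⟩
  · rw [formL_apply]
    have : ∑ e ∈ boxT p t m, (∏ j, fct (GaloisField p t) (e j)) * ((∏ j, v0 j (e j)) * ∏ j, v0 j (e j)) =
        ∏ j, ∑ x ∈ Finset.Iic (topE p m), fct (GaloisField p t) x * (v0 j x * v0 j x) := by
      rw [Finset.prod_univ_sum]
      refine Finset.sum_congr rfl fun e _ => ?_
      rw [Finset.prod_mul_distrib, Finset.prod_mul_distrib]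
    rw [this]
    exact Finset.prod_ne_zero_iff.2 fun j _ => h2 j
  · intro c hc hk
    have key : ∀ T : Finset (Fin t), ∀ e, c e = c (fun j => if j ∈ T then g j else e j) * ∏ j ∈ T, v0 j (e j) := by
      intro T
      induction T using Finset.induction_on with
      | empty => intro e; simp
      | insert i T hi ih =>
        intro e
        rw [ih e, Finset.prod_insert hi]
        have := h3 i _ (slice_kil hk (fun j => if j ∈ T then g j else e j) i) (slice_supp hm hc (fun j => if j ∈ T then g j else e j) i) (e i)
        have e1 : Function.update (fun j => if j ∈ T then g j else e j) i (e i) = fun j => if j ∈ T then g j else e j := by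
          funext j
          by_cases hj : j = i
          · subst hj; simp [hi]
          · rw [Function.update_of_ne hj]
        have e2 : Function.update (fun j => if j ∈ T then g j else e j) i (g i) = fun j => if j ∈ insert i T then g j else e j := by
          funext j
          by_cases hj : j = i
          · subst hj; simp
          · rw [Function.update_of_ne hj]; simp [hj]
        simp only [e1, e2] at this
        rw [this]; ring
    funext e
    have := key Finset.univ e
    simpa using this

theorem formL_comm (c c' : LF p t m) : formL p t m c c' = formL p t m c' c := by
  rw [formL_apply, formL_apply]; exact Finset.sum_congr rfl fun _ _ => by ring

theorem W_sup (ht : 1 < t) (hodd : Odd p) (hd : d ≤ p ^ t - 2) {s : Fin t → ℤ} {eps : Finset (Fin t)} (hm : memCase p t m d s eps)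
    {W : Submodule (GaloisField p t) (FV p t m)} (hW : SpStable W) (hWY : W ≤ Ymod p t m d s eps) (hn : ¬ W ≤ Yltmod p t m d s eps) :
    Ymod p t m d s eps ≤ W ⊔ Yltmod p t m d s eps := by
  set D := W.map (lead p t m d s) with hD
  set U := (Ymod p t m d s eps).map (lead p t m d s) with hU
  have hDU : D ≤ U := Submodule.map_mono hWY
  have hDc : LClosed D := lead_closed ht hodd hW hWY
  have hUc : LClosed U := lead_closed ht hodd (Y_stable hodd ht hd s eps) le_rfl
  have hUg : ∀ c ∈ U, LGood p t m d s eps c := by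
    rintro _ ⟨f, hf, rfl⟩
    exact lead_good ht hodd hm hf
  have hred : ∀ c ∈ U, ∀ e, c e ≠ 0 → RedT p e := fun c hc e he => ((hUg c hc).1 e he).1
  obtain ⟨v, g, hv, hR⟩ := killed_form (p := p) hodd hm
  have hD0 : ∃ c ∈ D, c ≠ 0 := by
    obtain ⟨f, hf, hf'⟩ := Set.not_subset.1 hn
    refine ⟨_, ⟨f, hf, rfl⟩, fun h => hf' (Ylt_of_lead ht hodd hm (hWY hf) h)⟩
  have hEq : D = U := by
    by_contra hne
    have hlt : D < U := lt_of_le_of_ne hDU hne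
    haveI : Module.Finite (GaloisField p t) (FV p t m) := inferInstance
    haveI : Module.Finite (GaloisField p t) U := by
      rw [hU]; infer_instance
    haveI : Module.Finite (GaloisField p t) D := by
      rw [hD]; infer_instance
    have hfin : Module.finrank (GaloisField p t) D < Module.finrank (GaloisField p t) U := Submodule.finrank_lt_finrank_of_lt hlt
    let φ : U →ₗ[GaloisField p t] Module.Dual (GaloisField p t) D :=
      ((Module.Dual.transpose D.subtype).comp (formL p t m)).comp U.subtype
    have hφ : ∀ u : U, ∀ x : D, φ u x = formL p t m u x := fun u x => rfl
    have hker : ∃ u : U, u ≠ 0 ∧ φ u = 0 := by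
      have : LinearMap.ker φ ≠ ⊥ := by
        apply LinearMap.ker_ne_bot_of_finrank_lt
        rwa [Subspace.dual_finrank_eq]
      obtain ⟨u, hu, hu0⟩ := Submodule.exists_mem_ne_zero_of_ne_bot this
      exact ⟨u, hu0, hu⟩
    obtain ⟨u, hu0, hu⟩ := hker
    let N : Submodule (GaloisField p t) (LF p t m) :=
      { carrier := {c | c ∈ U ∧ ∀ x ∈ D, formL p t m c x = 0}
        add_mem' := fun {a b} ha hb => ⟨U.add_mem ha.1 hb.1, fun x hx => by rw [map_add, LinearMap.add_apply, ha.2 x hx, hb.2 x hx, add_zero]⟩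
        zero_mem' := ⟨U.zero_mem, fun x hx => by simp⟩
        smul_mem' := fun r a ha => ⟨U.smul_mem r ha.1, fun x hx => by rw [map_smul, LinearMap.smul_apply, ha.2 x hx, smul_zero]⟩ }
    have hNc : LClosed N := by
      refine ⟨fun i a c hc => ⟨hUc.1 i a c hc.1, fun x hx => ?_⟩, fun i a c hc => ⟨hUc.2.1 i a c hc.1, fun x hx => ?_⟩,
        fun i a b hab c hc => ⟨hUc.2.2 i a b hab c hc.1, fun x hx => ?_⟩⟩
      · rw [form_adj]; exact hc.2 _ (hDc.2.1 i a x hx)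
      · rw [form_adj]; exact hc.2 _ (hDc.1 i a x hx)
      · rw [map_sub, LinearMap.sub_apply, form_adj, form_adj, ← map_sub]
        exact hc.2 _ (hDc.2.2 i b a hab.symm x hx)
    obtain ⟨c0, hc0, hcn0⟩ := hD0
    obtain ⟨c1, hc1, hn1, hr1⟩ := engel hDc (fun c hc => hred c (hDU hc)) hc0 hcn0
    obtain ⟨c2, hc2, hn2, hr2⟩ := engel hNc (fun c hc => hred c hc.1) (c0 := (u : LF p t m))
      ⟨u.2, fun x hx => by rw [← hφ u ⟨x, hx⟩, hu]; rfl⟩ (fun h => hu0 (Subtype.ext h))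
    have e1 := hR c1 (hUg c1 (hDU hc1)) hr1
    have e2 := hR c2 (hUg c2 hc2.1) hr2
    have := hc2.2 c1 hc1
    rw [e1, e2, map_smul, map_smul, LinearMap.smul_apply, smul_eq_mul, smul_eq_mul] at this
    refine mul_ne_zero ?_ (mul_ne_zero ?_ hv) this
    · intro h; rw [h, zero_smul] at e1; exact hn1 e1
    · intro h; rw [h, zero_smul] at e2; exact hn2 e2
  intro y hy
  have : lead p t m d s y ∈ D := by rw [hEq]; exact ⟨y, hy, rfl⟩
  obtain ⟨w, hw, hwy⟩ := this
  have h1 : y - w ∈ Yltmod p t m d s eps := Ylt_of_lead ht hodd hm (Submodule.sub_mem _ hy (hWY hw)) (by rw [map_sub, hwy, sub_self])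
  have : y = w + (y - w) := by abel
  rw [this]
  exact Submodule.add_mem_sup hw h1

end PartD3

section PartE1
open MvPolynomial

theorem exists_btw {m : ℕ} (cap : Ex m) : ∀ (n : ℕ) (lo : Ex m), lo ≤ cap → lo.degree ≤ n → n ≤ cap.degree → 
    ∃ g : Ex m, lo ≤ g ∧ g ≤ cap ∧ g.degree = n := by
  intro n lo h1 h2 h3
  induction n, h2 using Nat.le_induction with
  | base => exact ⟨lo, le_rfl, h1, rfl⟩
  | succ n hn ih =>
    obtain ⟨g, hg1, hg2, hg3⟩ := ih (by omega)
    have : ∃ a, g a < cap a := by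
      by_contra hc
      push Not at hc
      have : cap = g := le_antisymm (fun a => hc a) hg2
      rw [this] at h3; omega
    obtain ⟨a, ha⟩ := this
    refine ⟨g + Finsupp.single a 1, hg1.trans (by simp), fun x => ?_, ?_⟩
    · by_cases hx : x = a
      · subst hx; simp; omega
      · simp [Finsupp.single_eq_of_ne hx]; exact hg2 x
    · rw [map_add, hg3]; simp

variable {K : Type} [Field K] {p : ℕ} [Fact p.Prime] [CharP K p] {m : ℕ}

/-- two-parameter exponents: `x` exponents `p-1`, `y` exponents `0`, except at `u`, `v` -/
def qE (p : ℕ) {m : ℕ} (u v : Fin m) (xu yu xv yv : ℕ) : Ex m :=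
  mkE (Sum.elim (fun a => if a = u then xu else if a = v then xv else p - 1)
    (fun a => if a = u then yu else if a = v then yv else 0))
@[simp] theorem qE_xu {u v : Fin m} {xu yu xv yv : ℕ} : qE p u v xu yu xv yv (.inl u) = xu := by simp [qE]
@[simp] theorem qE_yu {u v : Fin m} {xu yu xv yv : ℕ} : qE p u v xu yu xv yv (.inr u) = yu := by simp [qE]
theorem qE_xv {u v : Fin m} (h : u ≠ v) {xu yu xv yv : ℕ} : qE p u v xu yu xv yv (.inl v) = xv := by simp [qE, h.symm]
theorem qE_yv {u v : Fin m} (h : u ≠ v) {xu yu xv yv : ℕ} : qE p u v xu yu xv yv (.inr v) = yv := by simp [qE, h.symm]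
theorem qE_le {u v : Fin m} {xu yu xv yv : ℕ} (h1 : xu ≤ p-1) (h2 : yu ≤ p-1) (h3 : xv ≤ p-1) (h4 : yv ≤ p-1) :
    qE p u v xu yu xv yv ≤ topE p m := by
  rw [le_topE]
  rintro (a | a) <;> simp only [qE, mkE_apply, Sum.elim_inl, Sum.elim_inr] <;> split_ifs <;> omega
theorem qE_tw {u v : Fin m} {xu yu xv yv : ℕ}  :
    twE p (qE p u v xu yu xv yv) = qE p u v (p-1-yu) (p-1-xu) (p-1-yv) (p-1-xv) := by
  ext (a | a) <;> simp only [qE, twE, mkE_apply, Sum.elim_inl, Sum.elim_inr, Sum.swap_inl, Sum.swap_inr] <;> split_ifs <;> omega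
theorem qE_deg {u v : Fin m} (h : u ≠ v) {xu yu xv yv : ℕ} (hs : xu + yu + xv + yv = 2 * (p - 1)) :
    (qE p u v xu yu xv yv).degree = m * (p-1) := by
  rw [Finsupp.degree_eq_sum, Fintype.sum_sum_type]
  simp only [qE, mkE_apply, Sum.elim_inl, Sum.elim_inr]
  have e : ∀ a : Fin m, (((if a = u then xu else if a = v then xv else p - 1 : ℕ) : ℤ) + ((if a = u then yu else if a = v then yv else 0 : ℕ) : ℤ))
     = (p-1:ℕ) + (if a = u then (xu + yu - (p-1:ℕ) : ℤ) else 0) + (if a = v then (xv + yv - (p-1:ℕ) : ℤ) else 0) := by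
    intro a
    by_cases h1 : a = u
    · subst h1; simp [h]
    · by_cases h2 : a = v
      · subst h2; simp [h1]
      · simp [h1, h2]
  rw [← Finset.sum_add_distrib]
  apply Nat.cast_injective (R := ℤ)
  rw [Nat.cast_sum, Finset.sum_congr rfl fun a _ => (Nat.cast_add _ _).trans (e a)]
  simp only [Finset.sum_add_distrib, Finset.sum_ite_eq', Finset.mem_univ, if_true, Finset.sum_const, Finset.card_univ, Fintype.card_fin, smul_eq_mul]
  simp only [nsmul_eq_mul]
  push_cast
  zify at hs
  linarith

theorem qE_add (u v : Fin m) (xu yu xv yv : ℕ) : qE p u v xu (yu+1) xv yv = Finsupp.single (.inr u) 1 + qE p u v xu yu xv yv := by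
  ext (a | a)
  · simp [qE]
  · by_cases ha : a = u
    · subst ha; simp; omega
    · have : (Sum.inr a : Ix m) ≠ .inr u := fun h => ha (Sum.inr_injective h)
      simp [qE, ha, Finsupp.single_eq_of_ne this]

theorem X_mul_qE (u v : Fin m) (xu yu xv yv : ℕ) (c : K) :
    X (Sum.inr u : Ix m) * monomial (qE p u v xu yu xv yv) c = monomial (qE p u v xu (yu+1) xv yv) c := by
  rw [X, monomial_mul, one_mul, qE_add]

theorem two_idx (hm : 2 ≤ m) : ∃ u v : Fin m, u ≠ v := ⟨⟨0, by omega⟩, ⟨1, by omega⟩, by simp [Fin.ext_iff]⟩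

/-- minus-digit exponent -/
theorem gm_facts (hodd : Odd p) {u v : Fin m} (h : u ≠ v) :
    qE p u v (p-1) 1 (p-2) 0 ≤ topE p m ∧ (qE p u v (p-1) 1 (p-2) 0).degree = m * (p-1) ∧
    twE p (qE p u v (p-1) 1 (p-2) 0) = qE p u v (p-2) 0 (p-1) 1 ∧ twE p (qE p u v (p-1) 1 (p-2) 0) ≠ qE p u v (p-1) 1 (p-2) 0 := by
  have h3 := p_ge3 hodd
  have e : twE p (qE p u v (p-1) 1 (p-2) 0) = qE p u v (p-2) 0 (p-1) 1 := by
    rw [qE_tw]; congr 1 <;> omega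
  refine ⟨qE_le (by omega) (by omega) (by omega) (by omega), qE_deg h (by omega), e, fun h' => ?_⟩
  rw [e] at h'
  have := DFunLike.congr_fun h' (.inr u)
  simp at this

theorem pr_ne {g g' : Ex m} (c : K) (h : g' ≠ g) : coeff g (monomial g 1 + monomial g' c) = 1 := by
  rw [coeff_add, coeff_monomial, coeff_monomial, if_pos rfl, if_neg h, add_zero]

theorem pr_supp {g g' h : Ex m} {c c' : K} (hc : coeff h (monomial g c + monomial g' c') ≠ 0) : h = g ∨ h = g' := by
  rw [coeff_add, coeff_monomial, coeff_monomial] at hc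
  by_contra hn
  push Not at hn
  rw [if_neg (Ne.symm hn.1), if_neg (Ne.symm hn.2)] at hc
  simp at hc

theorem mono_supp {g h : Ex m} {c : K} (hc : coeff h (monomial g c) ≠ 0) : h = g := by
  rw [coeff_monomial] at hc
  by_contra hn
  exact hc (if_neg (Ne.symm hn))

theorem exists_dig (hodd : Odd p) (hm : 2 ≤ m) {lam : ℕ} (hl : lam ≤ 2 * (m * (p-1))) (pl : Prop) :
    ∃ F : MvPolynomial (Ix m) K, SSg p m lam pl F ∧ (∀ g, coeff g F ≠ 0 → g ≤ topE p m) ∧ ∃ g, coeff g F ≠ 0 := by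
  obtain ⟨u, v, huv⟩ := two_idx hm
  by_cases h : lam = m * (p-1)
  · subst h
    by_cases hpl : pl
    · refine ⟨monomial (hE p m) 1, self_SSg hpl hE_le hE_tw _ (deg_of_self hE_le hE_tw), fun g hg => ?_, hE p m, by simp⟩
      rw [mono_supp hg]; exact hE_le
    · obtain ⟨h1, h2, h3, h4⟩ := gm_facts (m := m) hodd huv
      refine ⟨_, pr_SSg hodd pl h1 h2, fun g hg => ?_, qE p u v (p-1) 1 (p-2) 0, ?_⟩
      · rcases pr_supp hg with rfl | rfl
        · exact h1
        · exact twE_le _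
      · rw [pr_ne _ h4]; exact one_ne_zero
  · obtain ⟨g, -, hg, hd⟩ := exists_btw (topE p m) lam 0 (by simp) (by simp) (by rw [deg_top]; exact hl)
    refine ⟨monomial g 1, mono_SSg pl hd h, fun g' hg' => ?_, g, by simp⟩
    rw [mono_supp hg']; exact hg

theorem SSg_ne {pl : Prop} {n : ℕ} {F : MvPolynomial (Ix m) K} (hF : F.IsHomogeneous n) (h : n ≠ m * (p-1)) : SSg p m n pl F :=
  ⟨hF, fun h' => absurd h' h⟩

theorem SSg_pl {pl pl' : Prop} {n : ℕ} {F : MvPolynomial (Ix m) K} (hF : SSg p m n pl F) (h : n = m * (p-1) → (pl ↔ pl')) : SSg p m n pl' F := by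
  by_cases hn : n = m * (p-1)
  · rw [← propext (h hn)]; exact hF
  · exact SSg_ne hF.1 hn

set_option maxHeartbeats 1000000 in
theorem exists_J (hodd : Odd p) {u v : Fin m} (huv : u ≠ v) {lam : ℕ} (hl : lam + 1 ≤ 2 * (m * (p-1))) (pl pl' : Prop) :
    ∃ F : MvPolynomial (Ix m) K, SSg p m lam pl F ∧ SSg p m (lam+1) pl' (X (Sum.inr u : Ix m) * F) ∧
      (∀ g, coeff g F ≠ 0 → g ≤ topE p m ∧ g (.inr u) ≤ p - 2) ∧ ∃ g, coeff g F ≠ 0 := by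
  have h3 := p_ge3 hodd
  have hX : ∀ {n : ℕ} {F : MvPolynomial (Ix m) K}, F.IsHomogeneous n → (X (Sum.inr u : Ix m) * F).IsHomogeneous (n+1) := by
    intro n F hF
    rw [add_comm]
    exact (isHomogeneous_X K _).mul hF
  by_cases h : lam = m * (p-1)
  · subst h
    by_cases hpl : pl
    · have : SSg p m (m * (p-1)) pl (monomial (hE p m) (1:K)) := self_SSg hpl hE_le hE_tw _ (deg_of_self hE_le hE_tw)
      refine ⟨monomial (hE p m) 1, this, SSg_ne (hX this.1) (by omega), fun g hg => ?_, hE p m, by simp⟩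
      rw [mono_supp hg]; exact ⟨hE_le, by simp⟩
    · obtain ⟨h1, h2, h3, h4⟩ := gm_facts (m := m) hodd huv
      have := pr_SSg (K := K) hodd pl h1 h2
      refine ⟨_, this, SSg_ne (hX this.1) (by omega), fun g hg => ?_, qE p u v (p-1) 1 (p-2) 0, ?_⟩
      · rcases pr_supp hg with rfl | rfl
        · exact ⟨h1, by simp; omega⟩
        · exact ⟨twE_le _, by rw [h3]; simp⟩
      · rw [pr_ne _ h4]; exact one_ne_zero
  · by_cases h' : lam + 1 = m * (p-1)
    · have key : ∀ F : MvPolynomial (Ix m) K, F.IsHomogeneous lam → SSg p m lam pl F := fun F hF => SSg_ne hF h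
      by_cases hpl : pl'
      · have hle : qE p u v 0 (p-1) (p-1) 0 ≤ topE p m := qE_le (by omega) (by omega) (by omega) (by omega)
        have hp : p - 1 = p - 2 + 1 := by omega
        have hX1 : X (Sum.inr u : Ix m) * monomial (qE p u v 0 (p-2) (p-1) 0) (1:K) = monomial (qE p u v 0 (p-1) (p-1) 0) 1 := by
          rw [X_mul_qE, ← hp]
        have hd : (qE p u v 0 (p-2) (p-1) 0).degree = lam := by
          have := qE_deg (p := p) huv (xu := 0) (yu := p-2+1) (xv := p-1) (yv := 0) (by omega)
          rw [qE_add, map_add, ← h'] at this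
          simp at this; omega
        refine ⟨monomial (qE p u v 0 (p-2) (p-1) 0) 1, key _ (monomial_hom _ hd), ?_, fun g hg => ?_, qE p u v 0 (p-2) (p-1) 0, ?_⟩
        · rw [hX1]
          exact self_SSg hpl hle (by rw [qE_tw]; congr 1 <;> omega) _ (by rw [h']; exact qE_deg huv (by omega))
        · rw [mono_supp hg]
          exact ⟨qE_le (by omega) (by omega) (by omega) (by omega), by simp⟩
        · simp
      · have hle : qE p u v (p-2) 2 (p-2) 0 ≤ topE p m := qE_le (by omega) (by omega) (by omega) (by omega)
        have hdg : (qE p u v (p-2) 2 (p-2) 0).degree = m * (p-1) := qE_deg huv (by omega)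
        have htw : twE p (qE p u v (p-2) 2 (p-2) 0) = qE p u v (p-3) 1 (p-1) 1 := by
          rw [qE_tw]; congr 1 <;> omega
        have hS := pr_SSg (K := K) hodd pl' hle hdg
        rw [htw] at hS
        have hd1 : (qE p u v (p-2) 1 (p-2) 0).degree = lam := by
          rw [qE_add _ _ _ 1, map_add] at hdg; simp at hdg; omega
        have hd2 : (qE p u v (p-3) 0 (p-1) 1).degree = lam := by
          have : (qE p u v (p-3) 1 (p-1) 1).degree = m * (p-1) := qE_deg huv (by omega)
          rw [qE_add _ _ _ 0, map_add] at this; simp at this; omega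
        refine ⟨monomial (qE p u v (p-2) 1 (p-2) 0) 1 + monomial (qE p u v (p-3) 0 (p-1) 1) (pm K pl' * sgE K (qE p u v (p-2) 2 (p-2) 0)),
          key _ ((monomial_hom _ hd1).add (monomial_hom _ hd2)), ?_, fun g hg => ?_, qE p u v (p-2) 1 (p-2) 0, ?_⟩
        · rw [mul_add, X_mul_qE, X_mul_qE, h']; exact hS
        · rcases pr_supp hg with rfl | rfl
          · exact ⟨qE_le (by omega) (by omega) (by omega) (by omega), by simp; omega⟩
          · exact ⟨qE_le (by omega) (by omega) (by omega) (by omega), by simp⟩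
        · rw [pr_ne]
          · exact one_ne_zero
          · intro hh
            have := DFunLike.congr_fun hh (.inr u)
            simp at this
    · obtain ⟨g, -, hg, hd⟩ := exists_btw (topE p m - Finsupp.single (.inr u) 1) lam 0 (by simp) (by simp) (by
        have : (topE p m - Finsupp.single (.inr u) 1 + Finsupp.single (.inr u) 1 : Ex m) = topE p m :=
          tsub_add_cancel_of_le (by
            intro x
            by_cases hx : x = .inr u
            · subst hx; simp [topE]; omega
            · simp [Finsupp.single_eq_of_ne hx])
        have h2 := congrArg Finsupp.degree this
        rw [map_add, deg_top] at h2
        simp at h2; omega)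
      refine ⟨monomial g 1, mono_SSg pl hd h, SSg_ne (hX (monomial_hom _ hd)) h', fun g' hg' => ?_, g, by simp⟩
      rw [mono_supp hg']
      refine ⟨hg.trans tsub_le_self, (hg (.inr u)).trans ?_⟩
      simp [topE]; omega

end PartE1

section PartE2
open MvPolynomial
variable {p t m d : ℕ} [Fact p.Prime] [NeZero t]

def ew (u : Fin m) : Ix m → ℤ := Pi.single (.inl u) 1
def fw (u : Fin m) : Ix m → ℤ := Pi.single (.inr u) 1

theorem ell_e (u : Fin m) : ellP p t (ew u) = - X (.inr u) := by
  rw [ellP, Fintype.sum_sum_type]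
  simp [lc, ew, Pi.single_apply]

theorem ell_f (u : Fin m) : ellP p t (fw u) = X (.inl u) := by
  rw [ellP, Fintype.sum_sum_type]
  simp [lc, fw, Pi.single_apply]

theorem S1_fixed (b : Ix m) {h : Ex m} (hb : h b = 0) (c : GaloisField p t) :
    S1 p t (Pi.single b 1) (monomial h c) = Polynomial.C (monomial h c) := by
  rw [monomial_eq, map_mul, S1_C, Polynomial.C_mul, Finsupp.prod, map_prod, map_prod]
  congr 1
  refine Finset.prod_congr rfl fun a ha => ?_
  have hab : a ≠ b := by
    rintro rfl
    exact (Finsupp.mem_support_iff.1 ha) hb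
  rw [map_pow, S1_X, Pi.single_eq_of_ne hab]
  simp

theorem S1_mono (b : Ix m) (g : Ex m) (c : GaloisField p t) (l : ℕ) :
    (S1 p t (Pi.single b 1) (monomial g c)).coeff l = monomial (g - Finsupp.single b l) (c * ((g b).choose l : ℕ)) := by
  have e : monomial g c = X b ^ (g b) * monomial (g.erase b) c := by
    rw [X_pow_eq_monomial, monomial_mul, one_mul, Finsupp.single_add_erase]
  rw [e, map_mul, S1_fixed b (by simp), map_pow, S1_X, Polynomial.coeff_mul_C]
  have : (Polynomial.C (X b) + Polynomial.X * Polynomial.C (C (((Pi.single b 1 : Ix m → ℤ) b : ℤ) : GaloisField p t)) : Polynomial (PV p t m)) =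
      Polynomial.X + Polynomial.C (X b) := by
    simp [add_comm]
  rw [this, Polynomial.coeff_X_add_C_pow]
  by_cases h : l ≤ g b
  · have e2 : (((g b).choose l : ℕ) : PV p t m) = C (((g b).choose l : ℕ) : GaloisField p t) := by simp
    rw [e2, X_pow_eq_monomial, mul_comm (monomial _ _), C_mul_monomial, monomial_mul]
    have e3 : (Finsupp.single b (g b - l) + g.erase b) = g - Finsupp.single b l := by
      ext a
      by_cases ha : a = b
      · subst ha; simp
      · simp [Finsupp.single_eq_of_ne ha, Finsupp.erase_ne ha]
    rw [e3]; congr 1; ring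
  · rw [Nat.choose_eq_zero_of_lt (by omega)]; simp

theorem DL_e (u : Fin m) (g : Ex m) (c : GaloisField p t) (l : ℕ) :
    DL p t (ew u) l (monomial g c) = monomial (g - Finsupp.single (.inl u) l + Finsupp.single (.inr u) l) ((-1)^l * (c * ((g (.inl u)).choose l : ℕ))) := by
  rw [DL_apply, ell_e, ew, S1_mono, neg_pow, X_pow_eq_monomial]
  have : ((-1 : PV p t m))^l = C ((-1)^l) := by simp
  rw [this, mul_assoc, monomial_mul, C_mul_monomial, one_mul, add_comm]

theorem DL_f (u : Fin m) (g : Ex m) (c : GaloisField p t) (l : ℕ) :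
    DL p t (fw u) l (monomial g c) = monomial (g - Finsupp.single (.inr u) l + Finsupp.single (.inl u) l) (c * ((g (.inr u)).choose l : ℕ)) := by
  rw [DL_apply, ell_f, fw, S1_mono, X_pow_eq_monomial, monomial_mul, one_mul, add_comm]

/-- all `DL` of degree at least `p` vanish -/
def G0 (p t : ℕ) {m : ℕ} [Fact p.Prime] (u : Fin m) (F : PV p t m) : Prop :=
  ∀ l, p ≤ l → DL p t (ew u) l F = 0 ∧ DL p t (fw u) l F = 0

def GJ (p t : ℕ) {m : ℕ} [Fact p.Prime] (u : Fin m) (F : PV p t m) : Prop :=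
  G0 p t u F ∧ ∀ l, p ≤ l → DL p t (fw u) l (DL p t (ew u) 1 F) = 0

def GI (p t : ℕ) {m : ℕ} [Fact p.Prime] (u : Fin m) (F G : PV p t m) : Prop :=
  G0 p t u F ∧ (∀ l, p < l → DL p t (ew u) l (DL p t (fw u) 1 F) = 0) ∧
  DL p t (ew u) p (DL p t (fw u) 1 F) = - (X (.inr u) ^ p * G)

theorem G0_mono (u : Fin m) {g : Ex m} (hg : g ≤ topE p m) (c : GaloisField p t) : G0 p t u (monomial g c) := by
  intro l hl
  have hp := (Fact.out : p.Prime).two_le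
  have h1 := (le_topE _).1 hg (.inl u)
  have h2 := (le_topE _).1 hg (.inr u)
  rw [DL_e, DL_f, Nat.choose_eq_zero_of_lt (by omega), Nat.choose_eq_zero_of_lt (by omega)]
  simp

theorem GJ_mono (u : Fin m) {g : Ex m} (hg : g ≤ topE p m) (hu : g (.inr u) ≤ p - 2) (c : GaloisField p t) : GJ p t u (monomial g c) := by
  refine ⟨G0_mono u hg c, fun l hl => ?_⟩
  have hp := (Fact.out : p.Prime).two_le
  rw [DL_e, DL_f, Nat.choose_eq_zero_of_lt (k := l)]
  · simp
  · simp; omega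

theorem GI_lt (u : Fin m) {g : Ex m} (hg : g ≤ topE p m) (hu : g (.inl u) + 1 < p) (c : GaloisField p t) : GI p t u (monomial g c) 0 := by
  have : ∀ l, p ≤ l → DL p t (ew u) l (DL p t (fw u) 1 (monomial g c)) = 0 := by
    intro l hl
    rw [DL_f, DL_e, Nat.choose_eq_zero_of_lt (k := l)]
    · simp
    · simp; omega
  exact ⟨G0_mono u hg c, fun l hl => this l hl.le, by rw [this p le_rfl]; simp⟩

theorem GI_eq (hodd : Odd p) (u : Fin m) {g : Ex m} (hg : g ≤ topE p m) (hu : g (.inl u) = p - 1) (hy : 1 ≤ g (.inr u)) (c : GaloisField p t) :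
    GI p t u (monomial g c) (monomial (g - Finsupp.single (.inl u) (p-1) - Finsupp.single (.inr u) 1) (c * (g (.inr u) : ℕ))) := by
  have hp := (Fact.out : p.Prime).two_le
  refine ⟨G0_mono u hg c, fun l hl => ?_, ?_⟩
  · rw [DL_f, DL_e, Nat.choose_eq_zero_of_lt (k := l)]
    · simp
    · simp; omega
  · rw [DL_f, DL_e]
    have e : (g - Finsupp.single (.inr u) 1 + Finsupp.single (.inl u) 1 : Ex m) (.inl u) = p := by simp; omega
    rw [e, Nat.choose_self, Nat.choose_one_right, Odd.neg_one_pow hodd, X_pow_eq_monomial, monomial_mul]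
    rw [← map_neg (monomial (R := GaloisField p t) _)]
    congr 1
    · congr 1
      ext x
      by_cases h1 : x = .inl u
      · subst h1; simp; omega
      · by_cases h2 : x = .inr u
        · subst h2; simp; omega
        · simp [Finsupp.single_eq_of_ne h1, Finsupp.single_eq_of_ne h2]
    · push_cast; ring

theorem G0_add {u : Fin m} {F F' : PV p t m} (h : G0 p t u F) (h' : G0 p t u F') : G0 p t u (F + F') := by
  intro l hl
  rw [map_add, map_add, (h l hl).1, (h l hl).2, (h' l hl).1, (h' l hl).2]; simp

theorem GI_add {u : Fin m} {F F' G G' : PV p t m} (h : GI p t u F G) (h' : GI p t u F' G') : GI p t u (F + F') (G + G') := by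
  refine ⟨G0_add h.1 h'.1, fun l hl => ?_, ?_⟩
  · rw [map_add, map_add, h.2.1 l hl, h'.2.1 l hl, add_zero]
  · rw [map_add, map_add, h.2.2, h'.2.2]; ring

theorem lin_red {S : Ex m → Prop} {F : PV p t m} (h : ∀ g, coeff g F ≠ 0 → S g) {L : PV p t m →ₗ[GaloisField p t] PV p t m}
    (hL : ∀ g c, S g → L (monomial g c) = 0) : L F = 0 := by
  conv_lhs => rw [F.as_sum]
  rw [map_sum]
  exact Finset.sum_eq_zero fun g hg => hL _ _ (h g (mem_support_iff.1 hg))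

theorem G0_red (u : Fin m) {F : PV p t m} (h : ∀ g, coeff g F ≠ 0 → g ≤ topE p m) : G0 p t u F := fun l hl =>
  ⟨lin_red h fun g c hg => (G0_mono u hg c l hl).1, lin_red h fun g c hg => (G0_mono u hg c l hl).2⟩

theorem GJ_red (u : Fin m) {F : PV p t m} (h : ∀ g, coeff g F ≠ 0 → g ≤ topE p m ∧ g (.inr u) ≤ p - 2) : GJ p t u F :=
  ⟨G0_red u fun g hg => (h g hg).1, fun l hl => lin_red (L := (DL p t (fw u) l).comp (DL p t (ew u) 1)) h fun g c hg => (GJ_mono u hg.1 hg.2 c).2 l hl⟩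

theorem exists_I (hodd : Odd p) {u v : Fin m} (huv : u ≠ v) {lam : ℕ} (h0 : p ≤ lam) (hl : lam ≤ 2 * (m * (p-1))) (pl : Prop) :
    ∃ (F : PV p t m) (g : Ex m) (c : GaloisField p t), SSg p m lam pl F ∧ GI p t u F (monomial g c) ∧ c ≠ 0 ∧ g ≤ topE p m ∧
      g.degree = lam - p ∧ (lam - p = m * (p-1) → g = qE p u v 0 (p-2) (p-1) 1) := by
  have h3 := p_ge3 hodd
  have gen : ∀ g : Ex m, g ≤ topE p m → g (.inl u) = p - 1 → 1 ≤ g (.inr u) → g.degree = lam →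
      (1 * ((g (.inr u) : ℕ) : GaloisField p t)) ≠ 0 ∧ (g - Finsupp.single (.inl u) (p-1) - Finsupp.single (.inr u) 1) ≤ topE p m ∧ 
      (g - Finsupp.single (.inl u) (p-1) - Finsupp.single (.inr u) 1 : Ex m).degree = lam - p := by
    intro g hg h1 h2 hd
    refine ⟨?_, (tsub_le_self.trans tsub_le_self).trans hg, ?_⟩
    · rw [one_mul]; exact cast_ne (p := p) h2 ((le_topE _).1 hg _)
    · have : (g - Finsupp.single (.inl u) (p-1) - Finsupp.single (.inr u) 1 + Finsupp.single (.inr u) 1 + Finsupp.single (.inl u) (p-1) : Ex m) = g := by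
        ext x
        by_cases h1 : x = .inl u
        · subst h1; simp; omega
        · by_cases h2 : x = .inr u
          · subst h2; simp; omega
          · simp [Finsupp.single_eq_of_ne h1, Finsupp.single_eq_of_ne h2]
      have h4 := congrArg Finsupp.degree this
      rw [map_add, map_add, hd, Finsupp.degree_single, Finsupp.degree_single] at h4
      omega
  by_cases h : lam = m * (p-1)
  · obtain ⟨h1, h2, h3', h4⟩ := gm_facts (m := m) hodd huv
    obtain ⟨e1, e2, e3⟩ := gen _ h1 (by simp) (by simp) (by rw [h2, h])
    refine ⟨monomial (qE p u v (p-1) 1 (p-2) 0) 1 + monomial (twE p (qE p u v (p-1) 1 (p-2) 0)) (pm _ pl * sgE _ (qE p u v (p-1) 1 (p-2) 0)),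
      _, _, ?_, ?_, e1, e2, e3, fun hh => by omega⟩
    · rw [h]; exact pr_SSg hodd pl h1 h2
    · have := GI_add (GI_eq (t := t) hodd u h1 (by simp) (by simp) 1) (GI_lt u (twE_le _) (by rw [h3']; simp; omega) (pm _ pl * sgE _ (qE p u v (p-1) 1 (p-2) 0)))
      rwa [add_zero] at this
  · by_cases h' : lam - p = m * (p-1)
    · have hle : qE p u v (p-1) (p-1) (p-1) 1 ≤ topE p m := qE_le (by omega) (by omega) (by omega) (by omega)
      have hq : qE p u v (p-1) (p-1) (p-1) 1 = Finsupp.single (.inr u) 1 + Finsupp.single (.inl u) (p-1) + qE p u v 0 (p-2) (p-1) 1 := by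
        ext (a | a)
        · by_cases ha : a = u
          · subst ha; simp
          · have : (Sum.inl a : Ix m) ≠ .inl u := fun h => ha (Sum.inl_injective h)
            simp [qE, ha, Finsupp.single_eq_of_ne this]
        · by_cases ha : a = u
          · subst ha; simp; omega
          · have : (Sum.inr a : Ix m) ≠ .inr u := fun h => ha (Sum.inr_injective h)
            simp [qE, ha, Finsupp.single_eq_of_ne this]
      have hd : (qE p u v (p-1) (p-1) (p-1) 1).degree = lam := by
        rw [hq, map_add, map_add, qE_deg huv (by omega), Finsupp.degree_single, Finsupp.degree_single]; omega
      obtain ⟨e1, e2, e3⟩ := gen _ hle (by simp) (by simp; omega) hd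
      refine ⟨monomial (qE p u v (p-1) (p-1) (p-1) 1) 1, _, _, mono_SSg pl hd h, GI_eq hodd u hle (by simp) (by simp; omega) 1, e1, e2, e3, fun _ => ?_⟩
      rw [hq]
      ext x
      simp only [Finsupp.tsub_apply, Finsupp.add_apply]
      omega
    · obtain ⟨g, hg1, hg2, hd⟩ := exists_btw (topE p m) lam (Finsupp.single (.inl u) (p-1) + Finsupp.single (.inr u) 1) (by
          rw [le_topE]; intro x
          by_cases h1 : x = .inl u
          · subst h1; simp
          · by_cases h2 : x = .inr u
            · subst h2; simp; omega
            · simp [Finsupp.single_eq_of_ne h1, Finsupp.single_eq_of_ne h2]) (by rw [map_add, Finsupp.degree_single, Finsupp.degree_single]; omega) (by rw [deg_top]; exact hl)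
      have k1 : g (.inl u) = p - 1 := by
        have := hg1 (.inl u)
        have h5 := (le_topE _).1 hg2 (.inl u)
        simp at this; omega
      have k2 : 1 ≤ g (.inr u) := by
        have := hg1 (.inr u)
        simpa using this
      obtain ⟨e1, e2, e3⟩ := gen _ hg2 k1 k2 hd
      exact ⟨monomial g 1, _, _, mono_SSg pl hd h, GI_eq hodd u hg2 k1 k2 1, e1, e2, e3, fun hh => absurd hh h'⟩

end PartE2

section PartE3
open MvPolynomial
variable {p t m d : ℕ} [Fact p.Prime] [NeZero t]

theorem nI_pos (ht : 1 < t) (hodd : Odd p) (i : Fin t) : 0 < nI p t i := by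
  have := pow_lt_q ht hodd i; unfold nI; omega

theorem single_le (i : Fin t) (j : Fin t) : (Pi.single i 1 : Fin t → ℕ) j ≤ p - 1 := by
  have hp := (Fact.out : p.Prime).two_le
  by_cases c : j = i
  · subst c; simp; omega
  · rw [Pi.single_eq_of_ne c]; omega

theorem Xop_exact (ht : 1 < t) (hodd : Odd p) (w : Ix m → ℤ) (F : Fin t → PV p t m) (i : Fin t)
    (h : ∀ j l, p ≤ l → DL p t w l (F j) = 0) :
    Xop w (nI p t i) (PhiM p t m F) = PhiM p t m (Function.update F i (DL p t w 1 (F i))) := by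
  obtain ⟨N, hN1, hNp, hN⟩ := exists_N w F
  rw [Xop_Phi w (nI_pos ht hodd i) F hN, Finset.sum_eq_single (Pi.single i 1)]
  · rw [if_pos, DL_single]
    rw [l_single ht hodd]
    exact single_le i
  · intro l _ hl1
    split_ifs with hc
    · by_cases hl : ∀ j, l j ≤ p - 1
      · exact absurd ((l_single ht hodd i hl).1 hc) hl1
      · push Not at hl
        obtain ⟨j, hj⟩ := hl
        exact (PhiM p t m).map_coord_zero j (h j _ (by omega))
    · rfl
  · intro h
    exfalso; apply h
    rw [Fintype.mem_piFinset]
    intro j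
    rw [Finset.mem_range]
    have := single_le (p := p) i j
    omega

theorem l_p (ht : 1 < t) (hodd : Odd p) (i : Fin t) {l : Fin t → ℕ} (hi : l i = p) (hl : ∀ j, j ≠ i → l j ≤ p - 1) :
    p ^ t - 1 ∣ nI p t (i+1 : Fin t) + ∑ j : Fin t, l j * p ^ (j:ℕ) ↔ l = Pi.single i p := by
  have hp := p_ge3 hodd
  set l0 := Function.update l i 0 with hl0
  have hpi : 0 < p ^ (i:ℕ) := by positivity
  have e1 : ∑ j : Fin t, l j * p ^ (j:ℕ) = p * p ^ (i:ℕ) + ∑ j : Fin t, l0 j * p ^ (j:ℕ) := by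
    rw [← Finset.add_sum_erase _ _ (Finset.mem_univ i), ← Finset.add_sum_erase (f := fun j : Fin t => l0 j * p ^ (j:ℕ)) _ (Finset.mem_univ i)]
    simp only [hl0, Function.update_self, hi, zero_mul, zero_add]
    congr 1
    refine Finset.sum_congr rfl fun j hj => ?_
    rw [Function.update_of_ne (Finset.ne_of_mem_erase hj)]
  have e2 : (p - 1) * p ^ (i:ℕ) + ∑ j : Fin t, l0 j * p ^ (j:ℕ) < p ^ t := by
    have := digs_lt (p := p) (t := t) (f := Function.update l i (p-1)) (by
      intro j
      by_cases h : j = i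
      · subst h; simp
      · rw [Function.update_of_ne h]; exact hl j h)
    refine lt_of_eq_of_lt ?_ this
    rw [← Finset.add_sum_erase (f := fun j : Fin t => Function.update l i (p-1) j * p ^ (j:ℕ)) _ (Finset.mem_univ i), ← Finset.add_sum_erase (f := fun j : Fin t => l0 j * p ^ (j:ℕ)) _ (Finset.mem_univ i)]
    simp only [hl0, Function.update_self, zero_mul, zero_add]
    refine congrArg _ ?_
    refine Finset.sum_congr rfl fun j hj => ?_
    rw [Function.update_of_ne (Finset.ne_of_mem_erase hj), Function.update_of_ne (Finset.ne_of_mem_erase hj)]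
  have e3 : ∑ j : Fin t, l0 j * p ^ (j:ℕ) < p ^ t - 1 := by
    have : 2 * 1 ≤ (p - 1) * p ^ (i:ℕ) := Nat.mul_le_mul (by omega) hpi
    omega
  have e4 : p ^ t - 1 ∣ nI p t (i+1 : Fin t) + p * p ^ (i:ℕ) := by
    have h5 := pow_lt_q ht hodd (i+1)
    by_cases hlast : i.1 + 1 < t
    · have : p * p ^ (i:ℕ) = p ^ ((i+1 : Fin t) : ℕ) := by rw [val_succ' hlast, pow_succ, mul_comm]
      rw [this]; unfold nI
      rw [Nat.sub_add_cancel (by omega)]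
    · have hl : i.1 + 1 = t := by have := i.2; omega
      have : p * p ^ (i:ℕ) = p ^ t := by
        have h6 : p ^ t = p ^ (i.1+1) := congrArg _ hl.symm
        rw [h6, pow_succ, mul_comm]
      rw [this, last_succ hl]; unfold nI
      rw [last_succ hl] at h5
      simp at h5 ⊢
      refine ⟨2, ?_⟩
      omega
  rw [e1, ← add_assoc, Nat.dvd_add_right e4]
  constructor
  · intro h
    have h0 := Nat.eq_zero_of_dvd_of_lt h e3
    rw [Finset.sum_eq_zero_iff] at h0
    funext j
    by_cases hj : j = i
    · subst hj; rw [hi, Pi.single_eq_same]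
    · have := h0 j (Finset.mem_univ j)
      rw [hl0, Function.update_of_ne hj] at this
      rw [Pi.single_eq_of_ne hj]
      have hpj : 0 < p ^ (j:ℕ) := by positivity
      rcases Nat.mul_eq_zero.1 this with h | h
      · exact h
      · omega
  · intro h
    rw [Finset.sum_eq_zero]
    · exact dvd_zero _
    · intro j _
      by_cases hj : j = i
      · subst hj; simp [hl0]
      · rw [hl0, Function.update_of_ne hj, h, Pi.single_eq_of_ne hj, zero_mul]

theorem Xop_exact2 (ht : 1 < t) (hodd : Odd p) (w : Ix m → ℤ) (F : Fin t → PV p t m) (i : Fin t)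
    (h : ∀ j, j ≠ i → ∀ l, p ≤ l → DL p t w l (F j) = 0) (hi : ∀ l, p < l → DL p t w l (F i) = 0) :
    Xop w (nI p t (i+1 : Fin t)) (PhiM p t m F) = PhiM p t m (Function.update F (i+1) (DL p t w 1 (F (i+1)))) +
      PhiM p t m (Function.update F i (DL p t w p (F i))) := by
  have hp := p_ge3 hodd
  obtain ⟨N, hN1, hNp, hN⟩ := exists_N w F
  rw [Xop_Phi w (nI_pos ht hodd (i+1)) F hN, Finset.sum_eq_add (Pi.single (i+1) 1) (Pi.single i p)]
  · rw [if_pos, DL_single, if_pos, DL_single]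
    · rw [l_p ht hodd _ (by simp)]
      intro j hj; rw [Pi.single_eq_of_ne hj]; omega
    · rw [l_single ht hodd]
      exact single_le _
  · intro h
    have := congrFun h i
    rw [Pi.single_eq_of_ne (fin_succ_ne ht i).symm] at this
    simp at this; omega
  · intro l _ hl1
    split_ifs with hc
    · by_cases hl : ∀ j, j ≠ i → l j ≤ p - 1
      · by_cases hli : l i ≤ p - 1
        · refine absurd ((l_single ht hodd (i+1) fun j => ?_).1 hc) hl1.1
          by_cases hj : j = i
          · subst hj; exact hli
          · exact hl j hj
        · by_cases hlp : l i = p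
          · exact absurd ((l_p ht hodd i hlp hl).1 hc) hl1.2
          · exact (PhiM p t m).map_coord_zero i (hi _ (by omega))
      · push Not at hl
        obtain ⟨j, hj, hj'⟩ := hl
        exact (PhiM p t m).map_coord_zero j (h j hj _ (by omega))
    · rfl
  · intro h
    exfalso; apply h
    rw [Fintype.mem_piFinset]
    intro j
    rw [Finset.mem_range]
    have := single_le (p := p) (i+1) j
    omega
  · intro h
    exfalso; apply h
    rw [Fintype.mem_piFinset]
    intro j
    rw [Finset.mem_range]
    by_cases hj : j = i
    · subst hj; simpa using hNp
    · rw [Pi.single_eq_of_ne hj]; omega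

/-- the commutator operator -/
def aop (p t : ℕ) {m : ℕ} [Fact p.Prime] [NeZero t] (u : Fin m) (i : Fin t) : FV p t m →ₗ[GaloisField p t] FV p t m :=
  (Xop (ew u) (nI p t (i+1 : Fin t))).comp (Xop (fw u) (nI p t i)) - (Xop (fw u) (nI p t i)).comp (Xop (ew u) (nI p t (i+1 : Fin t)))

theorem aop_stable {W : Submodule (GaloisField p t) (FV p t m)} (hW : SpStable W) (u : Fin m) (i : Fin t) {f : FV p t m} (hf : f ∈ W) :
    aop p t u i f ∈ W :=
  W.sub_mem (Xop_stable hW _ _ (Xop_stable hW _ _ hf)) (Xop_stable hW _ _ (Xop_stable hW _ _ hf))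

theorem aop_Phi (ht : 1 < t) (hodd : Odd p) (u : Fin m) (i : Fin t) {F : Fin t → PV p t m} {G : PV p t m}
    (h0 : ∀ j, G0 p t u (F j)) (hJ : GJ p t u (F (i+1))) (hI : GI p t u (F i) G) :
    aop p t u i (PhiM p t m F) = - PhiM p t m (Function.update (Function.update F (i+1) (X (.inr u) * F (i+1))) i G) := by
  have hne := fin_succ_ne ht i
  rw [aop, LinearMap.sub_apply, LinearMap.comp_apply, LinearMap.comp_apply,
    Xop_exact ht hodd (fw u) F i (fun j l hl => (h0 j l hl).2),
    Xop_exact ht hodd (ew u) F (i+1) (fun j l hl => (h0 j l hl).1),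
    Xop_exact ht hodd (fw u) _ i, Xop_exact2 ht hodd (ew u) _ i]
  · rw [Function.update_of_ne hne, Function.update_of_ne hne.symm, Function.update_self, Function.update_idem,
      Function.update_comm hne.symm, add_sub_cancel_left, hI.2.2]
    have e : -(X (Sum.inr u : Ix m) ^ p * G) = (-1 : GaloisField p t) • (X (Sum.inr u : Ix m) ^ p * G) := by simp
    rw [e, (PhiM p t m).map_update_smul, PhiM_carry' ht, Function.update_comm hne.symm]
    simp
  · intro j hj l hl
    rw [Function.update_of_ne hj]; exact (h0 j l hl).1
  · intro l hl
    rw [Function.update_self]; exact hI.2.1 l hl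
  · intro j l hl
    by_cases hj : j = i + 1
    · subst hj; rw [Function.update_self]; exact hJ.2 l hl
    · rw [Function.update_of_ne hj]; exact (h0 j l hl).2

theorem LOp_comm {i j : Fin t} (h : i ≠ j) (a b a' b' : Ix m) (c : LF p t m) :
    LOp p t m i a b (LOp p t m j a' b' c) = LOp p t m j a' b' (LOp p t m i a b c) := by
  funext e
  simp only [LOp_apply, dop, Function.update_of_ne h, Function.update_of_ne h.symm, Function.update_comm h]
  split_ifs <;> ring

theorem aop_Y (ht : 1 < t) (hodd : Odd p) (hd : d ≤ p ^ t - 2) {s : Fin t → ℤ} {eps : Finset (Fin t)} (hm : memCase p t m d s eps)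
    (u : Fin m) (i : Fin t) {f : FV p t m} (hf : f ∈ Ymod p t m d s eps) : aop p t u i f ∈ Yltmod p t m d s eps := by
  have hst := Y_stable (m := m) hodd ht hd s eps
  refine Ylt_of_lead ht hodd hm (aop_stable hst u i hf) ?_
  have h1 := Xop_stable hst (fw u) (nI p t i) hf
  have h2 := Xop_stable hst (ew u) (nI p t (i+1 : Fin t)) hf
  rw [aop, LinearMap.sub_apply, LinearMap.comp_apply, LinearMap.comp_apply, map_sub, sub_eq_zero]
  rw [lead_XopL ht hodd _ (i+1) h1, lead_XopL ht hodd _ i h2, lead_XopL ht hodd _ i hf, lead_XopL ht hodd _ (i+1) hf]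
  simp only [map_sum, map_smul, Finset.smul_sum]
  have e : ∀ a b a' b', LOp p t m (i+1) a b (LOp p t m i a' b' (lead p t m d s f)) = LOp p t m i a' b' (LOp p t m (i+1) a b (lead p t m d s f)) :=
    fun a b a' b' => LOp_comm (fin_succ_ne ht i) _ _ _ _ _
  simp only [e]
  let T : Ix m → Ix m → Ix m → Ix m → LF p t m := fun a b a' b' =>
    (((lc (ew u) a : ℤ) : GaloisField p t) * ((ew u b : ℤ) : GaloisField p t)) •
      (((lc (fw u) a' : ℤ) : GaloisField p t) * ((fw u b' : ℤ) : GaloisField p t)) • LOp p t m i a' b' (LOp p t m (i+1) a b (lead p t m d s f))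
  have lhs : ∑ a, ∑ b, ∑ a', ∑ b', T a b a' b' = ∑ a', ∑ b', ∑ a, ∑ b, T a b a' b' := by
    calc _ = ∑ x : Ix m × Ix m, ∑ y : Ix m × Ix m, T x.1 x.2 y.1 y.2 := by simp only [Fintype.sum_prod_type]
      _ = ∑ y : Ix m × Ix m, ∑ x : Ix m × Ix m, T x.1 x.2 y.1 y.2 := Finset.sum_comm
      _ = _ := by simp only [Fintype.sum_prod_type]
  refine lhs.trans ?_
  refine Finset.sum_congr rfl fun a' _ => Finset.sum_congr rfl fun b' _ => Finset.sum_congr rfl fun a _ => Finset.sum_congr rfl fun b _ => ?_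
  exact smul_comm _ _ _

end PartE3

section PartE4
open MvPolynomial
variable {p t m d : ℕ} [Fact p.Prime] [NeZero t]

theorem sum_shift (f : Fin t → ℤ) : ∑ i, f (i+1) = ∑ i, f i := Equiv.sum_comp (Equiv.addRight (1 : Fin t)) f

theorem digits_zero (hd : d ≤ p ^ t - 2) (h : ∀ j : Fin t, digitp p d j = 0) : d = 0 := by
  have h2 : ∀ k, k ≤ t → d % p ^ k = 0 := by
    intro k
    induction k with
    | zero => intro _; simp [Nat.mod_one]
    | succ k ih =>
      intro hk
      have := h ⟨k, hk⟩
      unfold digitp at this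
      rw [Nat.mod_pow_succ, ih (by omega)]
      simp only at this
      rw [this, mul_zero, add_zero]
  have h3 := h2 t le_rfl
  have : 0 < p ^ t := by have := (Fact.out : p.Prime).pos; positivity
  rwa [Nat.mod_eq_of_lt (by omega)] at h3

theorem exists_good (hodd : Odd p) (hd : d ≤ p ^ t - 2) (hm : 2 ≤ m) {s s1 : Fin t → ℤ} {e e1 : Finset (Fin t)}
    (h : memCase p t m d s e) (h1 : memCase p t m d s1 e1) (hle : ∀ j, s1 j ≤ s j) (hne : s1 ≠ s) :
    ∃ i : Fin t, s1 (i+1) < s (i+1) ∧ (p:ℤ) ≤ lamOf p t d s i ∧ lamOf p t d s (i+1) < 2 * m * ((p:ℤ)-1) := by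
  rw [memCase_iff] at h h1
  obtain ⟨hb, hl, -⟩ := h
  obtain ⟨hb1, hl1, -⟩ := h1
  have hp : (3:ℤ) ≤ p := by exact_mod_cast p_ge3 hodd
  have hm' : (2:ℤ) ≤ m := by exact_mod_cast hm
  by_contra hcon
  push Not at hcon
  have hbig : (p:ℤ) ≤ 2 * m * ((p:ℤ)-1) := by nlinarith
  obtain ⟨j0, hj0⟩ : ∃ j, s1 j < s j := by
    by_contra hc
    push Not at hc
    exact hne (funext fun j => le_antisymm (hle j) (hc j))
  by_cases hA : ∃ i : Fin t, s1 (i+1) < s (i+1) ∧ lamOf p t d s i < p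
  · obtain ⟨i0, hi0⟩ := hA
    have hall := cyc_down (fun i : Fin t => s1 (i+1) < s (i+1) ∧ lamOf p t d s i < p) (by
      rintro i ⟨ha, hb2⟩
      have hD : s1 (i+1) < s (i+1) := by
        have hx := (hl1 (i+1)).1
        unfold lamOf at hb2 hx
        nlinarith
      refine ⟨hD, ?_⟩
      by_contra hc
      have := hcon i hD (by linarith)
      linarith) i0 hi0
    have hs1 : ∀ i, 1 ≤ s i := by
      intro i
      have h1 := (hall (i - 1)).1
      rw [sub_add_cancel] at h1
      have := (hb1 i).1
      omega
    have hsum : ∑ i : Fin t, (((p:ℤ)-1) * (s i - 1) + digitp p d (i:ℕ)) ≤ 0 := by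
      have e : ∑ i : Fin t, (((p:ℤ)-1) * (s i - 1) + digitp p d (i:ℕ)) = ∑ i : Fin t, (lamOf p t d s i - (p - 1)) := by
        have e2 : ∀ i : Fin t, lamOf p t d s i - (p - 1) = p * s (i+1) - s i + digitp p d (i:ℕ) - (p - 1) := fun i => rfl
        simp only [e2, Finset.sum_sub_distrib, Finset.sum_add_distrib, ← Finset.mul_sum, sum_shift]
        simp only [Finset.sum_const, Finset.card_univ, Fintype.card_fin, nsmul_eq_mul]
        ring
      rw [e]
      exact Finset.sum_nonpos fun i _ => by have := (hall i).2; omega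
    have hnn : ∀ i ∈ (Finset.univ : Finset (Fin t)), (0:ℤ) ≤ (((p:ℤ)-1) * (s i - 1) + digitp p d (i:ℕ)) := by
      intro i _
      have := hs1 i
      have : 0 ≤ ((p:ℤ)-1) * (s i - 1) := mul_nonneg (by linarith) (by linarith)
      positivity
    have hz := (Finset.sum_eq_zero_iff_of_nonneg hnn).1 (le_antisymm hsum (Finset.sum_nonneg hnn))
    have hz2 : ∀ i : Fin t, digitp p d (i:ℕ) = 0 ∧ s i = 1 := by
      intro i
      have h2 := hz i (Finset.mem_univ i)
      have := hs1 i
      have h3 : 0 ≤ ((p:ℤ)-1) * (s i - 1) := mul_nonneg (by linarith) (by linarith)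
      have h4 : (0:ℤ) ≤ digitp p d (i:ℕ) := by positivity
      refine ⟨by omega, ?_⟩
      have h5 : ((p:ℤ)-1) * (s i - 1) = 0 := by linarith
      rcases mul_eq_zero.1 h5 with h6 | h6
      · linarith
      · linarith
    have hd0 := digits_zero hd fun j => (hz2 j).1
    have := (hb1 j0).2.1 hd0
    have := (hz2 j0).2
    omega
  · push Not at hA
    have hQ : ∀ i, s1 i < s i → 2 * m * ((p:ℤ)-1) ≤ lamOf p t d s i := by
      intro i hi
      have h2 := hcon (i-1) (by rwa [sub_add_cancel]) (hA (i-1) (by rwa [sub_add_cancel]))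
      rwa [sub_add_cancel] at h2
    have hall : ∀ i, s1 i < s i := by
      by_contra hc
      push Not at hc
      obtain ⟨i1, hi1⟩ := hc
      have := cyc_down (fun i : Fin t => s i ≤ s1 i) (by
        intro i hi
        by_contra hc
        push Not at hc
        have h2 := hQ i hc
        have h3 := (hl1 i).2
        unfold lamOf at h2 h3
        nlinarith) i1 hi1 j0
      omega
    have hdl : ∀ i : Fin t, (digitp p d (i:ℕ) : ℤ) ≤ p - 1 := by
      intro i
      have := digit_lt (p := p) (d := d) (i:ℕ)
      omega
    have hsum : ∑ i : Fin t, (((p:ℤ)-1) * (2 * m - 1 - s i) + (p - 1 - digitp p d (i:ℕ))) ≤ 0 := by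
      have e : ∑ i : Fin t, (((p:ℤ)-1) * (2 * m - 1 - s i) + (p - 1 - digitp p d (i:ℕ))) = ∑ i : Fin t, (2 * m * ((p:ℤ) - 1) - lamOf p t d s i) := by
        have e2 : ∀ i : Fin t, 2 * m * ((p:ℤ) - 1) - lamOf p t d s i = 2 * m * ((p:ℤ) - 1) - (p * s (i+1) - s i + digitp p d (i:ℕ)) := fun i => rfl
        simp only [e2, Finset.sum_sub_distrib, Finset.sum_add_distrib, ← Finset.mul_sum, sum_shift]
        simp only [Finset.sum_const, Finset.card_univ, Fintype.card_fin, nsmul_eq_mul]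
        ring
      rw [e]
      exact Finset.sum_nonpos fun i _ => by have := hQ i (hall i); linarith
    have hnn : ∀ i ∈ (Finset.univ : Finset (Fin t)), (0:ℤ) ≤ (((p:ℤ)-1) * (2 * m - 1 - s i) + (p - 1 - digitp p d (i:ℕ))) := by
      intro i _
      have := (hb i).2.2
      have : 0 ≤ ((p:ℤ)-1) * (2 * m - 1 - s i) := mul_nonneg (by linarith) (by linarith)
      have := hdl i
      linarith
    have hz := (Finset.sum_eq_zero_iff_of_nonneg hnn).1 (le_antisymm hsum (Finset.sum_nonneg hnn))
    refine digits_full (p := p) hd fun i => ?_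
    have h2 := hz i (Finset.mem_univ i)
    have := (hb i).2.2
    have : 0 ≤ ((p:ℤ)-1) * (2 * m - 1 - s i) := mul_nonneg (by linarith) (by linarith)
    have := hdl i
    have : (digitp p d (i:ℕ) : ℤ) = p - 1 := by linarith
    omega

theorem drp_self (s : Fin t → ℤ) (j : Fin t) : drp s j j = s j - 1 := by simp [drp]
theorem drp_ne (s : Fin t → ℤ) {j i : Fin t} (h : i ≠ j) : drp s j i = s i := by simp [drp, h]
theorem drp_le (s : Fin t → ℤ) (j i : Fin t) : drp s j i ≤ s i := by
  by_cases h : i = j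
  · subst h; rw [drp_self]; omega
  · rw [drp_ne s h]

theorem exists_cover (hodd : Odd p) (ht : 1 < t) (hd : d ≤ p ^ t - 2) (hm : 2 ≤ m) {s s1 : Fin t → ℤ} {e e1 : Finset (Fin t)}
    (h : memCase p t m d s e) (h1 : memCase p t m d s1 e1) (hle : leSd p t m d s1 e1 s e) (hne : ¬ (s1 = s ∧ e1 = e)) :
    ∃ (i : Fin t) (e' : Finset (Fin t)), (p:ℤ) ≤ lamOf p t d s i ∧ lamOf p t d s (i+1) < 2 * m * ((p:ℤ)-1) ∧
      memCase p t m d (drp s (i+1)) e' ∧ leSd p t m d s1 e1 (drp s (i+1)) e' ∧ leSd p t m d (drp s (i+1)) e' s e := by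
  have hs : s1 ≠ s := by
    rintro rfl
    exact hne ⟨rfl, le_same h1 h hle⟩
  have hle' := le_iff.1 hle
  obtain ⟨i, hi1, hi2, hi3⟩ := exists_good hodd hd hm h h1 hle'.1 hs
  have hc := memCase_iff.1 h
  have hc1 := memCase_iff.1 h1
  have hle1 : ∀ j, s1 j ≤ drp s (i+1) j := by
    intro j
    by_cases hj : j = i+1
    · subst hj; rw [drp_self]; omega
    · rw [drp_ne s hj]; exact hle'.1 j
  let e' : Finset (Fin t) := Finset.univ.filter fun r => lamOf p t d (drp s (i+1)) r = m * ((p:ℤ)-1) ∧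
    (if s1 r = drp s (i+1) r ∧ s1 (r+1) = drp s (i+1) (r+1) then r ∈ e1 else r ∈ e)
  have he' : ∀ r, r ∈ e' ↔ lamOf p t d (drp s (i+1)) r = m * ((p:ℤ)-1) ∧
    (if s1 r = drp s (i+1) r ∧ s1 (r+1) = drp s (i+1) (r+1) then r ∈ e1 else r ∈ e) := fun r => by
      simp only [e', Finset.mem_filter, Finset.mem_univ, true_and]
  refine ⟨i, e', hi2, hi3, memCase_iff.2 ⟨fun j => ?_, fun j => ?_, fun j hj => ((he' j).1 hj).1⟩, le_iff.2 ⟨hle1, fun j ha hb hcc => ?_⟩,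
    le_iff.2 ⟨drp_le s _, fun j ha hb hcc => ?_⟩⟩
  · have h2 := hc1.1 j
    have h3 := hc.1 j
    have h4 := hle1 j
    have h5 := drp_le s (i+1) j
    exact ⟨by omega, fun h0 => by have := h2.2.1 h0; omega, by omega⟩
  · rw [lam_drp ht]
    have := hc.2.1 j
    have hp := p_ge3 hodd
    by_cases hj : j = i
    · subst hj
      rw [if_pos rfl, if_neg (fin_succ_ne ht j).symm]
      constructor <;> omega
    · by_cases hj2 : j = i + 1
      · subst hj2
        rw [if_neg hj, if_pos rfl]
        constructor <;> linarith
      · rw [if_neg hj, if_neg hj2]; constructor <;> linarith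
  · rw [he', if_pos ⟨ha, hb⟩, ← lam_congr ha hb]
    simp [hcc]
  · rw [he']
    simp only [hcc, true_and]
    split_ifs with hx
    · exact hle'.2 j (hx.1.trans ha) (hx.2.trans hb) ((lam_congr hx.1 hx.2).trans hcc)
    · rfl

theorem stable_inf {A B : Submodule (GaloisField p t) (FV p t m)} (hA : SpStable A) (hB : SpStable B) : SpStable (A ⊓ B) :=
  fun g hg h hh => ⟨hA g hg h hh.1, hB g hg h hh.2⟩

theorem stable_sup {A B : Submodule (GaloisField p t) (FV p t m)} (hA : SpStable A) (hB : SpStable B) : SpStable (A ⊔ B) := by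
  intro g hg h hh
  obtain ⟨a, ha, b, hb, rfl⟩ := Submodule.mem_sup.1 hh
  exact Submodule.mem_sup.2 ⟨_, hA g hg a ha, _, hB g hg b hb, rfl⟩

theorem lamN_le {s : Fin t → ℤ} {e : Finset (Fin t)} (h : memCase p t m d s e) (j : Fin t) : lamOfN p t d s j ≤ 2 * (m * (p-1)) := by
  have h1 := (memCase_iff.1 h).2.1 j
  zify
  rw [lamN_cast h1.1, p_cast]
  linarith [h1.2]

theorem lead_ne (ht : 1 < t) {s : Fin t → ℤ} {eps : Finset (Fin t)} (hm : memCase p t m d s eps)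
    {F : Fin t → PV p t m} (hF : ∀ j, (F j).IsHomogeneous (lamOfN p t d s j)) (hg : ∀ j, ∃ g, g ≤ topE p m ∧ coeff g (F j) ≠ 0) :
    lead p t m d s (PhiM p t m F) ≠ 0 := by
  choose e he1 he2 using hg
  intro h
  have h2 := congrFun h e
  rw [lead_Phi ht (fun _ => le_rfl) (fun j => ((memCase_iff.1 hm).2.1 j).1) hF, if_pos ⟨he1, rfl⟩] at h2
  exact Finset.prod_ne_zero_iff.2 (fun j _ => he2 j) h2

theorem Y_strict (hodd : Odd p) (ht : 1 < t) (hd : d ≤ p ^ t - 2) (hm2 : 2 ≤ m) {s : Fin t → ℤ} {eps : Finset (Fin t)} (hm : memCase p t m d s eps) :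
    ¬ Ymod p t m d s eps ≤ Yltmod p t m d s eps := by
  intro h
  choose F h1 h2 h3 using fun j : Fin t => exists_dig (K := GaloisField p t) hodd hm2 (lamN_le hm j) (j ∈ eps)
  refine lead_ne ht hm (fun j => (h1 j).1) (fun j => ?_) (lead_Ylt ht hodd hm (h (Phi_mem_Y hodd ht hd hm F h1)))
  obtain ⟨g, hg⟩ := h3 j
  exact ⟨g, h2 j g hg, hg⟩

end PartE4

section PartE5
open MvPolynomial
variable {p t m d : ℕ} [Fact p.Prime] [NeZero t]

def PP (p t m d : ℕ) [Fact p.Prime] [NeZero t] (s : Fin t → ℤ) (e : Finset (Fin t)) : Prop :=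
  ∀ W : Submodule (GaloisField p t) (FV p t m), SpStable W → W ≤ Ymod p t m d s e → ¬ W ≤ Yltmod p t m d s e →
    Ymod p t m d s e ≤ W

theorem PP_use (ht : 1 < t) (hodd : Odd p) (hd : d ≤ p ^ t - 2) {s : Fin t → ℤ} {e : Finset (Fin t)} (hm : memCase p t m d s e)
    (hP : PP p t m d s e) {M : Submodule (GaloisField p t) (FV p t m)} (hM : SpStable M) {f : FV p t m} (hf : f ∈ M)
    (hY : f ∈ Ymod p t m d s e) (hl : lead p t m d s f ≠ 0) : Ymod p t m d s e ≤ M :=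
  (hP (M ⊓ Ymod p t m d s e) (stable_inf hM (Y_stable hodd ht hd s e)) inf_le_right
    (fun h => hl (lead_Ylt ht hodd hm (h ⟨hf, hY⟩)))).trans inf_le_left

theorem sign_both (ht : 1 < t) (hodd : Odd p) {s : Fin t → ℤ} {e e' : Finset (Fin t)} (hm : memCase p t m d s e)
    (hm' : memCase p t m d s e') {i : Fin t} (hi : lamOf p t d s i = m * ((p:ℤ)-1)) (he : i ∈ e) (he' : i ∉ e')
    {f f' : FV p t m} (hf : f ∈ Ymod p t m d s e) (hf' : f' ∈ Ymod p t m d s e') (heq : lead p t m d s f = lead p t m d s f') :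
    lead p t m d s f' = 0 := by
  funext x
  by_cases hx : RT p t m d s x
  · have h1 := lead_sign ht hodd hm hf hx hi
    have h2 := lead_sign ht hodd hm' hf' hx hi
    rw [heq, h2] at h1
    simp only [pm, if_pos he, if_neg he'] at h1
    have h3 := sg_ne (K := GaloisField p t) hodd (hx.1 i)
    have h4 := two_ne (K := GaloisField p t) hodd
    have h5 : 2 * (sgE (GaloisField p t) (x i) * lead p t m d s f' x) = 0 := by linear_combination -h1
    have h6 := (mul_eq_zero.1 h5).resolve_left h4
    exact (mul_eq_zero.1 h6).resolve_left h3
  · exact lead_out _ hx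

theorem der_q (hodd : Odd p) {u v : Fin m} (huv : u ≠ v) :
    X (Sum.inl v : Ix m) * pderiv (Sum.inl u : Ix m) (monomial (qE p u v 0 (p-2) (p-1) 1) (1 : GaloisField p t)) = 0 ∧
    X (Sum.inr u : Ix m) * pderiv (Sum.inr v : Ix m) (monomial (qE p u v 0 (p-2) (p-1) 1) (1 : GaloisField p t)) =
      monomial (qE p u v 0 (p-1) (p-1) 0) 1 := by
  have hp := p_ge3 hodd
  constructor
  · rw [pderiv_monomial, qE_xu]; simp
  · rw [pderiv_monomial, qE_yv huv]
    have : qE p u v 0 (p-2) (p-1) 1 - Finsupp.single (Sum.inr v : Ix m) 1 = qE p u v 0 (p-2) (p-1) 0 := by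
      ext a
      rw [Finsupp.tsub_apply, Finsupp.single_apply]
      rcases a with a | a
      · simp [qE]
      · simp only [qE, mkE_apply, Sum.elim_inr, Sum.inr.injEq]
        by_cases h1 : a = u
        · subst h1; simp [huv.symm]
        · by_cases h2 : a = v
          · subst h2; simp [h1]
          · simp [h1, h2, Ne.symm h2]
    rw [this, X_mul_qE]
    have : p - 2 + 1 = p - 1 := by omega
    rw [this]; simp

theorem X_mul_coeff {u : Fin m} {F : PV p t m} (hodd : Odd p) (h : ∀ g, coeff g F ≠ 0 → g ≤ topE p m ∧ g (.inr u) ≤ p - 2)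
    (h2 : ∃ g, coeff g F ≠ 0) : ∃ g, g ≤ topE p m ∧ coeff g (X (Sum.inr u : Ix m) * F) ≠ 0 := by
  obtain ⟨g, hg⟩ := h2
  have hp := p_ge3 hodd
  refine ⟨Finsupp.single (.inr u) 1 + g, ?_, by rwa [coeff_X_mul]⟩
  obtain ⟨h3, h4⟩ := h g hg
  rw [le_topE] at h3 ⊢
  intro a
  have := h3 a
  rw [Finsupp.add_apply, Finsupp.single_apply]
  split_ifs with hh
  · subst hh; omega
  · omega

theorem cover_step (ht : 1 < t) (hodd : Odd p) (hd : d ≤ p ^ t - 2) (hm2 : 2 ≤ m) {s : Fin t → ℤ} {e : Finset (Fin t)}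
    (hm : memCase p t m d s e) {M : Submodule (GaloisField p t) (FV p t m)} (hM : SpStable M)
    (hIH : ∀ s1 e1, memCase p t m d s1 e1 → leSd p t m d s1 e1 s e → ¬ (s1 = s ∧ e1 = e) → PP p t m d s1 e1 ∧ Yltmod p t m d s1 e1 ≤ M)
    (haop : ∀ (u : Fin m) (i : Fin t) (f : FV p t m), f ∈ Ymod p t m d s e → aop p t u i f ∈ M)
    {i : Fin t} {e' : Finset (Fin t)} (hi : (p:ℤ) ≤ lamOf p t d s i) (hj : lamOf p t d s (i+1) < 2 * m * ((p:ℤ)-1))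
    (hm' : memCase p t m d (drp s (i+1)) e') (hle : leSd p t m d (drp s (i+1)) e' s e) :
    Ymod p t m d (drp s (i+1)) e' ≤ M := by
  obtain ⟨u, v, huv⟩ := two_idx hm2
  have hp := p_ge3 hodd
  have hij : i + 1 ≠ i := fin_succ_ne ht i
  have hc := memCase_iff.1 hm
  have hc' := memCase_iff.1 hm'
  have hle' := le_iff.1 hle
  set s' := drp s (i+1) with hs'
  have hlam : ∀ j, lamOf p t d s' j = lamOf p t d s j - (if j = i then (p:ℤ) else 0) + (if j = i + 1 then 1 else 0) := lam_drp ht s i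
  have hs'ne : s' ≠ s := fun h => by
    have := congrFun h (i+1)
    rw [hs', drp_self] at this; omega
  have hNi : lamOfN p t d s' i = lamOfN p t d s i - p := by
    have h1 := hlam i
    rw [if_pos rfl, if_neg hij.symm] at h1
    have h2 := lamN_cast (hc.2.1 i).1
    have h3 := lamN_cast (hc'.2.1 i).1
    omega
  have hpi : p ≤ lamOfN p t d s i := by
    have h2 := lamN_cast (hc.2.1 i).1
    omega
  have hNj : lamOfN p t d s' (i+1) = lamOfN p t d s (i+1) + 1 := by
    have h1 := hlam (i+1)
    rw [if_pos rfl, if_neg hij] at h1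
    have h2 := lamN_cast (hc.2.1 (i+1)).1
    have h3 := lamN_cast (hc'.2.1 (i+1)).1
    omega
  have hNr : ∀ r, r ≠ i → r ≠ i+1 → lamOfN p t d s' r = lamOfN p t d s r := by
    intro r h1 h2
    have h3 := hlam r
    rw [if_neg h1, if_neg h2] at h3
    unfold lamOfN
    rw [h3]; simp
  obtain ⟨FJ, hJ1, hJ2, hJ3, hJ4⟩ := exists_J (K := GaloisField p t) hodd huv (lam := lamOfN p t d s (i+1))
    (by rw [← hNj]; exact lamN_le hm' _) (i+1 ∈ e) (i+1 ∈ e')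
  obtain ⟨FI, g, c, hI1, hI2, hc0, hg1, hg2, hg3⟩ := exists_I (t := t) hodd huv hpi (lamN_le hm i) (i ∈ e)
  choose F0 h01 h02 h03 using fun j : Fin t => exists_dig (K := GaloisField p t) hodd hm2 (lamN_le hm j) (j ∈ e)
  let F : Fin t → PV p t m := fun j => if j = i then FI else if j = i+1 then FJ else F0 j
  have Fi : F i = FI := by simp [F]
  have Fj : F (i+1) = FJ := by simp only [F, if_neg hij, if_true]
  have Fr : ∀ r, r ≠ i → r ≠ i+1 → F r = F0 r := fun r h1 h2 => by simp only [F, if_neg h1, if_neg h2]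
  have FS : ∀ j, SSg p m (lamOfN p t d s j) (j ∈ e) (F j) := by
    intro j
    by_cases h1 : j = i
    · subst h1; rw [Fi]; exact hI1
    · by_cases h2 : j = i+1
      · subst h2; rw [Fj]; exact hJ1
      · rw [Fr j h1 h2]; exact h01 j
  have FG : ∀ j, G0 p t u (F j) := by
    intro j
    by_cases h1 : j = i
    · subst h1; rw [Fi]; exact hI2.1
    · by_cases h2 : j = i+1
      · subst h2; rw [Fj]; exact G0_red u fun g hg => (hJ3 g hg).1
      · rw [Fr j h1 h2]; exact G0_red u (h02 j)
  have hA := haop u i _ (Phi_mem_Y hodd ht hd hm F FS)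
  rw [aop_Phi ht hodd u i FG (by rw [Fj]; exact GJ_red u hJ3) (by rw [Fi]; exact hI2), Submodule.neg_mem_iff] at hA
  set F1 := Function.update F (i+1) (X (.inr u) * F (i+1)) with hF1
  have F1j : F1 (i+1) = X (.inr u) * FJ := by rw [hF1, Function.update_self, Fj]
  have F1r : ∀ r, r ≠ i → r ≠ i+1 → F1 r = F0 r := fun r h1 h2 => by rw [hF1, Function.update_of_ne h2, Fr r h1 h2]
  have F1S : ∀ r, r ≠ i → SSg p m (lamOfN p t d s' r) (r ∈ e') (F1 r) := by
    intro r hr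
    by_cases h2 : r = i+1
    · subst h2; rw [F1j, hNj]; exact hJ2
    · rw [F1r r hr h2, hNr r hr h2]
      refine SSg_pl (h01 r) fun hh => hle'.2 r (drp_ne s h2) (drp_ne s fun h3 => hr (add_right_cancel h3)) ?_
      rw [← lamN_mu (hc'.2.1 r).1, hNr r hr h2, hh]
  have F1c : ∀ r, r ≠ i → ∃ g, g ≤ topE p m ∧ coeff g (F1 r) ≠ 0 := by
    intro r hr
    by_cases h2 : r = i+1
    · subst h2; rw [F1j]; exact X_mul_coeff hodd hJ3 hJ4
    · rw [F1r r hr h2]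
      obtain ⟨g, hg⟩ := h03 r
      exact ⟨g, h02 r g hg, hg⟩
  have UH : ∀ {H : PV p t m}, H.IsHomogeneous (lamOfN p t d s' i) → ∀ j, (Function.update F1 i H j).IsHomogeneous (lamOfN p t d s' j) := by
    intro H hH j
    by_cases h1 : j = i
    · subst h1; rw [Function.update_self]; exact hH
    · rw [Function.update_of_ne h1]; exact (F1S j h1).1
  have Uc : ∀ {H : PV p t m}, H.IsHomogeneous (lamOfN p t d s' i) → (∃ g, g ≤ topE p m ∧ coeff g H ≠ 0) →
      lead p t m d s' (PhiM p t m (Function.update F1 i H)) ≠ 0 := by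
    intro H hH hH2
    refine lead_ne ht hm' (UH hH) fun j => ?_
    by_cases h1 : j = i
    · subst h1; rw [Function.update_self]; exact hH2
    · rw [Function.update_of_ne h1]; exact F1c j h1
  have UY : ∀ {H : PV p t m} {e2 : Finset (Fin t)}, memCase p t m d s' e2 → (∀ r, r ≠ i → (r ∈ e2 ↔ r ∈ e')) →
      SSg p m (lamOfN p t d s' i) (i ∈ e2) H → PhiM p t m (Function.update F1 i H) ∈ Ymod p t m d s' e2 := by
    intro H e2 he2 hag hH
    refine Phi_mem_Y hodd ht hd he2 _ fun j => ?_
    by_cases h1 : j = i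
    · subst h1; rw [Function.update_self]; exact hH
    · rw [Function.update_of_ne h1]; exact SSg_pl (F1S j h1) fun _ => (hag j h1).symm
  have hgdeg : g.degree = lamOfN p t d s' i := by rw [hNi, hg2]
  have hIH' := hIH s' e' hm' hle fun h => hs'ne h.1
  by_cases hmu : lamOfN p t d s' i = m * (p-1)
  swap
  · refine PP_use ht hodd hd hm' hIH'.1 hM hA (UY hm' (fun _ _ => Iff.rfl) (SSg_ne (monomial_hom c hgdeg) hmu))
      (Uc (monomial_hom c hgdeg) ⟨g, hg1, ?_⟩)
    rw [coeff_monomial, if_pos rfl]; exact hc0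
  have hmu' := (lamN_mu (m := m) (hc'.2.1 i).1).1 hmu
  have hgq := hg3 (by rw [← hNi]; exact hmu)
  let Lm : PV p t m →ₗ[GaloisField p t] FV p t m := (PhiM p t m).toLinearMap F1 i
  have Lm_app : ∀ H, PhiM p t m (Function.update F1 i H) = Lm H := fun H => rfl
  simp only [Lm_app] at hA Uc UY
  have hAg : Lm (monomial g 1) ∈ M := by
    have h1 : (monomial g (1 : GaloisField p t)) = c⁻¹ • monomial g c := by
      rw [smul_monomial, smul_eq_mul, inv_mul_cancel₀ hc0]
    rw [h1, map_smul]
    exact M.smul_mem _ hA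
  -- the two signatures
  let ep := insert i e'
  let em := e'.erase i
  have iep : i ∈ ep := Finset.mem_insert_self i e'
  have iem : i ∉ em := Finset.notMem_erase i e'
  have agp : ∀ r, r ≠ i → (r ∈ ep ↔ r ∈ e') := fun r hr => by simp [ep, hr]
  have agm : ∀ r, r ≠ i → (r ∈ em ↔ r ∈ e') := fun r hr => by simp [em, hr]
  have gen : ∀ e2 : Finset (Fin t), (∀ r, r ≠ i → (r ∈ e2 ↔ r ∈ e')) → memCase p t m d s' e2 ∧ leSd p t m d s' e2 s e := by
    intro e2 h2
    refine ⟨memCase_iff.2 ⟨hc'.1, hc'.2.1, fun j hj => ?_⟩, le_iff.2 ⟨hle'.1, fun j h3 h4 h5 => ?_⟩⟩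
    · by_cases h1 : j = i
      · subst h1; exact hmu'
      · exact hc'.2.2 j ((h2 j h1).1 hj)
    · by_cases h1 : j = i
      · subst h1; rw [hs', drp_self] at h4; omega
      · rw [h2 j h1]; exact hle'.2 j h3 h4 h5
  obtain ⟨mp, lp⟩ := gen ep agp
  obtain ⟨mm, lm⟩ := gen em agm
  have hIp := hIH s' ep mp lp fun h => hs'ne h.1
  have hIm := hIH s' em mm lm fun h => hs'ne h.1
  have hgd : g.degree = m * (p-1) := by rw [hgdeg, hmu]
  let prp : PV p t m := monomial g 1 + monomial (twE p g) (pm (GaloisField p t) (i ∈ ep) * sgE (GaloisField p t) g)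
  let prm : PV p t m := monomial g 1 + monomial (twE p g) (pm (GaloisField p t) (i ∈ em) * sgE (GaloisField p t) g)
  have sp : SSg p m (lamOfN p t d s' i) (i ∈ ep) prp := by rw [hmu]; exact pr_SSg hodd _ hg1 hgd
  have sm : SSg p m (lamOfN p t d s' i) (i ∈ em) prm := by rw [hmu]; exact pr_SSg hodd _ hg1 hgd
  have hsum : prp + prm = (2 : GaloisField p t) • monomial g 1 := by
    simp only [prp, prm, pm, if_pos iep, if_neg iem]
    rw [add_add_add_comm, ← map_add (monomial (twE p g)), ← two_smul (GaloisField p t)]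
    simp
  have h2ne := two_ne (K := GaloisField p t) hodd
  have Ysp := UY mp agp sp
  have Ysm := UY mm agm sm
  have hLs : Lm prp + Lm prm = (2 : GaloisField p t) • Lm (monomial g 1) := by rw [← map_add, hsum, map_smul]
  have hgY : Lm (monomial g 1) ∈ Ymod p t m d s' ep ⊔ Ymod p t m d s' em := by
    have h3 : Lm (monomial g 1) = (2 : GaloisField p t)⁻¹ • (Lm prp + Lm prm) := by
      rw [hLs, smul_smul, inv_mul_cancel₀ h2ne, one_smul]
    rw [h3]
    exact Submodule.smul_mem _ _ (Submodule.add_mem_sup Ysp Ysm)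
  let N := M ⊓ (Ymod p t m d s' ep ⊔ Ymod p t m d s' em)
  have hNst : SpStable N := stable_inf hM (stable_sup (Y_stable hodd ht hd _ _) (Y_stable hodd ht hd _ _))
  have hNc : LClosed (N.map (lead p t m d s')) := by
    refine lead_closed' hNst fun w i f hf => ?_
    obtain ⟨a, ha, b, hb, rfl⟩ := Submodule.mem_sup.1 hf.2
    rw [map_add, map_add, lead_XopL ht hodd w i ha, lead_XopL ht hodd w i hb, map_add]
    simp only [map_add, smul_add, Finset.sum_add_distrib]
  obtain ⟨n, hn, hnl⟩ := hNc.2.2 i v u huv.symm _ ⟨Lm (monomial g 1), ⟨hAg, hgY⟩, rfl⟩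
  set q' := qE p u v 0 (p-1) (p-1) 0 with hq'
  have hq'le : q' ≤ topE p m := qE_le (by omega) le_rfl le_rfl (by omega)
  have hq'tw : twE p q' = q' := by rw [hq', qE_tw]; simp
  have hq'deg : q'.degree = lamOfN p t d s' i := by rw [hmu]; exact qE_deg huv (by omega)
  have hlead : lead p t m d s' n = - lead p t m d s' (Lm (monomial q' 1)) := by
    rw [hnl]
    funext x
    have hd1 := der_q (t := t) hodd huv
    rw [← hgq] at hd1
    have hUi := UH (monomial_hom (1 : GaloisField p t) hgdeg)
    have k1 := LOp_Phi (d := d) ht (fun j => le_refl (s' j)) (fun j => (hc'.2.1 j).1) hUi i (.inl v) (.inl u) x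
    have k2 := LOp_Phi (d := d) ht (fun j => le_refl (s' j)) (fun j => (hc'.2.1 j).1) hUi i (.inr u) (.inr v) x
    have k3 := lead_Phi (d := d) ht (fun j => le_refl (s' j)) (fun j => (hc'.2.1 j).1) (UH (monomial_hom (1 : GaloisField p t) hq'deg)) x
    rw [Function.update_self, Function.update_idem] at k1 k2
    rw [hd1.1] at k1
    rw [hd1.2] at k2
    have k0 : (∏ j, coeff (x j) (Function.update F1 i (0 : PV p t m) j)) = 0 :=
      Finset.prod_eq_zero (Finset.mem_univ i) (by rw [Function.update_self, coeff_zero])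
    rw [k0, ite_self] at k1
    rw [Pi.sub_apply, Pi.neg_apply]
    change LOp p t m i _ _ (lead p t m d s' (PhiM p t m (Function.update F1 i (monomial g 1)))) x -
      LOp p t m i _ _ (lead p t m d s' (PhiM p t m (Function.update F1 i (monomial g 1)))) x = - lead p t m d s' (PhiM p t m (Function.update F1 i (monomial q' 1))) x
    rw [k1, k2, k3, zero_sub]
  have Yq : Lm (monomial q' 1) ∈ Ymod p t m d s' ep := UY mp agp (self_SSg iep hq'le hq'tw _ hq'deg)
  obtain ⟨np, hnp, nm, hnm, hnn⟩ := Submodule.mem_sup.1 hn.2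
  have hnm0 : lead p t m d s' nm = 0 := by
    refine sign_both ht hodd mp mm hmu' iep iem (f := - Lm (monomial q' 1) - np) (Submodule.sub_mem _ (Submodule.neg_mem _ Yq) hnp) hnm ?_
    rw [map_sub, map_neg, ← hlead, ← hnn, map_add]; abel
  have hnmM : nm ∈ M := hIm.2 (Ylt_of_lead ht hodd mm hnm hnm0)
  have hnpM : np ∈ M := by
    have : np = n - nm := by rw [← hnn]; abel
    rw [this]; exact M.sub_mem hn.1 hnmM
  have hYp : Ymod p t m d s' ep ≤ M := by
    refine PP_use ht hodd hd mp hIp.1 hM hnpM hnp ?_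
    have h5 : lead p t m d s' np = - lead p t m d s' (Lm (monomial q' 1)) := by
      rw [← hlead, ← hnn, map_add, hnm0, add_zero]
    rw [h5, neg_ne_zero]
    refine Uc (monomial_hom _ hq'deg) ⟨q', hq'le, ?_⟩
    rw [coeff_monomial, if_pos rfl]; exact one_ne_zero
  have hYm : Ymod p t m d s' em ≤ M := by
    have h6 : Lm prm ∈ M := by
      have : Lm prm = (2 : GaloisField p t) • Lm (monomial g 1) - Lm prp := by rw [← hLs]; abel
      rw [this]
      exact M.sub_mem (M.smul_mem _ hAg) (hYp Ysp)
    refine PP_use ht hodd hd mm hIm.1 hM h6 Ysm (Uc sm.1 ⟨g, hg1, ?_⟩)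
    have htw : twE p g ≠ g := by
      intro h
      have := DFunLike.congr_fun h (Sum.inl u)
      rw [hgq, qE_tw, qE_xu, qE_xu] at this
      omega
    simp only [prm]
    rw [pr_ne _ htw]; exact one_ne_zero
  by_cases hie : i ∈ e'
  · have : ep = e' := Finset.insert_eq_of_mem hie
    rw [← this]; exact hYp
  · have : em = e' := Finset.erase_eq_of_notMem hie
    rw [← this]; exact hYm

end PartE5

section PartE6
open MvPolynomial
variable {p t m d : ℕ} [Fact p.Prime] [NeZero t]

theorem sum_lt {s s1 : Fin t → ℤ} {e e1 : Finset (Fin t)} (h : memCase p t m d s e) (h1 : memCase p t m d s1 e1)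
    (hle : leSd p t m d s1 e1 s e) (hne : ¬ (s1 = s ∧ e1 = e)) : (∑ j, s1 j).toNat < (∑ j, s j).toNat := by
  have hs : s1 ≠ s := by
    rintro rfl
    exact hne ⟨rfl, le_same h1 h hle⟩
  have hle' := (le_iff.1 hle).1
  have h3 : ∑ j, s1 j < ∑ j, s j := by
    refine Finset.sum_lt_sum (fun j _ => hle' j) ?_
    by_contra hc
    push Not at hc
    exact hs (funext fun j => le_antisymm (hle' j) (hc j (Finset.mem_univ j)))
  have h4 : 0 ≤ ∑ j, s1 j := Finset.sum_nonneg fun j _ => ((memCase_iff.1 h1).1 j).1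
  omega

theorem PP_all (ht : 1 < t) (hodd : Odd p) (hd : d ≤ p ^ t - 2) (hm2 : 2 ≤ m) : ∀ (n : ℕ) (s : Fin t → ℤ) (e : Finset (Fin t)),
    (∑ j, s j).toNat = n → memCase p t m d s e → PP p t m d s e := by
  intro n
  induction n using Nat.strong_induction_on with
  | _ n ih =>
  intro s e hsn hm W hW hWY hn
  have IH : ∀ s1 e1, memCase p t m d s1 e1 → leSd p t m d s1 e1 s e → ¬ (s1 = s ∧ e1 = e) → PP p t m d s1 e1 := by
    intro s1 e1 h1 h2 h3
    exact ih _ (by rw [← hsn]; exact sum_lt hm h1 h2 h3) s1 e1 rfl h1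
  have hsup := W_sup ht hodd hd hm hW hWY hn
  by_contra hcon
  have hns : ¬ Yltmod p t m d s e ≤ W := fun h => hcon (hsup.trans (sup_le le_rfl h))
  let A : Set (Submodule (GaloisField p t) (FV p t m)) := {M | SpStable M ∧ W ≤ M ∧ ¬ Yltmod p t m d s e ≤ M}
  obtain ⟨M, ⟨hM, hWM, hMn⟩, hmax⟩ := (wellFounded_gt (α := Submodule (GaloisField p t) (FV p t m))).has_min A ⟨W, hW, le_rfl, hns⟩
  have hlow : ∀ s1 e1, memCase p t m d s1 e1 → leSd p t m d s1 e1 s e → ¬ (s1 = s ∧ e1 = e) → Yltmod p t m d s1 e1 ≤ M := by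
    intro s1 e1 h1 h2 h3
    by_contra h4
    have h5 : Yltmod p t m d s e ≤ M ⊔ Yltmod p t m d s1 e1 := by
      by_contra h6
      refine hmax (M ⊔ Yltmod p t m d s1 e1) ⟨stable_sup hM (Ylt_stable hodd ht hd h1), hWM.trans le_sup_left, h6⟩ ?_
      refine lt_of_le_of_ne le_sup_left fun h7 => h4 ?_
      rw [h7]; exact le_sup_right
    have h6 : Ymod p t m d s1 e1 ≤ M ⊔ Yltmod p t m d s1 e1 := (Y_le_Ylt h1 hm h2 h3).trans h5
    by_cases h7 : M ⊓ Ymod p t m d s1 e1 ≤ Yltmod p t m d s1 e1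
    · refine Y_strict hodd ht hd hm2 h1 fun y hy => ?_
      obtain ⟨a, ha, b, hb, rfl⟩ := Submodule.mem_sup.1 (h6 hy)
      refine Submodule.add_mem _ (h7 ⟨ha, ?_⟩) hb
      have := Submodule.sub_mem _ hy (Ylt_le_Y s1 e1 hb)
      rwa [add_sub_cancel_right] at this
    · have h8 := IH s1 e1 h1 h2 h3 _ (stable_inf hM (Y_stable hodd ht hd s1 e1)) inf_le_right h7
      exact h4 ((Ylt_le_Y s1 e1).trans (h8.trans inf_le_left))
  have haop : ∀ (u : Fin m) (i : Fin t) (f : FV p t m), f ∈ Ymod p t m d s e → aop p t u i f ∈ M := by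
    intro u i f hf
    obtain ⟨w, hw, y, hy, rfl⟩ := Submodule.mem_sup.1 (hsup hf)
    rw [map_add]
    refine M.add_mem (hWM (aop_stable hW u i hw)) ?_
    have h9 : Yltmod p t m d s e ≤ M.comap (aop p t u i) := by
      refine Submodule.span_le.2 ?_
      rintro f ⟨s1, e1, h1, h2, h3, h4⟩
      exact hlow s1 e1 h1 h2 h3 (aop_Y ht hodd hd h1 u i (Submodule.subset_span ⟨s1, e1, h1, leS_refl _ _, h4⟩))
    exact h9 hy
  refine hMn (Submodule.span_le.2 ?_)
  rintro f ⟨s1, e1, h1, h2, h3, h4⟩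
  obtain ⟨i, e', k1, k2, k3, k4, k5⟩ := exists_cover hodd ht hd hm2 hm h1 h2 h3
  have h5 := cover_step ht hodd hd hm2 hm hM (fun s1 e1 a b c => ⟨IH s1 e1 a b c, hlow s1 e1 a b c⟩) haop k1 k2 k3 k5
  exact h5 (Y_mono k4 (Submodule.subset_span ⟨s1, e1, h1, leS_refl _ _, h4⟩))

end PartE6
/-- `Y(s,ε)[d]` and `Y_<(s,ε)[d]` are `kSp(V)`-submodules of `k[V]`, `Y_<(s,ε)[d]` is
properly contained in `Y(s,ε)[d]`, and every `kSp(V)`-submodule properly contained in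
`Y(s,ε)[d]` is contained in `Y_<(s,ε)[d]`: it is the unique maximal `kSp(V)`-submodule
of `Y(s,ε)[d]`. (For `d = 0` read `Y(s,ε)` and `Y_<(s,ε)`.) -/
theorem Ylt_unique_maximal (p t m d : ℕ) [Fact p.Prime] [NeZero t]
    (hodd : Odd p) (ht : 1 < t) (hm : 2 ≤ m) (hd : d ≤ p ^ t - 2)
    (s : Fin t → ℤ) (eps : Finset (Fin t))
    (hmem : memCase p t m d s eps) :
    SpStable (Ymod p t m d s eps) ∧ SpStable (Yltmod p t m d s eps) ∧
    Yltmod p t m d s eps < Ymod p t m d s eps ∧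
    ∀ W : Submodule (GaloisField p t) (SympV p t m → GaloisField p t),
      SpStable W → W < Ymod p t m d s eps → W ≤ Yltmod p t m d s eps := by
  refine ⟨Y_stable hodd ht hd s eps, Ylt_stable hodd ht hd hmem,
    lt_of_le_not_ge (Ylt_le_Y s eps) (Y_strict hodd ht hd hm hmem), fun W hW hlt => ?_⟩
  by_contra hn
  exact not_le_of_gt hlt (PP_all ht hodd hd hm _ s eps rfl hmem W hW hlt.le hn)

end
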